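/- arXiv:1602.00166 — 5 statements merged into one kernel-verified Lean document; each statement's English description precedes it below -/
import Mathlib

section
/- (Cai–Stanley) Fix n ≥ 1 and let M_n be the p(n)×p(n) integer matrix with rows and columns indexed by the partitions of n, whose (λ, ν)-entry equals the number of partitions μ of n+1 whose Young diagram contains both the Young diagram of λ and the Young diagram of ν. Let t be an indeterminate. Then the matrix M_n + tI over the polynomial ring ℤ[t] has a Smith normal form over ℤ[t]: there exist matrices P and Q over ℤ[t], invertible over ℤ[t], such that P(M_n + tI)Q is diagonal with each diagonal entry dividing the next. -/
open scoped Classical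

/-- Young-diagram containment of partitions: `a ⊆ b` iff `a_i ≤ b_i` for all `i`,
equivalently the conjugate parts satisfy `a'_j ≤ b'_j` for all `j ≥ 1`, where
`a'_j` is the number of parts of `a` that are `≥ j`. -/
def PartitionLE {n m : ℕ} (a : Nat.Partition n) (b : Nat.Partition m) : Prop :=
  ∀ j : ℕ, 1 ≤ j →
    Multiset.card (a.parts.filter (fun p => j ≤ p)) ≤
      Multiset.card (b.parts.filter (fun p => j ≤ p))

/-- The matrix of the operator `ψ_n(f) = (∂/∂p₁)(p₁ f)` in the Schur basis: rows and
columns are indexed by partitions of `n`, and the `(λ, ν)` entry is the number of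
partitions `μ ⊢ n+1` whose Young diagram contains those of both `λ` and `ν`. -/
noncomputable def psiMatrix (n : ℕ) :
    Matrix (Nat.Partition n) (Nat.Partition n) ℤ :=
  fun lam nu =>
    (Nat.card {μ : Nat.Partition (n + 1) // PartitionLE lam μ ∧ PartitionLE nu μ} : ℤ)

/-- The matrix `ψ_n + t·I` over the polynomial ring `ℤ[t]`. -/
noncomputable def psiMatrixT (n : ℕ) :
    Matrix (Nat.Partition n) (Nat.Partition n) (Polynomial ℤ) :=
  (psiMatrix n).map Polynomial.C +
    (Polynomial.X : Polynomial ℤ) • (1 : Matrix (Nat.Partition n) (Nat.Partition n) (Polynomial ℤ))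

namespace CaiStanley

section Chains

variable {ι C R : Type*} [Fintype ι] [DecidableEq ι] [CommRing R]

/-- A matrix that is unitriangular with respect to a statistic has determinant one. -/
theorem det_eq_one_of_unitriangular (A : Matrix ι ι R) (stat : ι → ℕ) (hdiag : ∀ i, A i i = 1)
    (hoff : ∀ i j, i ≠ j → stat j ≤ stat i → A i j = 0) : A.det = 1 := by
  have hA : A.BlockTriangular stat := by
    intro i j hij
    refine hoff i j ?_ hij.le
    rintro rfl
    exact lt_irrefl _ hij
  rw [hA.det]
  refine Finset.prod_eq_one fun a _ => ?_
  have : A.toSquareBlock stat a = 1 := by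
    ext i j
    by_cases hij : i = j
    · subst hij
      simp [Matrix.toSquareBlock, Matrix.toSquareBlockProp, hdiag]
    · rw [Matrix.one_apply_ne hij]
      have h1 : (i : ι) ≠ j := fun h => hij (Subtype.ext h)
      exact hoff i j h1 (by rw [i.2, j.2])
  rw [this, Matrix.det_one]

theorem det_eq_one_of_unitriangular' (A : Matrix ι ι R) (stat : ι → ℕ) (hdiag : ∀ i, A i i = 1)
    (hoff : ∀ i j, i ≠ j → stat i ≤ stat j → A i j = 0) : A.det = 1 := by
  rw [← Matrix.det_transpose]
  exact det_eq_one_of_unitriangular _ stat hdiag fun i j hij h => hoff j i hij.symm h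

/-- A matrix which is bidiagonal along a family of disjoint chains is equivalent to a diagonal
matrix, with a `1` for each element that is not the last one of its chain and, up to sign,
the product of the diagonal entries along the chain for each last element. -/
theorem exists_diagonalization_of_chains (chain : ι → C) (pos : ι → ℕ) (d : ι → R)
    (inj : ∀ μ ν, chain μ = chain ν → pos μ = pos ν → μ = ν)
    (down : ∀ μ, pos μ ≠ 0 → ∃ ν, chain ν = chain μ ∧ pos ν + 1 = pos μ)
    (B : Matrix ι ι R)
    (hB : ∀ μ ν, B μ ν = if μ = ν then d μ else
      if chain μ = chain ν ∧ pos ν = pos μ + 1 then 1 else 0) :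
    ∃ P Q : Matrix ι ι R, IsUnit P.det ∧ IsUnit Q.det ∧
      P * B * Q = Matrix.diagonal fun μ =>
        if ∃ ν, chain ν = chain μ ∧ pos ν = pos μ + 1 then 1
        else (-1) ^ pos μ * ∏ κ with chain κ = chain μ, d κ := by
  have down' : ∀ k μ, k ≤ pos μ → ∃ ν, chain ν = chain μ ∧ pos ν + k = pos μ := by
    intro k
    induction k with
    | zero => exact fun μ _ => ⟨μ, rfl, rfl⟩
    | succ k ih =>
      intro μ hμ
      obtain ⟨ν, h1, h2⟩ := ih μ (by omega)
      obtain ⟨κ, h3, h4⟩ := down ν (by omega)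
      exact ⟨κ, h3.trans h1, by omega⟩
  have hstart : ∀ μ, ∃ ν, chain ν = chain μ ∧ pos ν = 0 := fun μ => by
    obtain ⟨ν, h1, h2⟩ := down' (pos μ) μ le_rfl
    exact ⟨ν, h1, by omega⟩
  choose start hs1 hs2 using hstart
  let NE : ι → Prop := fun μ => ∃ ν, chain ν = chain μ ∧ pos ν = pos μ + 1
  have ends : ∀ μ ν, ¬ NE μ → chain μ = chain ν → pos ν ≤ pos μ := by
    intro μ ν hμ hc
    by_contra! hlt
    obtain ⟨κ, h1, h2⟩ := down' (pos ν - pos μ - 1) ν (by omega)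
    exact hμ ⟨κ, h1.trans hc.symm, by omega⟩
  let f : ι → ι := fun μ => if h : NE μ then h.choose else start μ
  have f_ne : ∀ μ, NE μ → chain (f μ) = chain μ ∧ pos (f μ) = pos μ + 1 := by
    intro μ h
    simp only [f, dif_pos h]
    exact h.choose_spec
  have f_end : ∀ μ, ¬ NE μ → chain (f μ) = chain μ ∧ pos (f μ) = 0 := by
    intro μ h
    simp only [f, dif_neg h]
    exact ⟨hs1 μ, hs2 μ⟩
  have f_chain : ∀ μ, chain (f μ) = chain μ := fun μ => by
    by_cases h : NE μ
    · exact (f_ne μ h).1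
    · exact (f_end μ h).1
  have f_inj : Function.Injective f := by
    intro μ ν h
    have hc : chain μ = chain ν := by rw [← f_chain μ, h, f_chain]
    refine inj μ ν hc ?_
    by_cases h1 : NE μ <;> by_cases h2 : NE ν
    · have := (f_ne μ h1).2
      have := (f_ne ν h2).2
      rw [h] at *
      omega
    · have := (f_ne μ h1).2
      have := (f_end ν h2).2
      rw [h] at *
      omega
    · have := (f_end μ h1).2
      have := (f_ne ν h2).2
      rw [h] at *
      omega
    · exact le_antisymm (ends ν μ h2 hc.symm) (ends μ ν h1 hc)
  let σ : Equiv.Perm ι := Equiv.ofBijective f (Finite.injective_iff_bijective.mp f_inj)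
  let g : ι → R := fun μ => if NE μ then 1 else (-1) ^ pos μ * ∏ κ with chain κ = chain μ, d κ
  let W : Matrix ι ι R := fun κ ν => if κ = ν then 1 else
    if chain κ = chain ν ∧ pos κ = pos ν + 1 then d ν else 0
  let P : Matrix ι ι R := fun μ ν => if NE μ then (if μ = ν then 1 else 0) else
    if chain μ = chain ν then
      (-1) ^ (pos μ + pos ν) * ∏ κ with chain κ = chain μ ∧ pos ν < pos κ, d κ else 0
  have hW : W.det = 1 := by
    refine det_eq_one_of_unitriangular' W pos (fun i => by simp [W]) fun i j hij h => ?_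
    simp only [W, if_neg hij]
    rw [if_neg]
    rintro ⟨-, h2⟩
    omega
  have hP : P.det = 1 := by
    refine det_eq_one_of_unitriangular' P pos (fun i => ?_) fun i j hij h => ?_
    · by_cases hi : NE i
      · simp [P, hi]
      · simp only [P, if_neg hi, if_true]
        rw [Finset.filter_false_of_mem]
        · rw [Finset.prod_empty, mul_one, ← two_mul, pow_mul]
          simp
        · rintro κ - ⟨h1, h2⟩
          have := ends i κ hi h1.symm
          omega
    · by_cases hi : NE i
      · simp [P, hi, hij]
      · simp only [P, if_neg hi]
        rw [if_neg]
        intro hc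
        exact hij (inj i j hc (le_antisymm h (ends i j hi hc)))
  have key : P * B = Matrix.diagonal g * (W.submatrix σ id) := by
    ext μ ν
    rw [Matrix.diagonal_mul, Matrix.mul_apply, Matrix.submatrix_apply, id]
    change _ = g μ * W (f μ) ν
    by_cases hμ : NE μ
    · simp only [P, g, if_pos hμ, ite_mul, one_mul, zero_mul, Finset.sum_ite_eq,
        Finset.mem_univ, if_true, hB, W]
      obtain ⟨hc, hp⟩ := f_ne μ hμ
      by_cases h1 : μ = ν
      · subst h1
        have : f μ ≠ μ := fun h => by rw [h] at hp; omega
        rw [if_pos rfl, if_neg this, if_pos ⟨hc, hp⟩]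
      · rw [if_neg h1]
        by_cases h2 : f μ = ν
        · rw [if_pos h2, if_pos]
          subst h2
          exact ⟨hc.symm, hp⟩
        · rw [if_neg h2, if_neg, if_neg]
          · rintro ⟨h3, h4⟩
            exact h1 (inj μ ν (hc.symm.trans h3) (by omega))
          · rintro ⟨h3, h4⟩
            exact h2 (inj _ ν (hc.trans h3) (by omega))
    · have hBsum : ∀ κ, P μ κ * B κ ν = (if κ = ν then P μ ν * d ν else 0) +
          (if chain κ = chain ν ∧ pos ν = pos κ + 1 then P μ κ else 0) := by
        intro κ
        rw [hB]
        by_cases h1 : κ = ν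
        · subst h1
          simp
        · simp [h1]
      rw [Finset.sum_congr rfl fun κ _ => hBsum κ, Finset.sum_add_distrib, Finset.sum_ite_eq']
      simp only [Finset.mem_univ, if_true]
      obtain ⟨hc, hp⟩ := f_end μ hμ
      by_cases h0 : pos ν = 0
      · rw [Finset.sum_eq_zero (fun κ _ => if_neg (by omega)), add_zero]
        by_cases hcc : chain μ = chain ν
        · have hfν : f μ = ν := inj _ _ (hc.trans hcc) (by omega)
          simp only [P, g, if_neg hμ, if_pos hcc, W, if_pos hfν, mul_one, h0, add_zero]
          rw [mul_assoc]
          congr 1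
          rw [← Finset.prod_erase_mul (Finset.univ.filter fun κ => chain κ = chain μ) d
            (a := ν) (by simp [hcc])]
          congr 1
          refine Finset.prod_congr ?_ fun _ _ => rfl
          ext κ
          simp only [Finset.mem_filter, Finset.mem_univ, true_and, Finset.mem_erase]
          constructor
          · rintro ⟨h1, h2⟩
            refine ⟨?_, h1⟩
            rintro rfl
            omega
          · rintro ⟨h1, h2⟩
            refine ⟨h2, ?_⟩
            by_contra h3
            exact h1 (inj _ _ (h2.trans hcc) (by omega))
        · have hfν : f μ ≠ ν := fun h => hcc (by rw [← h, hc])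
          simp only [P, if_neg hμ, if_neg hcc, W, if_neg hfν]
          rw [if_neg (by omega)]
          simp
      · obtain ⟨κ₀, hκ1, hκ2⟩ := down ν h0
        have : ∀ κ, (if chain κ = chain ν ∧ pos ν = pos κ + 1 then P μ κ else 0) =
            if κ = κ₀ then P μ κ₀ else 0 := by
          intro κ
          by_cases h1 : κ = κ₀
          · subst h1
            rw [if_pos rfl, if_pos ⟨hκ1, hκ2.symm⟩]
          · rw [if_neg h1, if_neg]
            rintro ⟨h2, h3⟩
            exact h1 (inj _ _ (h2.trans hκ1.symm) (by omega))
        rw [Finset.sum_congr rfl fun κ _ => this κ, Finset.sum_ite_eq']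
        simp only [Finset.mem_univ, if_true]
        have hfν : f μ ≠ ν := fun h => by rw [h] at hp; omega
        simp only [W, if_neg hfν]
        rw [if_neg (by omega), mul_zero]
        by_cases hcc : chain μ = chain ν
        · simp only [P, if_neg hμ, if_pos hcc, if_pos (hcc.trans hκ1.symm)]
          rw [← Finset.prod_erase_mul
            (Finset.univ.filter fun κ => chain κ = chain μ ∧ pos κ₀ < pos κ) d
            (a := ν) (by simp [hcc]; omega)]
          have hset : (Finset.univ.filter fun κ => chain κ = chain μ ∧ pos κ₀ < pos κ).erase ν =
              Finset.univ.filter fun κ => chain κ = chain μ ∧ pos ν < pos κ := by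
            ext κ
            simp only [Finset.mem_filter, Finset.mem_univ, true_and, Finset.mem_erase]
            constructor
            · rintro ⟨h1, h2, h3⟩
              refine ⟨h2, ?_⟩
              by_contra h4
              exact h1 (inj _ _ (h2.trans hcc) (by omega))
            · rintro ⟨h1, h2⟩
              refine ⟨?_, h1, by omega⟩
              rintro rfl
              omega
          rw [hset, ← hκ2, ← add_assoc, pow_succ]
          ring
        · simp only [P, if_neg hμ, if_neg hcc,
            if_neg (fun h => hcc (h.trans hκ1) : ¬ chain μ = chain κ₀)]
          simp
  have hWu : IsUnit (W.submatrix σ id).det := by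
    have := Matrix.det_permute σ W
    rw [this, hW, mul_one]
    exact (Int.isUnit_iff.mpr (by
      rcases Int.units_eq_one_or (Equiv.Perm.sign σ) with h | h <;> simp [h])).map (Int.castRingHom R)
  refine ⟨P, (W.submatrix σ id)⁻¹, by rw [hP]; exact isUnit_one,
    Matrix.isUnit_nonsing_inv_det _ hWu, ?_⟩
  rw [key, Matrix.mul_assoc, Matrix.mul_nonsing_inv _ hWu, mul_one]

end Chains

open MvPolynomial

/-- The ring of symmetric functions, presented as the polynomial ring on the complete homogeneous
symmetric functions `h₁, h₂, …` (the variable with index `0` is not used). -/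
abbrev Sym : Type := MvPolynomial ℕ ℤ

/-- The complete homogeneous symmetric function `h_k`, with `h_0 = 1` and `h_k = 0` for `k < 0`. -/
noncomputable def H (k : ℤ) : Sym := if k < 0 then 0 else if k = 0 then 1 else X k.toNat

theorem H_neg {k : ℤ} (hk : k < 0) : H k = 0 := by simp [H, hk]

@[simp] theorem H_zero : H 0 = 1 := by simp [H]

theorem H_pos {k : ℤ} (hk : 0 < k) : H k = X k.toNat := by
  simp [H, not_lt.mpr hk.le, hk.ne']

theorem H_natCast {k : ℕ} (hk : k ≠ 0) : H k = X k := by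
  rw [H_pos (by omega)]; simp

/-- The derivation `∂/∂p₁`, which sends `h_k` to `h_{k-1}`. -/
noncomputable def D : Derivation ℤ Sym Sym :=
  mkDerivation ℤ fun k => if k = 0 then 0 else H ((k : ℤ) - 1)

@[simp] theorem D_H (k : ℤ) : D (H k) = H (k - 1) := by
  rcases lt_trichotomy k 0 with hk | rfl | hk
  · rw [H_neg hk, H_neg (by omega), map_zero]
  · rw [H_zero, H_neg (by omega), Derivation.map_one_eq_zero]
  · rw [H_pos hk, D, mkDerivation_X, if_neg (by omega), Int.toNat_of_nonneg hk.le]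

theorem D_mul (f g : Sym) : D (f * g) = f * D g + D f * g := by
  rw [Derivation.leibniz, smul_eq_mul, smul_eq_mul, mul_comm g]

/-- The product of the `h_p` over a multiset of indices. -/
noncomputable def hm (s : Multiset ℕ) : Sym := (s.map fun p : ℕ => H p).prod

@[simp] theorem hm_zero : hm 0 = 1 := by simp [hm]

@[simp] theorem hm_cons (p : ℕ) (s : Multiset ℕ) : hm (p ::ₘ s) = H p * hm s := by simp [hm]

theorem hm_add (s t : Multiset ℕ) : hm (s + t) = hm s * hm t := by simp [hm]

theorem hm_replicate (i p : ℕ) : hm (Multiset.replicate i p) = H p ^ i := by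
  rw [hm, Multiset.map_replicate, Multiset.prod_replicate]

theorem hm_filter_ne_zero (s : Multiset ℕ) : hm (s.filter (· ≠ 0)) = hm s := by
  induction s using Multiset.induction_on with
  | empty => simp
  | cons p s ih =>
    by_cases hp : p = 0
    · simp [hp] at ih ⊢
      exact ih
    · rw [Multiset.filter_cons_of_pos (p := (· ≠ 0)) _ hp, hm_cons, hm_cons, ih]

theorem hm_eq_monomial (s : Multiset ℕ) (hs : 0 ∉ s) :
    hm s = monomial (Multiset.toFinsupp s) 1 := by
  induction s using Multiset.induction_on with
  | empty => simp
  | cons p s ih =>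
    rw [Multiset.mem_cons, not_or] at hs
    rw [hm_cons, ih hs.2, H_natCast (Ne.symm hs.1), X, monomial_mul, one_mul,
      ← Multiset.singleton_add, map_add, Multiset.toFinsupp_singleton]

theorem linearIndependent_hm (n : ℕ) :
    LinearIndependent ℤ fun μ : n.Partition => hm μ.parts := by
  have h := (basisMonomials ℕ ℤ).linearIndependent.comp
    (fun μ : n.Partition => Multiset.toFinsupp μ.parts)
    (fun μ ν h => Nat.Partition.ext (Multiset.toFinsupp.injective h))
  have heq : (fun μ : n.Partition => hm μ.parts) = basisMonomials ℕ ℤ ∘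
      fun μ : n.Partition => Multiset.toFinsupp μ.parts := by
    ext1 μ
    rw [hm_eq_monomial _ (fun h => lt_irrefl 0 (μ.parts_pos h))]
    simp
  rw [heq]
  exact h

/-- The homogeneous symmetric functions of degree `w`. -/
noncomputable def Deg (w : ℤ) : Submodule ℤ Sym :=
  Submodule.span ℤ {f | ∃ s : Multiset ℕ, (s.sum : ℤ) = w ∧ hm s = f}

theorem hm_mem_Deg {s : Multiset ℕ} {w : ℤ} (h : (s.sum : ℤ) = w) : hm s ∈ Deg w :=
  Submodule.subset_span ⟨s, h, rfl⟩

theorem Deg_neg {w : ℤ} (hw : w < 0) : Deg w = ⊥ := by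
  rw [Deg, Submodule.span_eq_bot]
  rintro _ ⟨s, h, -⟩
  omega

theorem H_mul_mem_Deg {f : Sym} {k w v : ℤ} (hf : f ∈ Deg w) (hv : k + w = v) :
    H k * f ∈ Deg v := by
  rcases lt_or_ge k 0 with hk | hk
  · simp [H_neg hk]
  lift k to ℕ using hk
  induction hf using Submodule.span_induction with
  | mem x h =>
    obtain ⟨s, h, rfl⟩ := h
    rw [← hm_cons]
    exact hm_mem_Deg (by rw [Multiset.sum_cons]; omega)
  | zero => simp
  | add x y _ _ hx hy => rw [mul_add]; exact add_mem hx hy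
  | smul a x _ hx => rw [mul_smul_comm]; exact Submodule.smul_mem _ _ hx

theorem D_mem_Deg {f : Sym} {w v : ℤ} (hf : f ∈ Deg w) (hv : w - 1 = v) : D f ∈ Deg v := by
  subst hv
  induction hf using Submodule.span_induction with
  | mem x h =>
    obtain ⟨s, rfl, rfl⟩ := h
    induction s using Multiset.induction_on with
    | empty => simp
    | cons p s ih =>
      rw [hm_cons, D_mul, D_H]
      refine add_mem (H_mul_mem_Deg ih ?_) (H_mul_mem_Deg (hm_mem_Deg rfl) ?_) <;>
      · simp; ring
  | zero => simp
  | add x y _ _ hx hy => rw [map_add]; exact add_mem hx hy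
  | smul a x _ hx => rw [map_zsmul]; exact Submodule.smul_mem _ _ hx

theorem iterate_D_mem_Deg {f : Sym} {w : ℤ} (hf : f ∈ Deg w) (k : ℕ) : D^[k] f ∈ Deg (w - k) := by
  induction k with
  | zero => simpa
  | succ k ih =>
    rw [Function.iterate_succ_apply']
    exact D_mem_Deg ih (by push_cast; ring)

theorem iterate_D_eq_zero {f : Sym} {w : ℤ} (hf : f ∈ Deg w) {k : ℕ} (hk : w < k) :
    D^[k] f = 0 := by
  have := iterate_D_mem_Deg hf k
  rwa [Deg_neg (by omega), Submodule.mem_bot] at this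

/-- The homogeneous symmetric functions of degree `w` spanned by multiples of some `h_q` with
`m ≤ q`. -/
noncomputable def Large (m w : ℤ) : Submodule ℤ Sym :=
  Submodule.span ℤ {f | ∃ q : ℤ, m ≤ q ∧ ∃ y ∈ Deg (w - q), H q * y = f}

theorem H_mul_mem_Large {m w q : ℤ} {y : Sym} (hq : m ≤ q) (hy : y ∈ Deg (w - q)) :
    H q * y ∈ Large m w := Submodule.subset_span ⟨q, hq, y, hy, rfl⟩

theorem D_mem_Large {m w m' w' : ℤ} {f : Sym} (hf : f ∈ Large m w) (hm : m - 1 = m')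
    (hw : w - 1 = w') : D f ∈ Large m' w' := by
  subst hm hw
  induction hf using Submodule.span_induction with
  | mem x h =>
    obtain ⟨q, hq, y, hy, rfl⟩ := h
    rw [D_mul, D_H]
    refine add_mem (H_mul_mem_Large (by omega) (D_mem_Deg hy (by ring)))
      (H_mul_mem_Large (by omega) ?_)
    rwa [show w - 1 - (q - 1) = w - q by ring]
  | zero => simp
  | add x y _ _ hx hy => rw [map_add]; exact add_mem hx hy
  | smul a x _ hx => rw [map_zsmul]; exact Submodule.smul_mem _ _ hx

theorem H_one_mul_mem_Large {m w w' : ℤ} {f : Sym} (hf : f ∈ Large m w) (hw : w + 1 = w') :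
    H 1 * f ∈ Large m w' := by
  subst hw
  induction hf using Submodule.span_induction with
  | mem x h =>
    obtain ⟨q, hq, y, hy, rfl⟩ := h
    rw [mul_left_comm]
    exact H_mul_mem_Large hq (H_mul_mem_Deg hy (by ring))
  | zero => simp
  | add x y _ _ hx hy => rw [mul_add]; exact add_mem hx hy
  | smul a x _ hx => rw [mul_smul_comm]; exact Submodule.smul_mem _ _ hx

theorem H_one_pow_mul_mem_Large {m w w' : ℤ} {f : Sym} (i : ℕ) (hf : f ∈ Large m w)
    (hw : w + i = w') : H 1 ^ i * f ∈ Large m w' := by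
  subst hw
  induction i with
  | zero => simpa
  | succ i ih =>
    rw [pow_succ', mul_assoc]
    exact H_one_mul_mem_Large ih (by push_cast; ring)

/-- Applying `D` repeatedly to `h_a Y` gives `h_{a-i} Y` up to terms containing larger `h_q`. -/
theorem iterate_D_sub_mem_Large {a w : ℤ} {f Y : Sym} (hY : Y ∈ Deg (w - a))
    (hf : f - H a * Y ∈ Large (a + 1) w) (i : ℕ) :
    D^[i] f - H (a - i) * Y ∈ Large (a - i + 1) (w - i) := by
  induction i with
  | zero => simpa
  | succ i ih =>
    rw [Function.iterate_succ_apply']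
    have h1 := D_mem_Large ih rfl rfl
    rw [map_sub, D_mul, D_H] at h1
    have h2 : H (a - i) * D Y ∈ Large (a - i + 1 - 1) (w - i - 1) :=
      H_mul_mem_Large (by omega) (D_mem_Deg hY (by ring))
    have h3 := add_mem h1 h2
    rw [show a - i + 1 - 1 = a - ((i + 1 : ℕ) : ℤ) + 1 by push_cast; ring,
      show w - i - 1 = w - ((i + 1 : ℕ) : ℤ) by push_cast; ring] at h3
    convert h3 using 1
    rw [show a - ((i + 1 : ℕ) : ℤ) = a - i - 1 by push_cast; ring]
    ring

theorem Large_le {m : ℤ} {n : ℕ} (hm1 : 1 ≤ m) :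
    Large m n ≤ Submodule.span ℤ ((fun μ : n.Partition => hm μ.parts) ''
      {μ | m ≤ ((μ.parts.sup : ℕ) : ℤ)}) := by
  refine Submodule.span_le.mpr ?_
  rintro _ ⟨q, hq, y, hy, rfl⟩
  lift q to ℕ using (by omega)
  rw [SetLike.mem_coe]
  induction hy using Submodule.span_induction with
  | mem x h =>
    obtain ⟨s, h, rfl⟩ := h
    rw [← hm_cons, ← hm_filter_ne_zero]
    refine Submodule.subset_span ⟨Nat.Partition.ofSums n (q ::ₘ s) ?_, ?_, rfl⟩
    · rw [Multiset.sum_cons]; omega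
    · have : q ≤ ((q ::ₘ s).filter (· ≠ 0)).sup :=
        Multiset.le_sup (by simp; omega)
      simp only [Set.mem_ofPred_eq, Nat.Partition.ofSums]
      omega
  | zero => simp
  | add x y _ _ hx hy => rw [mul_add]; exact add_mem hx hy
  | smul a x _ hx => rw [mul_smul_comm]; exact Submodule.smul_mem _ _ hx

theorem H_one_mul_D_iterate (i : ℕ) (f : Sym) :
    H 1 * D (H 1 ^ i * D^[i] f) =
      i • (H 1 ^ i * D^[i] f) + H 1 ^ (i + 1) * D^[i + 1] f := by
  rw [D_mul, Derivation.leibniz_pow, D_H, Function.iterate_succ_apply']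
  cases i with
  | zero => simp
  | succ i => simp; ring

/-- The binomial coefficient `(p - b).choose (j - 1)`, which is zero for `j = 0`. -/
noncomputable def shiftedChoose (b p : ℤ) : ℕ → ℤ
  | 0 => 0
  | j + 1 => Ring.choose (p - b) j

theorem shiftedChoose_succ_sub (b p : ℤ) (j : ℕ) :
    shiftedChoose b (p + 1) (j + 1) - shiftedChoose b p (j + 1) = shiftedChoose b p j := by
  cases j with
  | zero => simp [shiftedChoose]
  | succ j =>
    simp only [shiftedChoose]
    rw [show p + 1 - b = p - b + 1 by ring, Ring.choose_succ_succ]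
    ring

/-- The sum `∑ₚ (-1)^p (p - b).choose (j - 1) h_p h_{c+k-p} D^k Y`. -/
noncomputable def altSum (b : ℤ) (Y : Sym) (P : ℕ) (c : ℤ) (k j : ℕ) : Sym :=
  ∑ p ∈ Finset.range P,
    ((-1) ^ p * shiftedChoose b p j) • (H p * H (c + k - p) * D^[k] Y)

theorem D_altSum (b : ℤ) (Y : Sym) (P : ℕ) (c : ℤ) (k j : ℕ) (hP : c + k < P) :
    D (altSum b Y P c k (j + 1)) =
      -altSum b Y P (c - 1) k j + altSum b Y P (c - 1) (k + 1) (j + 1) := by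
  have hshift : ∑ p ∈ Finset.range P, ((-1) ^ p * shiftedChoose b p (j + 1)) •
        (H ((p : ℤ) - 1) * H (c + k - p) * D^[k] Y) =
      -∑ p ∈ Finset.range P, ((-1) ^ p * shiftedChoose b ((p : ℤ) + 1) (j + 1)) •
        (H p * H (c - 1 + k - p) * D^[k] Y) := by
    cases P with
    | zero => simp
    | succ P =>
      rw [Finset.sum_range_succ', Finset.sum_range_succ, neg_add, ← Finset.sum_neg_distrib]
      congr 1
      · refine Finset.sum_congr rfl fun p _ => ?_
        rw [← neg_smul]
        congr 1
        · push_cast; ring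
        · push_cast
          rw [show (p : ℤ) + 1 - 1 = p by ring, show c + k - ((p : ℤ) + 1) = c - 1 + k - p by ring]
      · rw [H_neg (k := c - 1 + k - P) (by push_cast at hP; omega)]
        simp [H_neg]
  have hD : D (altSum b Y P c k (j + 1)) =
      ∑ p ∈ Finset.range P, ((-1) ^ p * shiftedChoose b p (j + 1)) •
        (H ((p : ℤ) - 1) * H (c + k - p) * D^[k] Y) +
      ∑ p ∈ Finset.range P, ((-1) ^ p * shiftedChoose b p (j + 1)) •
        (H p * H (c - 1 + k - p) * D^[k] Y) +
      ∑ p ∈ Finset.range P, ((-1) ^ p * shiftedChoose b p (j + 1)) •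
        (H p * H (c - 1 + (k + 1 : ℕ) - p) * D^[k + 1] Y) := by
    rw [altSum, map_sum, ← Finset.sum_add_distrib, ← Finset.sum_add_distrib]
    refine Finset.sum_congr rfl fun p _ => ?_
    rw [map_zsmul, D_mul, D_mul, D_H, D_H, Function.iterate_succ_apply', ← smul_add, ← smul_add,
      show c - 1 + ((k + 1 : ℕ) : ℤ) - p = c + k - p by push_cast; ring,
      show c - 1 + (k : ℤ) - p = c + k - p - 1 by ring]
    congr 1
    ring
  rw [hD, hshift, altSum, altSum, ← Finset.sum_neg_distrib, ← Finset.sum_neg_distrib,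
    ← Finset.sum_add_distrib]
  congr 1
  refine Finset.sum_congr rfl fun p _ => ?_
  rw [← shiftedChoose_succ_sub b p j, ← neg_smul, ← neg_smul, ← add_smul]
  congr 1
  ring

/-- The sum of the `altSum`s weighted by multiset coefficients. -/
noncomputable def corrSum (b : ℤ) (Y : Sym) (P K : ℕ) (r : ℕ) (c : ℤ) : Sym :=
  ∑ k ∈ Finset.range K, (r.multichoose k : ℤ) • altSum b Y P c k (r + k)

theorem D_corrSum (b : ℤ) (Y : Sym) (P K r : ℕ) (c : ℤ) (hP : c + K ≤ P) (hY : D^[K] Y = 0) :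
    D (corrSum b Y P K (r + 1) c) = -corrSum b Y P K r (c - 1) := by
  have hD : D (corrSum b Y P K (r + 1) c) = ∑ k ∈ Finset.range K,
      -((r + 1).multichoose k : ℤ) • altSum b Y P (c - 1) k (r + k) +
      ∑ k ∈ Finset.range K,
        ((r + 1).multichoose k : ℤ) • altSum b Y P (c - 1) (k + 1) (r + (k + 1)) := by
    rw [corrSum, map_sum, ← Finset.sum_add_distrib]
    refine Finset.sum_congr rfl fun k hk => ?_
    rw [Finset.mem_range] at hk
    rw [map_zsmul, show r + 1 + k = r + k + 1 by ring, D_altSum _ _ _ _ _ _ (by omega), smul_add,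
      smul_neg, neg_smul, ← add_assoc]
  have htop : altSum b Y P (c - 1) K (r + K) = 0 := by
    rw [altSum]
    exact Finset.sum_eq_zero fun p _ => by rw [hY, mul_zero, smul_zero]
  have hshift : ∑ k ∈ Finset.range K,
        ((r + 1).multichoose k : ℤ) • altSum b Y P (c - 1) (k + 1) (r + (k + 1)) =
      ∑ k ∈ Finset.range K, (((r + 1).multichoose k : ℤ) - r.multichoose k) •
        altSum b Y P (c - 1) k (r + k) := by
    have := Finset.sum_range_succ' (fun k => (((r + 1).multichoose k : ℤ) - r.multichoose k) •
        altSum b Y P (c - 1) k (r + k)) K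
    rw [Finset.sum_range_succ, htop, smul_zero, add_zero] at this
    rw [this]
    simp only [Nat.multichoose_zero_right, sub_self, zero_smul, add_zero]
    refine Finset.sum_congr rfl fun k _ => ?_
    rw [Nat.multichoose_succ_succ]
    congr 1
    push_cast
    ring
  rw [hD, hshift, corrSum, ← Finset.sum_add_distrib, ← Finset.sum_neg_distrib]
  refine Finset.sum_congr rfl fun k _ => ?_
  rw [← add_smul, ← neg_smul]
  congr 1
  ring

theorem iterate_D_corrSum (b : ℤ) (Y : Sym) (P K r : ℕ) (c : ℤ) (hP : c + K ≤ P)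
    (hY : D^[K] Y = 0) : D^[r] (corrSum b Y P K r c) = 0 := by
  induction r generalizing c with
  | zero =>
    rw [corrSum, Function.iterate_zero, id]
    refine Finset.sum_eq_zero fun k _ => ?_
    cases k with
    | zero => simp [altSum, shiftedChoose]
    | succ k => simp
  | succ r ih =>
    rw [Function.iterate_succ_apply, D_corrSum b Y P K r c hP hY]
    have := ih (c - 1) (by omega)
    have hneg : ∀ (m : ℕ) (f : Sym), D^[m] (-f) = -D^[m] f := by
      intro m f
      induction m with
      | zero => rfl
      | succ m ihm => rw [Function.iterate_succ_apply', ihm, map_neg, Function.iterate_succ_apply']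
    rw [hneg, this, neg_zero]

theorem corrSum_sub_mem_Large (a b : ℕ) (hab : b ≤ a) {w : ℤ} {Y : Sym} (hY : Y ∈ Deg w)
    (P K : ℕ) (hP : a < P) (hK : 0 < K) :
    (-1 : ℤ) ^ a • corrSum b Y P K (a - b + 1) (a + b) - H a * (H b * Y) ∈
      Large (a + 1) (a + b + w) := by
  have hmain : H a * (H b * Y) = (-1 : ℤ) ^ a • ∑ k ∈ Finset.range K, ∑ p ∈ Finset.range P,
      if k = 0 ∧ p = a then (-1 : ℤ) ^ a • (H a * (H b * Y)) else 0 := by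
    rw [Finset.sum_eq_single 0, Finset.sum_eq_single a, if_pos ⟨rfl, rfl⟩, smul_smul, ← mul_pow]
    · simp
    · exact fun p _ hp => if_neg fun h => hp h.2
    · exact fun h => absurd (Finset.mem_range.mpr hP) h
    · exact fun k _ hk => Finset.sum_eq_zero fun p _ => if_neg fun h => hk h.1
    · exact fun h => absurd (Finset.mem_range.mpr hK) h
  rw [hmain, ← smul_sub, corrSum, ← Finset.sum_sub_distrib]
  refine Submodule.smul_mem _ _ (Submodule.sum_mem _ fun k _ => ?_)
  rw [altSum, Finset.smul_sum, ← Finset.sum_sub_distrib]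
  refine Submodule.sum_mem _ fun p _ => ?_
  have hDY := iterate_D_mem_Deg hY k
  by_cases h0 : k = 0 ∧ p = a
  · obtain ⟨rfl, rfl⟩ := h0
    have : (p : ℤ) - b = ((p - b : ℕ) : ℤ) := by omega
    simp [shiftedChoose, this, mul_assoc, Ring.choose_natCast]
  rw [if_neg h0, sub_zero]
  refine Submodule.smul_mem _ _ ?_
  rcases lt_or_ge p b with h1 | h1
  · refine Submodule.smul_mem _ _ ?_
    rw [mul_comm (H (p : ℤ)), mul_assoc]
    exact H_mul_mem_Large (by omega) (H_mul_mem_Deg hDY (by ring))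
  · rcases lt_or_ge p (a + k) with h2 | h2
    · have h3 : (p : ℤ) - b = ((p - b : ℕ) : ℤ) := by omega
      rw [show a - b + 1 + k = (a - b + k) + 1 by ring, shiftedChoose, h3, Ring.choose_natCast,
        Nat.choose_eq_zero_of_lt (by omega)]
      simp
    · refine Submodule.smul_mem _ _ ?_
      rw [mul_assoc]
      exact H_mul_mem_Large (by omega) (H_mul_mem_Deg hDY (by ring))

section ChainBasis

variable {n : ℕ}

/-- The largest part of a partition. -/
def big (μ : n.Partition) : ℕ := μ.parts.sup

/-- The number of parts equal to `1` after the largest part has been removed. -/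
def pos (μ : n.Partition) : ℕ := (μ.parts.erase (big μ)).count 1

/-- The parts that are at least `2` after the largest part has been removed. -/
def rest (μ : n.Partition) : Multiset ℕ := (μ.parts.erase (big μ)).filter (2 ≤ ·)

theorem sup_mem {s : Multiset ℕ} (hs : s ≠ 0) : s.sup ∈ s := by
  induction s using Multiset.induction_on with
  | empty => exact absurd rfl hs
  | cons a s ih =>
    rw [Multiset.sup_cons]
    by_cases h : s = 0
    · simp [h]
    · rcases le_total a s.sup with h1 | h1
      · rw [sup_eq_right.mpr h1]
        exact Multiset.mem_cons_of_mem (ih h)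
      · rw [sup_eq_left.mpr h1]
        exact Multiset.mem_cons_self _ _

theorem big_mem (hn : 1 ≤ n) (μ : n.Partition) : big μ ∈ μ.parts := by
  refine sup_mem fun h => ?_
  have := μ.parts_sum
  rw [h, Multiset.sum_zero] at this
  omega

theorem big_pos (hn : 1 ≤ n) (μ : n.Partition) : 1 ≤ big μ := μ.parts_pos (big_mem hn μ)

theorem two_le_of_mem_rest {μ : n.Partition} {p : ℕ} (hp : p ∈ rest μ) : 2 ≤ p :=
  (Multiset.mem_filter.mp hp).2

theorem filter_add_replicate_count (s : Multiset ℕ) (hs : 0 ∉ s) :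
    s.filter (2 ≤ ·) + Multiset.replicate (s.count 1) 1 = s := by
  rw [← Multiset.filter_eq' s 1]
  conv_rhs => rw [← Multiset.filter_add_not (2 ≤ ·) s]
  congr 1
  refine Multiset.filter_congr fun p hp => ?_
  have : p ≠ 0 := fun h => hs (h ▸ hp)
  omega

theorem parts_eq (hn : 1 ≤ n) (μ : n.Partition) :
    μ.parts = big μ ::ₘ (rest μ + Multiset.replicate (pos μ) 1) := by
  rw [rest, pos, filter_add_replicate_count, Multiset.cons_erase (big_mem hn μ)]
  exact fun h => lt_irrefl 0 (μ.parts_pos (Multiset.mem_of_mem_erase h))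

theorem big_add_sum_rest_add_pos (hn : 1 ≤ n) (μ : n.Partition) :
    big μ + (rest μ).sum + pos μ = n := by
  conv_rhs => rw [← μ.parts_sum, parts_eq hn μ]
  simp [add_assoc]

theorem sup_rest_le_big (μ : n.Partition) : (rest μ).sup ≤ big μ := by
  refine Multiset.sup_le.mpr fun p hp => ?_
  exact Multiset.le_sup (Multiset.mem_of_mem_erase (Multiset.mem_of_mem_filter hp))

theorem eq_of_rest_eq_of_pos_eq (hn : 1 ≤ n) {μ ν : n.Partition} (h1 : rest μ = rest ν)
    (h2 : pos μ = pos ν) : μ = ν := by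
  have h3 := big_add_sum_rest_add_pos hn μ
  have h4 := big_add_sum_rest_add_pos hn ν
  have h5 : big μ = big ν := by rw [h1, h2] at h3; omega
  exact Nat.Partition.ext (by rw [parts_eq hn μ, parts_eq hn ν, h1, h2, h5])

theorem exists_partition (r : Multiset ℕ) (a i : ℕ) (hr : ∀ p ∈ r, 2 ≤ p) (ha : 1 ≤ a)
    (hra : r.sup ≤ a) (hsum : a + r.sum + i = n) :
    ∃ ν : n.Partition, rest ν = r ∧ pos ν = i ∧ big ν = a := by
  let ν : n.Partition :=
    { parts := a ::ₘ (r + Multiset.replicate i 1)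
      parts_pos := by
        intro p hp
        rw [Multiset.mem_cons, Multiset.mem_add] at hp
        rcases hp with rfl | hp | hp
        · omega
        · have := hr p hp; omega
        · rw [Multiset.eq_of_mem_replicate hp]; omega
      parts_sum := by
        rw [Multiset.sum_cons, Multiset.sum_add, Multiset.sum_replicate, ← hsum]
        simp [add_assoc] }
  have hbig : big ν = a := by
    change (a ::ₘ (r + Multiset.replicate i 1)).sup = a
    rw [Multiset.sup_cons, sup_eq_left, Multiset.sup_add, sup_le_iff]
    refine ⟨hra, Multiset.sup_le.mpr fun p hp => ?_⟩
    rw [Multiset.eq_of_mem_replicate hp]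
    exact ha
  have herase : ν.parts.erase a = r + Multiset.replicate i 1 := Multiset.erase_cons_head _ _
  refine ⟨ν, ?_, ?_, hbig⟩
  · rw [rest, hbig, herase, Multiset.filter_add, Multiset.filter_eq_self.mpr hr,
      Multiset.filter_eq_nil.mpr, add_zero]
    intro p hp
    rw [Multiset.eq_of_mem_replicate hp]
    omega
  · rw [pos, hbig, herase, Multiset.count_add, Multiset.count_replicate_self,
      Multiset.count_eq_zero_of_notMem, zero_add]
    intro h
    have := hr 1 h
    omega

theorem exists_pos_eq (hn : 1 ≤ n) (μ : n.Partition) {k : ℕ} (hk : k ≤ pos μ) :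
    ∃ ν : n.Partition, rest ν = rest μ ∧ pos ν = k := by
  have h1 := big_add_sum_rest_add_pos hn μ
  have h2 := sup_rest_le_big μ
  have h3 := big_pos hn μ
  obtain ⟨ν, h4, h5, -⟩ := exists_partition (n := n) (rest μ) (big μ + (pos μ - k)) k
    (fun p hp => two_le_of_mem_rest hp) (by omega) (by omega) (by omega)
  exact ⟨ν, h4, h5⟩

theorem sum_rest_eq_zero {μ : n.Partition} (h : (rest μ).sum = 0) : rest μ = 0 := by
  by_contra h0
  obtain ⟨p, hp⟩ := Multiset.exists_mem_of_ne_zero h0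
  have := two_le_of_mem_rest hp
  have := Multiset.single_le_sum (fun x _ => Nat.zero_le x) p hp
  omega

theorem two_le_sup_rest {μ : n.Partition} (h : rest μ ≠ 0) : 2 ≤ (rest μ).sup :=
  two_le_of_mem_rest (sup_mem h)

theorem rest_eq_zero_of_big_eq_one {μ : n.Partition} (h : big μ = 1) : rest μ = 0 := by
  by_contra h0
  have := two_le_sup_rest h0
  have := sup_rest_le_big μ
  omega

theorem count_one_parts (hn : 1 ≤ n) (μ : n.Partition) :
    μ.parts.count 1 = if rest μ = 0 ∧ pos μ = n - 1 then n else pos μ := by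
  have h1 := big_add_sum_rest_add_pos hn μ
  have h2 := big_pos hn μ
  have h3 : μ.parts.count 1 = pos μ + if 1 = big μ then 1 else 0 := by
    conv_lhs => rw [parts_eq hn μ]
    rw [Multiset.count_cons, Multiset.count_add, Multiset.count_replicate_self,
      Multiset.count_eq_zero_of_notMem, zero_add]
    intro h
    have := two_le_of_mem_rest h
    omega
  rw [h3]
  by_cases hb : 1 = big μ
  · have h4 := rest_eq_zero_of_big_eq_one hb.symm
    rw [h4, Multiset.sum_zero] at h1
    rw [if_pos hb, if_pos ⟨h4, by omega⟩]
    omega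
  · rw [if_neg hb, if_neg, add_zero]
    rintro ⟨-, h5⟩
    omega

/-- The element of degree `n` generating the chain of partitions whose `rest` is `r`. -/
noncomputable def chainGen (n : ℕ) (r : Multiset ℕ) : Sym :=
  if r = 0 then H n else
    (-1 : ℤ) ^ (n - r.sum) • corrSum r.sup (hm (r.erase r.sup)) (4 * n + 4) (n + 1)
      (n - r.sum - r.sup + 1) ((n - r.sum : ℕ) + r.sup)

theorem chainGen_sub_mem_Large (hn : 1 ≤ n) (μ : n.Partition) :
    chainGen n (rest μ) - H (big μ + pos μ) * hm (rest μ) ∈ Large (big μ + pos μ + 1) n := by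
  have h1 := big_add_sum_rest_add_pos hn μ
  have h2 := sup_rest_le_big μ
  by_cases h0 : rest μ = 0
  · rw [h0, Multiset.sum_zero] at h1
    rw [h0, chainGen, if_pos rfl, hm_zero, mul_one, show (big μ : ℤ) + pos μ = n by omega]
    simp
  · have h3 : n - (rest μ).sum = big μ + pos μ := by omega
    have h4 := Multiset.cons_erase (sup_mem h0)
    have h5 : (rest μ).sup + ((rest μ).erase (rest μ).sup).sum = (rest μ).sum := by
      rw [← Multiset.sum_cons, h4]
    rw [chainGen, if_neg h0, h3]
    have h6 := corrSum_sub_mem_Large (big μ + pos μ) (rest μ).sup (by omega)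
      (hm_mem_Deg (s := (rest μ).erase (rest μ).sup) rfl) (4 * n + 4) (n + 1) (by omega) (by omega)
    rw [← hm_cons, h4, show ((big μ + pos μ : ℕ) : ℤ) + (rest μ).sup +
      ((rest μ).erase (rest μ).sup).sum = n by omega] at h6
    rw [← Nat.cast_add]
    exact h6

theorem iterate_D_chainGen (hn : 1 ≤ n) (μ : n.Partition) (h0 : rest μ ≠ 0)
    (hb : big μ = (rest μ).sup) : D^[pos μ + 1] (chainGen n (rest μ)) = 0 := by
  have h1 := big_add_sum_rest_add_pos hn μ
  have h3 : n - (rest μ).sum = big μ + pos μ := by omega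
  have h5 : (rest μ).sup + ((rest μ).erase (rest μ).sup).sum = (rest μ).sum := by
    rw [← Multiset.sum_cons, Multiset.cons_erase (sup_mem h0)]
  rw [chainGen, if_neg h0, h3]
  have hsmul : ∀ (m : ℕ) (a : ℤ) (f : Sym), D^[m] (a • f) = a • D^[m] f := by
    intro m a f
    induction m with
    | zero => rfl
    | succ m ihm => rw [Function.iterate_succ_apply', ihm, map_zsmul, Function.iterate_succ_apply']
  have h6 := iterate_D_corrSum (rest μ).sup (hm ((rest μ).erase (rest μ).sup)) (4 * n + 4) (n + 1)
    (pos μ + 1) ((big μ + pos μ : ℕ) + (rest μ).sup) (by omega)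
    (iterate_D_eq_zero (hm_mem_Deg rfl) (by omega))
  rw [hsmul, show big μ + pos μ - (rest μ).sup + 1 = pos μ + 1 by omega, h6, smul_zero]

/-- The basis of the symmetric functions of degree `n` in which `h₁ D` is bidiagonal. -/
noncomputable def chainVec (μ : n.Partition) : Sym :=
  H 1 ^ pos μ * D^[pos μ] (chainGen n (rest μ))

theorem chainVec_sub_mem_Large (hn : 1 ≤ n) (μ : n.Partition) :
    chainVec μ - hm μ.parts ∈ Large (big μ + 1) n := by
  have h1 := big_add_sum_rest_add_pos hn μ
  have h2 := iterate_D_sub_mem_Large (hm_mem_Deg (s := rest μ) (by omega))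
    (chainGen_sub_mem_Large hn μ) (pos μ)
  have h3 := H_one_pow_mul_mem_Large (w' := n) (pos μ) h2 (by ring)
  rw [add_sub_cancel_right, mul_sub] at h3
  have h4 : hm μ.parts = H 1 ^ pos μ * (H (big μ) * hm (rest μ)) := by
    conv_lhs => rw [parts_eq hn μ]
    rw [hm_cons, hm_add, hm_replicate]
    push_cast
    ring
  rwa [h4]

/-- The matrix of `h₁ D` in the basis `chainVec`. -/
noncomputable def chainMatrix (n : ℕ) : Matrix n.Partition n.Partition ℤ := fun μ ν =>
  if μ = ν then (μ.parts.count 1 : ℤ) else if rest μ = rest ν ∧ pos ν = pos μ + 1 then 1 else 0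

theorem iterate_D_H (i : ℕ) (k : ℤ) : D^[i] (H k) = H (k - i) := by
  induction i with
  | zero => simp
  | succ i ih =>
    rw [Function.iterate_succ_apply', ih, D_H]
    congr 1
    push_cast
    ring

theorem H_one_mul_D_chainVec (hn : 1 ≤ n) (μ : n.Partition) :
    H 1 * D (chainVec μ) = ∑ ν, chainMatrix n μ ν • chainVec ν := by
  have h1 := big_add_sum_rest_add_pos hn μ
  have h2 := sup_rest_le_big μ
  have h3 := big_pos hn μ
  have hact := H_one_mul_D_iterate (pos μ) (chainGen n (rest μ))
  have hcount := count_one_parts hn μ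
  by_cases hne : ∃ ν : n.Partition, rest ν = rest μ ∧ pos ν = pos μ + 1
  · obtain ⟨ν, h4, h5⟩ := hne
    have hμν : μ ≠ ν := fun h => by rw [h] at h5; omega
    have h6 := big_add_sum_rest_add_pos hn ν
    have h7 := big_pos hn ν
    rw [h4, h5] at h6
    rw [if_neg (by rintro ⟨h8, h9⟩; omega)] at hcount
    rw [Fintype.sum_eq_add μ ν hμν]
    · simp only [chainMatrix, if_true, if_neg hμν, if_pos (And.intro h4.symm h5), hcount]
      rw [chainVec, hact, chainVec, h4, h5]
      simp
    · rintro κ ⟨h8, h9⟩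
      simp only [chainMatrix, if_neg h8.symm]
      rw [if_neg, zero_smul]
      rintro ⟨h10, h11⟩
      exact h9 (eq_of_rest_eq_of_pos_eq hn (h10.symm.trans h4.symm) (h11.trans h5.symm))
  · rw [Fintype.sum_eq_single μ]
    · simp only [chainMatrix, if_true, hcount]
      rw [chainVec, hact]
      by_cases h0 : rest μ = 0
      · have hb : big μ = 1 := by
          by_contra hb
          obtain ⟨ν, h4, h5, -⟩ := exists_partition (n := n) (rest μ) (big μ - 1) (pos μ + 1)
            (fun p hp => two_le_of_mem_rest hp) (by omega) (by simp [h0]) (by omega)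
          exact hne ⟨ν, h4, h5⟩
        rw [h0, Multiset.sum_zero, hb] at h1
        rw [h0, if_pos ⟨rfl, by omega⟩, chainGen, if_pos rfl, iterate_D_H, iterate_D_H,
          show (n : ℤ) - pos μ = 1 by omega, show (n : ℤ) - (pos μ + 1 : ℕ) = 0 by omega,
          show (n : ℤ) = pos μ + 1 by omega]
        simp
        ring
      · have hb : big μ = (rest μ).sup := by
          by_contra hb
          have := two_le_sup_rest h0
          obtain ⟨ν, h4, h5, -⟩ := exists_partition (n := n) (rest μ) (big μ - 1) (pos μ + 1)
            (fun p hp => two_le_of_mem_rest hp) (by omega) (by omega) (by omega)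
          exact hne ⟨ν, h4, h5⟩
        rw [if_neg (fun h => h0 h.1), iterate_D_chainGen hn μ h0 hb]
        simp
    · intro κ hκ
      simp only [chainMatrix, if_neg hκ.symm]
      rw [if_neg, zero_smul]
      rintro ⟨h10, h11⟩
      exact hne ⟨κ, h10.symm, h11⟩

/-- The products of the `t + 1 + m₁` along two chains are comparable for divisibility. -/
theorem chain_prod_dvd_or_dvd (hn : 1 ≤ n) (r₁ r₂ : Multiset ℕ) :
    let F : Multiset ℕ → Polynomial ℤ := fun r =>
      ∏ κ : n.Partition with rest κ = r, (Polynomial.X + 1 + (κ.parts.count 1 : Polynomial ℤ))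
    F r₁ ∣ F r₂ ∨ F r₂ ∣ F r₁ := by
  intro F
  let I : Multiset ℕ → Finset ℕ := fun r =>
    (Finset.univ.filter fun κ : n.Partition => rest κ = r).image pos
  have mem_I : ∀ r k, k ∈ I r ↔ ∃ κ : n.Partition, rest κ = r ∧ pos κ = k := by
    intro r k
    simp [I]
  have hF : ∀ r, F r = ∏ k ∈ I r, (Polynomial.X + 1 +
      ((if r = 0 ∧ k = n - 1 then n else k : ℕ) : Polynomial ℤ)) := by
    intro r
    rw [Finset.prod_image]
    · refine Finset.prod_congr rfl fun κ hκ => ?_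
      rw [count_one_parts hn, (Finset.mem_filter.mp hκ).2]
    · intro μ hμ ν hν h
      simp only [Finset.coe_filter, Finset.mem_univ, true_and, Set.mem_ofPred_eq] at hμ hν
      exact eq_of_rest_eq_of_pos_eq hn (hμ.trans hν.symm) h
  have top : ∀ r, n - 1 ∈ I r → r = 0 := by
    intro r h
    obtain ⟨κ, rfl, hκ⟩ := (mem_I _ _).mp h
    have := big_add_sum_rest_add_pos hn κ
    have := big_pos hn κ
    exact sum_rest_eq_zero (by omega)
  have sub : ∀ r s, I r ⊆ I s → F r ∣ F s := by
    intro r s hrs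
    rw [hF, hF, ← Finset.prod_sdiff hrs]
    refine dvd_mul_of_dvd_right (dvd_of_eq (Finset.prod_congr rfl fun k hk => ?_)) _
    by_cases hkn : k = n - 1
    · subst hkn
      rw [top r hk, top s (hrs hk)]
    · rw [if_neg fun h => hkn h.2, if_neg fun h => hkn h.2]
  by_cases h : I r₁ ⊆ I r₂
  · exact Or.inl (sub _ _ h)
  · obtain ⟨k, hk1, hk2⟩ := Finset.not_subset.mp h
    refine Or.inr (sub _ _ fun l hl => ?_)
    obtain ⟨κ, rfl, hκ⟩ := (mem_I _ _).mp hk1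
    obtain ⟨κ', rfl, hκ'⟩ := (mem_I _ _).mp hl
    rcases le_or_gt k l with hkl | hkl
    · obtain ⟨ν, h1, h2⟩ := exists_pos_eq hn κ' (k := k) (by omega)
      exact absurd ((mem_I _ _).mpr ⟨ν, h1, h2⟩) hk2
    · obtain ⟨ν, h1, h2⟩ := exists_pos_eq hn κ (k := l) (by omega)
      exact (mem_I _ _).mpr ⟨ν, h1, h2⟩

end ChainBasis

section Determinants

variable {k R ι : Type*} [CommRing k] [CommRing R] [Algebra k R] [DecidableEq ι]

theorem derivation_prod (d : Derivation k R R) (s : Finset ι) (f : ι → R) :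
    d (∏ i ∈ s, f i) = ∑ i ∈ s, ∏ j ∈ s, Function.update f i (d (f i)) j := by
  induction s using Finset.induction_on with
  | empty => simp
  | insert a s ha ih =>
    rw [Finset.prod_insert ha, Derivation.leibniz, ih, Finset.sum_insert ha, Finset.prod_insert ha,
      Function.update_self, smul_eq_mul, smul_eq_mul, Finset.mul_sum, add_comm, mul_comm]
    congr 1
    · congr 1
      refine Finset.prod_congr rfl fun j hj => ?_
      rw [Function.update_of_ne (by rintro rfl; exact ha hj)]
    · refine Finset.sum_congr rfl fun i hi => ?_
      rw [Finset.prod_insert ha, Function.update_of_ne (by rintro rfl; exact ha hi)]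

variable [Fintype ι]

theorem derivation_det (d : Derivation k R R) (A : Matrix ι ι R) :
    d A.det = ∑ i, (A.updateRow i fun j => d (A i j)).det := by
  have h (M : Matrix ι ι R) : M.det = ∑ σ : Equiv.Perm ι, (Equiv.Perm.sign σ : ℤ) •
      ∏ i, M i (σ i) := by
    rw [← Matrix.det_transpose, Matrix.det_apply]
    rfl
  simp_rw [h]
  rw [map_sum, Finset.sum_comm]
  refine Finset.sum_congr rfl fun σ _ => ?_
  rw [map_zsmul, derivation_prod, Finset.smul_sum]
  refine Finset.sum_congr rfl fun i _ => ?_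
  congr 1
  refine Finset.prod_congr rfl fun j _ => ?_
  by_cases hj : j = i
  · subst hj; simp
  · simp [hj]

theorem sum_det_updateRow (A B : Matrix ι ι R) :
    ∑ i, (A.updateRow i (B i)).det = ∑ j, (A.updateCol j fun i => B i j).det := by
  have hrow (i : ι) : (A.updateRow i (B i)).det = ∑ j, A.adjugate j i * B i j := by
    rw [← Matrix.cramer_transpose_apply, Matrix.cramer_eq_adjugate_mulVec,
      ← Matrix.adjugate_transpose]
    rfl
  have hcol (j : ι) : (A.updateCol j fun i => B i j).det = ∑ i, A.adjugate j i * B i j := by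
    rw [← Matrix.cramer_apply, Matrix.cramer_eq_adjugate_mulVec]
    rfl
  simp_rw [hrow, hcol]
  exact Finset.sum_comm

end Determinants

/-- The Jacobi–Trudi determinant of size `L` attached to a sequence of integers. -/
noncomputable def JT (L : ℕ) (f : ℕ → ℤ) : Sym :=
  Matrix.det (Matrix.of fun i j : Fin L => H (f i - i + j))

theorem JT_add_single (L : ℕ) (f : ℕ → ℤ) (i : Fin L) (a : ℤ) :
    JT L (f + Pi.single (i : ℕ) a) = ((Matrix.of fun i j : Fin L => H (f i - i + j)).updateRow i
      fun j => H (f i - i + j + a)).det := by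
  rw [JT]
  congr 1
  ext1 r c
  by_cases hr : r = i
  · subst hr
    simp only [Matrix.of_apply, Pi.add_apply, Pi.single_eq_same, Matrix.updateRow_self]
    congr 1
    ring
  · have : (r : ℕ) ≠ i := fun h => hr (Fin.ext h)
    simp [hr, this]

theorem D_JT (L : ℕ) (f : ℕ → ℤ) : D (JT L f) = ∑ i : Fin L, JT L (f + Pi.single (i : ℕ) (-1)) := by
  simp_rw [JT_add_single]
  rw [JT, derivation_det]
  simp [sub_eq_add_neg]

theorem H_one_mul_JT (L : ℕ) (f : ℕ → ℤ) (hf : f L = 0) :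
    ∑ i : Fin (L + 1), JT (L + 1) (f + Pi.single (i : ℕ) 1) = H 1 * JT (L + 1) f := by
  simp_rw [JT_add_single]
  set A : Matrix (Fin (L + 1)) (Fin (L + 1)) Sym := Matrix.of fun i j => H (f i - i + j) with hA
  rw [sum_det_updateRow A (fun i j => H (f i - i + j + 1)), Fin.sum_univ_castSucc,
    Finset.sum_eq_zero, zero_add]
  · have hlast (v : Fin (L + 1) → Sym) : (A.updateCol (Fin.last L) v).det =
        v (Fin.last L) * (A.submatrix Fin.castSucc Fin.castSucc).det := by
      rw [Matrix.det_succ_row _ (Fin.last L), Fin.sum_univ_castSucc, Finset.sum_eq_zero, zero_add]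
      · rw [Matrix.updateCol_self, Even.neg_one_pow ⟨_, rfl⟩, one_mul]
        congr 2
        ext1 r c
        simp [Fin.succAbove_last]
      · intro j _
        have : A (Fin.last L) j.castSucc = 0 := by
          have := j.2
          simp only [hA, Matrix.of_apply, Fin.val_last, hf, Fin.val_castSucc]
          exact H_neg (by omega)
        simp [this, (Fin.castSucc_lt_last j).ne]
    have h := hlast (fun i => A i (Fin.last L))
    rw [Matrix.updateCol_eq_self] at h
    rw [JT, ← hA, hlast, h]
    simp [hA, hf]
  · intro j _
    refine Matrix.det_zero_of_column_eq (i := j.castSucc) (j := j.succ)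
      (Fin.castSucc_lt_succ).ne fun r => ?_
    rw [Matrix.updateCol_self, Matrix.updateCol_ne (Fin.castSucc_lt_succ).ne']
    simp only [hA, Matrix.of_apply, Fin.val_castSucc, Fin.val_succ]
    push_cast
    congr 1
    ring

theorem JT_eq_zero_of_succ {L : ℕ} {f : ℕ → ℤ} {i : ℕ} (hi : i + 1 < L) (h : f (i + 1) = f i + 1) :
    JT L f = 0 := by
  refine Matrix.det_zero_of_row_eq (i := ⟨i, by omega⟩) (j := ⟨i + 1, hi⟩) (by simp) ?_
  ext1 c
  simp only [Matrix.of_apply, h]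
  congr 1
  push_cast
  ring

theorem JT_eq_zero_of_neg {L : ℕ} {f : ℕ → ℤ} (h : f L = -1) : JT (L + 1) f = 0 := by
  refine Matrix.det_eq_zero_of_row_eq_zero (Fin.last L) fun c => ?_
  have := c.2
  simp only [Matrix.of_apply, Fin.val_last, h]
  exact H_neg (by omega)

section Columns

variable {m n : ℕ}

/-- The length of the `j`-th column (starting from `0`) of the Young diagram of a partition. -/
def col (μ : m.Partition) (j : ℕ) : ℕ := Multiset.card (μ.parts.filter (j + 1 ≤ ·))

theorem partitionLE_iff (a : m.Partition) (b : n.Partition) :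
    PartitionLE a b ↔ ∀ j, col a j ≤ col b j := by
  refine ⟨fun h j => h (j + 1) (by omega), fun h j hj => ?_⟩
  obtain ⟨j, rfl⟩ := Nat.exists_eq_add_of_le' hj
  exact h j

theorem antitone_col (μ : m.Partition) : Antitone (col μ) := fun i j hij =>
  Multiset.card_le_card (Multiset.monotone_filter_right _ fun p (hp : j + 1 ≤ p) => by omega)

theorem le_of_mem_parts (μ : m.Partition) {p : ℕ} (hp : p ∈ μ.parts) : p ≤ m := by
  rw [← μ.parts_sum]
  exact Multiset.le_sum_of_mem hp

theorem col_eq_zero (μ : m.Partition) {j : ℕ} (hj : m ≤ j) : col μ j = 0 := by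
  rw [col, Multiset.card_eq_zero, Multiset.filter_eq_nil]
  intro p hp
  have := le_of_mem_parts μ hp
  omega

theorem sum_card_filter (s : Multiset ℕ) {L : ℕ} (h : ∀ p ∈ s, p ≤ L) :
    ∑ j ∈ Finset.range L, Multiset.card (s.filter (j + 1 ≤ ·)) = s.sum := by
  induction s using Multiset.induction_on with
  | empty => simp
  | cons p s ih =>
    rw [Multiset.sum_cons, ← ih fun q hq => h q (Multiset.mem_cons_of_mem hq)]
    have hp := h p (Multiset.mem_cons_self p s)
    have : p = ∑ j ∈ Finset.range L, if j + 1 ≤ p then 1 else 0 := by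
      rw [← Finset.sum_filter, ← Finset.card_eq_sum_ones]
      have : (Finset.range L).filter (fun j => j + 1 ≤ p) = Finset.range p := by
        ext j; simp; omega
      rw [this, Finset.card_range]
    conv_rhs => rw [this, ← Finset.sum_add_distrib]
    refine Finset.sum_congr rfl fun j _ => ?_
    by_cases hj : j + 1 ≤ p
    · rw [Multiset.filter_cons_of_pos (p := (j + 1 ≤ ·)) _ hj, Multiset.card_cons, if_pos hj,
        add_comm]
    · rw [Multiset.filter_cons_of_neg (p := (j + 1 ≤ ·)) _ hj, if_neg hj, zero_add]

theorem sum_col (μ : m.Partition) {L : ℕ} (h : m ≤ L) : ∑ j ∈ Finset.range L, col μ j = m := by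
  simp only [col]
  rw [sum_card_filter _ fun p hp => (le_of_mem_parts μ hp).trans h, μ.parts_sum]

theorem count_add_col (μ : m.Partition) (p : ℕ) :
    μ.parts.count (p + 1) + col μ (p + 1) = col μ p := by
  simp only [col]
  rw [Multiset.count_eq_card_filter_eq, ← Multiset.card_add]
  congr 1
  ext q
  rw [Multiset.count_add, Multiset.count_filter, Multiset.count_filter, Multiset.count_filter]
  split_ifs <;> omega

theorem col_injective : Function.Injective (col (m := m)) := by
  intro μ ν h
  refine Nat.Partition.ext (Multiset.ext.mpr fun p => ?_)
  cases p with
  | zero =>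
    rw [Multiset.count_eq_zero_of_notMem fun h => lt_irrefl 0 (μ.parts_pos h),
      Multiset.count_eq_zero_of_notMem fun h => lt_irrefl 0 (ν.parts_pos h)]
  | succ p =>
    have h1 := count_add_col μ p
    have h2 := count_add_col ν p
    rw [h] at h1
    omega

theorem exists_col_eq {f : ℕ → ℕ} (hf : Antitone f) {L : ℕ} (h0 : ∀ j, L ≤ j → f j = 0)
    (hsum : ∑ j ∈ Finset.range L, f j = m) : ∃ μ : m.Partition, col μ = f := by
  set s : Multiset ℕ := ∑ j ∈ Finset.range L, Multiset.replicate (f j - f (j + 1)) (j + 1) with hs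
  have hmem : ∀ p ∈ s, 0 < p ∧ p ≤ L := by
    intro p hp
    rw [hs, Multiset.mem_sum] at hp
    obtain ⟨j, hj, hp⟩ := hp
    rw [Multiset.eq_of_mem_replicate hp]
    rw [Finset.mem_range] at hj
    omega
  have htel (k l : ℕ) :
      ∑ j ∈ Finset.range l, (if k ≤ j then f j - f (j + 1) else 0) + f (max k l) = f k := by
    induction l with
    | zero => simp
    | succ l ih =>
      rw [Finset.sum_range_succ]
      have := hf (Nat.le_succ l)
      by_cases h : k ≤ l
      · rw [max_eq_right h] at ih
        rw [max_eq_right (by omega), if_pos h]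
        simp only [Nat.succ_eq_add_one] at this
        omega
      · rw [max_eq_left (by omega)] at ih
        rw [max_eq_left (by omega), if_neg h]
        omega
  have hcard (k : ℕ) : Multiset.card (s.filter (k + 1 ≤ ·)) = f k := by
    have h1 : Multiset.card (s.filter (k + 1 ≤ ·)) =
        ∑ j ∈ Finset.range L, if k ≤ j then f j - f (j + 1) else 0 := by
      rw [← Multiset.countP_eq_card_filter, hs, ← Multiset.coe_countPAddMonoidHom, map_sum]
      refine Finset.sum_congr rfl fun j _ => ?_
      rw [Multiset.coe_countPAddMonoidHom, Multiset.countP_eq_card_filter]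
      split_ifs with h
      · rw [Multiset.filter_eq_self.mpr fun p hp => ?_, Multiset.card_replicate]
        rw [Multiset.eq_of_mem_replicate hp]
        omega
      · rw [Multiset.filter_eq_nil.mpr fun p hp => ?_, Multiset.card_zero]
        rw [Multiset.eq_of_mem_replicate hp]
        omega
    have := htel k L
    rw [h0 _ (le_max_right k L)] at this
    omega
  have hsum' : s.sum = m := by
    rw [← sum_card_filter s fun p hp => (hmem p hp).2, ← hsum]
    exact Finset.sum_congr rfl fun j _ => hcard j
  exact ⟨⟨s, fun hp => (hmem _ hp).1, hsum'⟩, funext hcard⟩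

/-- The Young diagram of `b` is obtained from that of `a` by adding a cell in the column `i`. -/
def Covers (a : n.Partition) (b : (n + 1).Partition) (i : ℕ) : Prop :=
  ∀ j, col b j = col a j + if j = i then 1 else 0

theorem sum_ite_covers (a : n.Partition) (b : (n + 1).Partition) (x : Sym) :
    ∑ i : Fin (n + 1), (if Covers a b i then x else 0) = if PartitionLE a b then x else 0 := by
  rw [partitionLE_iff]
  split_ifs with h
  · obtain ⟨i, hi, hlt⟩ : ∃ i ∈ Finset.range (n + 1), col a i < col b i := by
      refine Finset.exists_lt_of_sum_lt ?_
      rw [sum_col a (by omega), sum_col b le_rfl]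
      omega
    have hle (j : ℕ) : col a j + (if j = i then 1 else 0) ≤ col b j := by
      have := h j
      split_ifs with hj
      · subst hj; omega
      · omega
    have hcov : Covers a b i := by
      intro j
      by_cases hj : j < n + 1
      · refine ((Finset.sum_eq_sum_iff_of_le fun j _ => hle j).mp ?_ j
          (Finset.mem_range.mpr hj)).symm
        rw [Finset.sum_add_distrib, sum_col a (by omega), sum_col b le_rfl, Finset.sum_ite_eq',
          if_pos hi]
      · rw [Finset.mem_range] at hi
        rw [col_eq_zero a (by omega), col_eq_zero b (by omega), if_neg (by omega)]
    rw [Finset.sum_eq_single (⟨i, Finset.mem_range.mp hi⟩ : Fin (n + 1)), if_pos hcov]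
    · intro j _ hj
      refine if_neg fun hc => hj (Fin.ext ?_)
      by_contra hne
      have h1 := hc j
      have h2 := hcov j
      rw [if_pos rfl] at h1
      rw [if_neg hne] at h2
      omega
    · simp
  · refine Finset.sum_eq_zero fun i _ => if_neg fun hc => h fun j => ?_
    rw [hc j]
    omega

/-- The Schur function of the conjugate of a partition, as a Jacobi–Trudi determinant of
size `L`. -/
noncomputable def schur (L : ℕ) (μ : m.Partition) : Sym := JT L fun j => col μ j

theorem sum_ite_eq_of_forall {ι : Type*} [Fintype ι] (p : ι → Prop) (F : ι → Sym) (i : ι)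
    (hi : p i) (h : ∀ j, p j → j = i) : ∑ j, (if p j then F j else 0) = F i := by
  rw [Finset.sum_eq_single i, if_pos hi]
  · exact fun j _ hj => if_neg fun hp => hj (h j hp)
  · simp

theorem JT_col_add_single (a : n.Partition) (i : Fin (n + 1)) :
    JT (n + 1) ((fun j => (col a j : ℤ)) + Pi.single (i : ℕ) 1) =
      ∑ b : (n + 1).Partition, if Covers a b i then schur (n + 1) b else 0 := by
  obtain ⟨i, hi⟩ := i
  simp only
  by_cases h : ∃ k, i = k + 1 ∧ col a i = col a k
  · obtain ⟨k, rfl, hk⟩ := h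
    rw [JT_eq_zero_of_succ (i := k) hi (by simp [hk]), Finset.sum_eq_zero]
    intro b _
    refine if_neg fun hc => ?_
    have h1 := hc k
    have h2 := hc (k + 1)
    have h3 := antitone_col b (Nat.le_succ k)
    rw [if_neg (by omega)] at h1
    rw [if_pos rfl] at h2
    simp only [Nat.succ_eq_add_one] at h3
    omega
  · obtain ⟨b, hb⟩ : ∃ b : (n + 1).Partition, col b = fun j => col a j + if j = i then 1 else 0 := by
      refine exists_col_eq (L := n + 1) (antitone_nat_of_succ_le fun j => ?_) (fun j hj => ?_) ?_
      · have h1 := antitone_col a (Nat.le_succ j)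
        simp only [Nat.succ_eq_add_one] at h1
        by_cases hj : j + 1 = i
        · have h2 : col a i ≠ col a j := fun h2 => h ⟨j, hj.symm, h2⟩
          subst hj
          simp
          omega
        · rw [if_neg hj]
          omega
      · rw [col_eq_zero a (by omega), if_neg (by omega)]
      · rw [Finset.sum_add_distrib, sum_col a (by omega), Finset.sum_ite_eq',
          if_pos (Finset.mem_range.mpr hi)]
    rw [sum_ite_eq_of_forall (Covers a · i) _ b (fun j => congrFun hb j)
      fun c hc => col_injective ((funext hc).trans hb.symm), schur, hb]
    congr 1
    ext1 j
    simp [Pi.single_apply]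

theorem JT_col_sub_single (b : (n + 1).Partition) (i : Fin (n + 1)) :
    JT (n + 1) ((fun j => (col b j : ℤ)) + Pi.single (i : ℕ) (-1)) =
      ∑ a : n.Partition, if Covers a b i then schur (n + 1) a else 0 := by
  obtain ⟨i, hi⟩ := i
  simp only
  have hanti := antitone_col b (Nat.le_succ i)
  simp only [Nat.succ_eq_add_one] at hanti
  by_cases h : col b (i + 1) = col b i
  · rw [Finset.sum_eq_zero]
    · rcases Nat.lt_succ_iff_lt_or_eq.mp hi with hi' | rfl
      · exact JT_eq_zero_of_succ (i := i) (by omega) (by simp [h])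
      · refine JT_eq_zero_of_neg ?_
        rw [col_eq_zero b le_rfl] at h
        simp [← h]
    · intro a _
      refine if_neg fun hc => ?_
      have h1 := hc i
      have h2 := hc (i + 1)
      have h3 := antitone_col a (Nat.le_succ i)
      rw [if_pos rfl] at h1
      rw [if_neg (by omega)] at h2
      simp only [Nat.succ_eq_add_one] at h3
      omega
  · have hcol (j : ℕ) : (col b j - if j = i then 1 else 0) + (if j = i then 1 else 0) = col b j := by
      split_ifs with hj
      · subst hj; omega
      · omega
    obtain ⟨a, ha⟩ : ∃ a : n.Partition, col a = fun j => col b j - if j = i then 1 else 0 := by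
      refine exists_col_eq (L := n + 1) (antitone_nat_of_succ_le fun j => ?_) (fun j hj => ?_) ?_
      · have h1 := antitone_col b (Nat.le_succ j)
        simp only [Nat.succ_eq_add_one] at h1
        by_cases hj : j = i
        · subst hj
          simp
          omega
        · rw [if_neg hj]
          omega
      · rw [col_eq_zero b (by omega)]
        simp
      · have := sum_col b le_rfl
        rw [← Finset.sum_congr rfl fun j _ => hcol j, Finset.sum_add_distrib, Finset.sum_ite_eq',
          if_pos (Finset.mem_range.mpr hi)] at this
        omega
    rw [sum_ite_eq_of_forall (Covers · b i) _ a (fun j => by rw [ha]; exact (hcol j).symm)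
      fun c hc => ?_, schur, ha]
    · congr 1
      ext1 j
      simp only [Pi.add_apply, Pi.single_apply]
      have := hcol j
      split_ifs at this ⊢ <;> omega
    · refine col_injective (funext fun j => ?_)
      rw [ha]
      simp [hc j]

theorem H_one_mul_schur (a : n.Partition) : H 1 * schur (n + 1) a =
    ∑ b : (n + 1).Partition, if PartitionLE a b then schur (n + 1) b else 0 := by
  rw [schur, ← H_one_mul_JT n _ (by simp [col_eq_zero a le_rfl])]
  simp_rw [JT_col_add_single]
  rw [Finset.sum_comm]
  simp_rw [sum_ite_covers]

theorem D_schur (b : (n + 1).Partition) : D (schur (n + 1) b) =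
    ∑ a : n.Partition, if PartitionLE a b then schur (n + 1) a else 0 := by
  rw [schur, D_JT]
  simp_rw [JT_col_sub_single]
  rw [Finset.sum_comm]
  simp_rw [sum_ite_covers]

theorem D_H_one_mul_schur (a : n.Partition) : D (H 1 * schur (n + 1) a) =
    ∑ c : n.Partition, psiMatrix n a c • schur (n + 1) c := by
  have hpsi (c : n.Partition) : psiMatrix n a c =
      ∑ b : (n + 1).Partition, if PartitionLE a b ∧ PartitionLE c b then 1 else 0 := by
    rw [psiMatrix, Nat.card_eq_fintype_card, Fintype.card_subtype, Finset.card_filter]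
    push_cast
    rfl
  simp_rw [H_one_mul_schur, map_sum, hpsi, Finset.sum_smul]
  rw [Finset.sum_comm]
  refine Finset.sum_congr rfl fun b _ => ?_
  by_cases h : PartitionLE a b
  · simp [h, D_schur]
  · simp [h]

end Columns

section Triangularity

variable {n : ℕ}

/-- The sum of the squares of the elements of a multiset. -/
def sqSum (s : Multiset ℕ) : ℕ := (s.map (· ^ 2)).sum

theorem sqSum_filter_ne_zero (s : Multiset ℕ) : sqSum (s.filter (· ≠ 0)) = sqSum s := by
  induction s using Multiset.induction_on with
  | empty => simp
  | cons p s ih =>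
    by_cases hp : p = 0
    · rw [Multiset.filter_cons_of_neg (p := (· ≠ 0)) _ (by simpa using hp), ih]
      simp [sqSum, hp]
    · rw [Multiset.filter_cons_of_pos (p := (· ≠ 0)) _ hp]
      simp only [sqSum, Multiset.map_cons, Multiset.sum_cons] at ih ⊢
      rw [ih]

/-- The partition of `n` whose parts are the nonzero values of a function. -/
noncomputable def ofFun (g : Fin (n + 1) → ℕ) (hg : ∑ i, g i = n) : n.Partition :=
  Nat.Partition.ofSums n (Finset.univ.val.map g) hg

theorem hm_ofFun (g : Fin (n + 1) → ℕ) (hg : ∑ i, g i = n) :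
    hm (ofFun g hg).parts = ∏ i, H (g i) :=
  (hm_filter_ne_zero (Finset.univ.val.map g)).trans (by rw [hm, Multiset.map_map]; rfl)

theorem sqSum_ofFun (g : Fin (n + 1) → ℕ) (hg : ∑ i, g i = n) :
    sqSum (ofFun g hg).parts = ∑ i, g i ^ 2 :=
  (sqSum_filter_ne_zero (Finset.univ.val.map g)).trans (by rw [sqSum, Multiset.map_map]; rfl)

/-- The conjugate of a partition. -/
noncomputable def conj (μ : n.Partition) : n.Partition :=
  ofFun (fun i : Fin (n + 1) => col μ i) (by
    rw [← Finset.sum_range, sum_col μ (Nat.le_succ n)])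

theorem conj_injective : Function.Injective (conj (n := n)) := by
  intro μ ν h
  set s := (Finset.univ : Finset (Fin (n + 1))).val.map fun i : Fin (n + 1) => col μ i with hs
  set t := (Finset.univ : Finset (Fin (n + 1))).val.map fun i : Fin (n + 1) => col ν i with ht
  have h1 : s.filter (· ≠ 0) = t.filter (· ≠ 0) := congrArg Nat.Partition.parts h
  have h0 (u : Multiset ℕ) : Multiset.card (u.filter (· ≠ 0)) + u.count 0 = Multiset.card u := by
    rw [Multiset.count_eq_card_filter_eq, ← Multiset.card_add]
    conv_rhs => rw [← Multiset.filter_add_not (· ≠ 0) u]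
    simp [eq_comm]
  have hcard : Multiset.card s = Multiset.card t := by simp [hs, ht]
  have hst : s = t := by
    refine Multiset.ext.mpr fun p => ?_
    by_cases hp : p = 0
    · subst hp
      have h2 := h0 s
      have h3 := h0 t
      rw [h1] at h2
      omega
    · rw [← Multiset.count_filter_of_pos (p := (· ≠ 0)) (s := s) hp, h1,
        Multiset.count_filter_of_pos (p := (· ≠ 0)) hp]
  have hlist (κ : n.Partition) : (Finset.univ : Finset (Fin (n + 1))).val.map
      (fun i : Fin (n + 1) => col κ i) = ((List.ofFn fun i : Fin (n + 1) => col κ i : List ℕ) :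
        Multiset ℕ) := by
    rw [List.ofFn_eq_map, ← Multiset.map_coe]
    rfl
  rw [hs, ht, hlist, hlist, Multiset.coe_eq_coe] at hst
  have hpair (κ : n.Partition) :
      (List.ofFn fun i : Fin (n + 1) => col κ i).Pairwise (· ≥ ·) := by
    rw [List.pairwise_ofFn]
    exact fun i j hij => antitone_col κ hij.le
  have heq := List.ofFn_injective
    (hst.eq_of_pairwise (fun a b _ _ h1 h2 => le_antisymm h2 h1) (hpair μ) (hpair ν))
  refine col_injective (funext fun j => ?_)
  by_cases hj : j < n + 1
  · exact congrFun heq ⟨j, hj⟩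
  · rw [col_eq_zero μ (by omega), col_eq_zero ν (by omega)]

/-- The nontrivial terms of a Jacobi–Trudi determinant are more spread out than the trivial one. -/
theorem sum_sq_lt_of_ne_one {L : ℕ} {f : Fin L → ℤ} (hf : Antitone f) {σ : Equiv.Perm (Fin L)}
    (hσ : σ ≠ 1) :
    ∑ i, f i ^ 2 < ∑ i : Fin L, (f (σ i) - ((σ i : ℕ) : ℤ) + ((i : ℕ) : ℤ)) ^ 2 := by
  have hanti : Antivary f fun i : Fin L => ((i : ℕ) : ℤ) :=
    hf.antivary fun i j hij => by exact_mod_cast hij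
  have h1 := hanti.sum_mul_le_sum_comp_perm_mul (σ := σ)
  have h2 := Equiv.sum_comp σ fun i => f i ^ 2
  have h3 := Equiv.sum_comp σ fun i => f i * ((i : ℕ) : ℤ)
  obtain ⟨k, hk⟩ : ∃ k, σ k ≠ k := by
    by_contra! h
    exact hσ (Equiv.ext h)
  have h4 : 0 < ∑ i : Fin L, (((i : ℕ) : ℤ) - ((σ i : ℕ) : ℤ)) ^ 2 := by
    refine Finset.sum_pos' (fun i _ => sq_nonneg _) ⟨k, Finset.mem_univ _, ?_⟩
    have : (((k : ℕ) : ℤ) - ((σ k : ℕ) : ℤ)) ≠ 0 := by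
      intro h
      exact hk (Fin.ext (by omega))
    positivity
  have h5 : ∑ i : Fin L, (f (σ i) - ((σ i : ℕ) : ℤ) + ((i : ℕ) : ℤ)) ^ 2 =
      ∑ i, f (σ i) ^ 2 + 2 * (∑ i : Fin L, f (σ i) * ((i : ℕ) : ℤ) -
          ∑ i : Fin L, f (σ i) * ((σ i : ℕ) : ℤ)) +
        ∑ i : Fin L, (((i : ℕ) : ℤ) - ((σ i : ℕ) : ℤ)) ^ 2 := by
    rw [← Finset.sum_sub_distrib, Finset.mul_sum, ← Finset.sum_add_distrib,
      ← Finset.sum_add_distrib]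
    exact Finset.sum_congr rfl fun i _ => by ring
  linarith

theorem schur_sub_mem (μ : n.Partition) : schur (n + 1) μ - hm (conj μ).parts ∈
    Submodule.span ℤ ((fun ν : n.Partition => hm ν.parts) ''
      {ν | sqSum (conj μ).parts < sqSum ν.parts}) := by
  have hconj : hm (conj μ).parts =
      ∏ i : Fin (n + 1), H ((col μ ((1 : Equiv.Perm (Fin (n + 1))) i) : ℤ) -
        (((1 : Equiv.Perm (Fin (n + 1))) i : ℕ) : ℤ) + ((i : ℕ) : ℤ)) := by
    rw [conj, hm_ofFun]
    exact Finset.prod_congr rfl fun i _ => by simp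
  have hdet : schur (n + 1) μ = ∑ σ : Equiv.Perm (Fin (n + 1)), (Equiv.Perm.sign σ : ℤ) •
      ∏ i, H ((col μ (σ i) : ℤ) - ((σ i : ℕ) : ℤ) + ((i : ℕ) : ℤ)) := by
    rw [schur, JT, Matrix.det_apply]
    rfl
  rw [hdet, ← Finset.add_sum_erase _ _ (Finset.mem_univ 1), ← hconj, Equiv.Perm.sign_one,
    Units.val_one, one_smul, add_sub_cancel_left]
  refine sum_mem fun σ hσ => Submodule.smul_mem _ _ ?_
  by_cases hneg : ∃ i, (col μ (σ i) : ℤ) - ((σ i : ℕ) : ℤ) + ((i : ℕ) : ℤ) < 0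
  · obtain ⟨i, hi⟩ := hneg
    rw [Finset.prod_eq_zero (Finset.mem_univ i) (H_neg hi)]
    exact zero_mem _
  push Not at hneg
  choose g hg using fun i => Int.eq_ofNat_of_zero_le (hneg i)
  simp_rw [hg]
  have hsum : ∑ i, g i = n := by
    have h1 : ((∑ i, g i : ℕ) : ℤ) = n := by
      push_cast
      simp_rw [← hg]
      rw [Finset.sum_add_distrib, Finset.sum_sub_distrib,
        Equiv.sum_comp σ fun i : Fin (n + 1) => (col μ i : ℤ),
        Equiv.sum_comp σ fun i : Fin (n + 1) => ((i : ℕ) : ℤ), sub_add_cancel,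
        ← Finset.sum_range fun i => (col μ i : ℤ)]
      exact_mod_cast sum_col μ (Nat.le_succ n)
    exact_mod_cast h1
  refine Submodule.subset_span ⟨ofFun g hsum, ?_, hm_ofFun g hsum⟩
  have hlt := sum_sq_lt_of_ne_one (f := fun i : Fin (n + 1) => (col μ i : ℤ))
    (fun i j hij => Int.ofNat_le.mpr (antitone_col μ hij)) (Finset.ne_of_mem_erase hσ)
  simp only [hg] at hlt
  rw [Set.mem_ofPred_eq, sqSum_ofFun, conj, sqSum_ofFun]
  exact_mod_cast hlt

end Triangularity

section Assembly

variable {ι : Type*} [Fintype ι]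

/-- The action of an integer matrix on a family of vectors. -/
noncomputable def act (A : Matrix ι ι ℤ) (b : ι → Sym) : ι → Sym := fun i => ∑ j, A i j • b j

theorem act_mul (A B : Matrix ι ι ℤ) (b : ι → Sym) : act (A * B) b = act A (act B b) := by
  ext1 i
  simp only [act, Matrix.mul_apply, Finset.sum_smul, Finset.smul_sum, mul_smul]
  exact Finset.sum_comm

theorem act_injective {b : ι → Sym} (hb : LinearIndependent ℤ b) :
    Function.Injective fun A => act A b := by
  intro A B h
  ext i j
  have h1 : ∑ j, (A i j - B i j) • b j = 0 := by
    simp only [sub_smul, Finset.sum_sub_distrib]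
    exact sub_eq_zero.mpr (congrFun h i)
  exact sub_eq_zero.mp (Fintype.linearIndependent_iff.mp hb _ h1 j)

theorem act_submatrix_id (A : Matrix ι ι ℤ) (e : Equiv.Perm ι) (b : ι → Sym) :
    act (A.submatrix id e.symm) b = act A (b ∘ e) := by
  ext1 i
  simp only [act, Matrix.submatrix_apply, id, Function.comp]
  rw [← Equiv.sum_comp e]
  simp only [Equiv.symm_apply_apply]

theorem map_act (T : Sym →+ Sym) (A : Matrix ι ι ℤ) (b : ι → Sym) :
    T ∘ act A b = act A (T ∘ b) := by
  ext1 i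
  simp only [Function.comp, act, map_sum, map_zsmul]

theorem exists_act_eq_of_triangular [DecidableEq ι] {b w : ι → Sym} (stat : ι → ℕ)
    (h : ∀ i, w i - b i ∈ Submodule.span ℤ (b '' {j | stat i < stat j})) :
    ∃ A : Matrix ι ι ℤ, A.det = 1 ∧ w = act A b := by
  have h' (i : ι) : ∃ c : ι → ℤ, (∀ j, ¬ stat i < stat j → c j = 0) ∧
      ∑ j, c j • b j = w i - b i := by
    obtain ⟨c, hc, hsum⟩ := (Finsupp.mem_span_image_iff_linearCombination ℤ).mp (h i)
    refine ⟨c, fun j hj => ?_, ?_⟩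
    · by_contra hne
      exact hj ((Finsupp.mem_supported ℤ c).mp hc (Finsupp.mem_support_iff.mpr hne))
    · rw [← hsum, Finsupp.linearCombination_apply, Finsupp.sum_fintype _ _ (by simp)]
  choose c hc hsum using h'
  refine ⟨fun i j => c i j + if i = j then 1 else 0, ?_, ?_⟩
  · refine det_eq_one_of_unitriangular _ stat (fun i => ?_) fun i j hij hle => ?_
    · simp [hc i i (lt_irrefl _)]
    · simp [hc i j (by omega), hij]
  · ext1 i
    simp only [act, add_smul, Finset.sum_add_distrib, hsum, ite_smul, one_smul, zero_smul,
      Finset.sum_ite_eq, Finset.mem_univ, if_true, sub_add_cancel]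

variable {n : ℕ}

theorem exists_act_eq_chainVec (hn : 1 ≤ n) : ∃ V : Matrix n.Partition n.Partition ℤ,
    IsUnit V.det ∧ chainVec = act V fun μ : n.Partition => hm μ.parts := by
  obtain ⟨V, hV, h⟩ := exists_act_eq_of_triangular (b := fun μ : n.Partition => hm μ.parts)
    (w := chainVec) big fun μ => by
      refine Submodule.span_mono (Set.image_mono fun ν hν => ?_)
        (Large_le (by omega) (chainVec_sub_mem_Large hn μ))
      have : (big μ : ℤ) + 1 ≤ (big ν : ℕ) := hν
      change big μ < big ν
      omega
  exact ⟨V, by rw [hV]; exact isUnit_one, h⟩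

theorem exists_act_eq_schur : ∃ S : Matrix n.Partition n.Partition ℤ,
    IsUnit S.det ∧ schur (n + 1) = act S fun μ : n.Partition => hm μ.parts := by
  set e : Equiv.Perm n.Partition :=
    Equiv.ofBijective conj (Finite.injective_iff_bijective.mp conj_injective) with he
  obtain ⟨S, hS, h⟩ := exists_act_eq_of_triangular
    (b := (fun μ : n.Partition => hm μ.parts) ∘ e) (w := schur (n + 1))
    (fun μ => sqSum (e μ).parts) fun μ => by
      have := schur_sub_mem μ
      have himage : e '' {ν | sqSum (e μ).parts < sqSum (e ν).parts} =
          {ν | sqSum (conj μ).parts < sqSum ν.parts} := by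
        ext ν
        refine ⟨fun ⟨κ, hκ, h⟩ => h ▸ hκ, fun hν => ⟨e.symm ν, ?_, e.apply_symm_apply ν⟩⟩
        rw [Set.mem_ofPred_eq, e.apply_symm_apply]
        exact hν
      rw [Set.image_comp, himage]
      exact this
  refine ⟨S.submatrix id e.symm, ?_, by rw [act_submatrix_id]; exact h⟩
  rw [Matrix.det_permute', hS, mul_one]
  exact (Equiv.Perm.sign e.symm).isUnit.map (Int.castRingHom ℤ)

/-- The operators `D ∘ h₁` written in the Schur basis and in the basis of chains are similar. -/
theorem exists_psiMatrix_mul_eq (hn : 1 ≤ n) : ∃ W : Matrix n.Partition n.Partition ℤ,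
    IsUnit W.det ∧ psiMatrix n * W = W * (chainMatrix n + 1) := by
  obtain ⟨V, hV, hc⟩ := exists_act_eq_chainVec hn
  obtain ⟨S, hS, hs⟩ := exists_act_eq_schur (n := n)
  set T : Sym →+ Sym := (D : Sym →ₗ[ℤ] Sym).toAddMonoidHom.comp (AddMonoidHom.mulLeft (H 1))
  have hTs : T ∘ schur (n + 1) = act (psiMatrix n) (schur (n + 1)) :=
    funext fun μ => D_H_one_mul_schur μ
  have hTc : T ∘ chainVec = act (chainMatrix n + 1) chainVec := by
    ext1 μ
    have : T (chainVec μ) = H 1 * D (chainVec μ) + chainVec μ := by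
      change D (H 1 * chainVec μ) = _
      rw [D_mul, D_H, sub_self, H_zero, one_mul]
    rw [Function.comp, this, H_one_mul_D_chainVec hn]
    simp only [act, Matrix.add_apply, add_smul, Finset.sum_add_distrib, Matrix.one_apply, ite_smul,
      one_smul, zero_smul, Finset.sum_ite_eq, Finset.mem_univ, if_true]
  have hsc : schur (n + 1) = act (S * V⁻¹) chainVec := by
    rw [hc, ← act_mul, mul_assoc, Matrix.nonsing_inv_mul _ hV, mul_one, hs]
  refine ⟨S * V⁻¹, ?_, ?_⟩
  · rw [Matrix.det_mul]
    exact hS.mul (Matrix.isUnit_nonsing_inv_det _ hV)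
  · have h : psiMatrix n * (S * V⁻¹) * V = S * V⁻¹ * (chainMatrix n + 1) * V := by
      refine act_injective (linearIndependent_hm n) ?_
      simp only
      rw [act_mul, ← hc, act_mul, ← hsc, ← hTs, hsc, map_act, hTc,
        act_mul (S * V⁻¹ * (chainMatrix n + 1)), ← hc, act_mul (S * V⁻¹)]
    have h' := congrArg (· * V⁻¹) h
    simpa only [Matrix.mul_nonsing_inv_cancel_right _ _ hV] using h'

end Assembly

end CaiStanley

/-- Cai–Stanley: For any `n ≥ 1`, the matrix `ψ_n + tI` has a Smith
normal form over `ℤ[t]`: there are matrices `P`, `Q` invertible over `ℤ[t]` such that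
`P (ψ_n + tI) Q` is diagonal with diagonal entries totally ordered by divisibility
(so they can be arranged so each divides the next). -/
theorem stmt15 (n : ℕ) (hn : 1 ≤ n) :
    ∃ P Q : Matrix (Nat.Partition n) (Nat.Partition n) (Polynomial ℤ),
      IsUnit P.det ∧ IsUnit Q.det ∧
      (∀ lam nu : Nat.Partition n, lam ≠ nu → (P * psiMatrixT n * Q) lam nu = 0) ∧
      (∀ lam nu : Nat.Partition n,
        (P * psiMatrixT n * Q) lam lam ∣ (P * psiMatrixT n * Q) nu nu ∨
        (P * psiMatrixT n * Q) nu nu ∣ (P * psiMatrixT n * Q) lam lam) := by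
  obtain ⟨W, hW, hpsi⟩ := CaiStanley.exists_psiMatrix_mul_eq hn
  set W' := W.map Polynomial.C with hW'
  have hWdet : IsUnit W'.det := by
    rw [hW', ← RingHom.mapMatrix_apply, ← RingHom.map_det]
    exact hW.map _
  set B : Matrix n.Partition n.Partition (Polynomial ℤ) :=
    (CaiStanley.chainMatrix n).map Polynomial.C +
      (Polynomial.X + 1 : Polynomial ℤ) • (1 : Matrix n.Partition n.Partition (Polynomial ℤ)) with hB
  have hpsi' : psiMatrixT n * W' = W' * B := by
    have h := congrArg (RingHom.mapMatrix (Polynomial.C : ℤ →+* Polynomial ℤ)) hpsi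
    rw [map_mul, map_mul, map_add, map_one] at h
    simp only [RingHom.mapMatrix_apply] at h
    rw [psiMatrixT, hB, add_mul, h, mul_add, mul_add, add_smul, mul_add, one_smul, mul_one,
      smul_mul_assoc, one_mul, mul_smul_comm, mul_one, add_assoc, add_comm W']
  obtain ⟨P, Q, hP, hQ, hPBQ⟩ := CaiStanley.exists_diagonalization_of_chains CaiStanley.rest
    CaiStanley.pos (fun μ : n.Partition => Polynomial.X + 1 + (μ.parts.count 1 : Polynomial ℤ))
    (fun μ ν => CaiStanley.eq_of_rest_eq_of_pos_eq hn)
    (fun μ hμ => by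
      obtain ⟨ν, h1, h2⟩ := CaiStanley.exists_pos_eq hn μ (Nat.sub_le (CaiStanley.pos μ) 1)
      exact ⟨ν, h1, by omega⟩) B fun μ ν => by
      rw [hB, Matrix.add_apply, Matrix.map_apply, CaiStanley.chainMatrix, Matrix.smul_apply,
        Matrix.one_apply]
      by_cases h : μ = ν
      · simp [h, add_comm]
      · simp only [h, if_false, smul_zero, add_zero]
        split_ifs <;> simp
  have hmain : P * W'⁻¹ * psiMatrixT n * (W' * Q) = P * B * Q := by
    rw [mul_assoc (P * W'⁻¹), ← mul_assoc (psiMatrixT n), hpsi', mul_assoc P, mul_assoc W',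
      Matrix.nonsing_inv_mul_cancel_left _ _ hWdet, mul_assoc]
  refine ⟨P * W'⁻¹, W' * Q, ?_, ?_, ?_, ?_⟩
  · rw [Matrix.det_mul]
    exact hP.mul (Matrix.isUnit_nonsing_inv_det _ hWdet)
  · rw [Matrix.det_mul]
    exact hWdet.mul hQ
  · intro lam nu h
    rw [hmain, hPBQ, Matrix.diagonal_apply_ne _ h]
  · intro lam nu
    rw [hmain, hPBQ, Matrix.diagonal_apply_eq, Matrix.diagonal_apply_eq]
    have hu (k : ℕ) : IsUnit ((-1) ^ k : Polynomial ℤ) := isUnit_one.neg.pow k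
    split_ifs
    · exact Or.inl dvd_rfl
    · exact Or.inl (one_dvd _)
    · exact Or.inr (one_dvd _)
    · rw [(hu _).mul_left_dvd, (hu _).dvd_mul_left, (hu _).mul_left_dvd, (hu _).dvd_mul_left]
      convert CaiStanley.chain_prod_dvd_or_dvd hn (CaiStanley.rest lam) (CaiStanley.rest nu)
end

section
/- Let λ be a partition and t ≥ ℓ(λ) (the number of parts of λ), with λ_i = 0 for i > ℓ(λ). Let J be the t×t matrix over the polynomial ring ℚ[x] whose (i,j)-entry is the polynomial C(x + λ_i + j − i − 1, λ_i + j − i) := (1/(λ_i+j−i)!) ∏_{s=0}^{λ_i+j−i−1} (x + λ_i + j − i − 1 − s) when λ_i + j − i ≥ 0, and 0 when λ_i + j − i < 0 (this is the Jacobi–Trudi matrix of λ with each complete homogeneous symmetric function h_m specialized to h_m(1^x) = C(x+m−1, m)). Then J has a Smith normal form over ℚ[x] with diagonal entries α_1, …, α_t where α_i = ∏_{u ∈ D_{t−i+1}} (x + c(u)); here c(i,j) = j − i is the content of the square (i,j) of the Young diagram of λ, D_k is the k-th diagonal hook of λ (all squares (i,j) ∈ λ with i = k and j ≥ k, or j =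 k and i ≥ k), and an empty product equals 1. -/
open Polynomial

namespace SpecializedJacobiTrudi

/-- The complete homogeneous polynomial `h_m(1^x)`, equal to `0` for `m < 0`. -/
noncomputable def complete (m : ℤ) : ℚ[X] :=
  if 0 ≤ m then
    ((m.toNat.factorial : ℚ)⁻¹ : ℚ) • ∏ r ∈ Finset.range m.toNat, (X + C (r : ℚ))
  else 0

/-- The elementary symmetric polynomial `e_m(1^x)`, with the sign `(-1) ^ m`. -/
noncomputable def signedElementary (m : ℕ) : ℚ[X] :=
  C ((-1) ^ m * (m.factorial : ℚ)⁻¹) * ∏ r ∈ Finset.range m, (X - C (r : ℚ))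

/-- The product of `x + c` over the contents `c` of the arm of a diagonal square. -/
noncomputable def armProd (n : ℕ) : ℚ[X] := ∏ r ∈ Finset.range n, (X + C ((r : ℚ) + 1))

/-- The product of `x + c` over the contents `c` of a diagonal square and its leg. -/
noncomputable def legProd (n : ℕ) : ℚ[X] := ∏ r ∈ Finset.range (n + 1), (X - C (r : ℚ))

lemma armProd_dvd {m n : ℕ} (h : m ≤ n) : armProd m ∣ armProd n :=
  Finset.prod_dvd_prod_of_subset _ _ _ (Finset.range_mono h)

lemma legProd_dvd {m n : ℕ} (h : m ≤ n) : legProd m ∣ legProd n :=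
  Finset.prod_dvd_prod_of_subset _ _ _ (Finset.range_mono (by omega))

lemma complete_of_neg {m : ℤ} (h : m < 0) : complete m = 0 := if_neg (by omega)

lemma complete_zero : complete 0 = 1 := by simp [complete]

lemma complete_succ (n : ℕ) :
    complete (n + 1 : ℕ) = C (((n + 1).factorial : ℚ)⁻¹) * (X * armProd n) := by
  rw [complete, if_pos (by omega), Int.toNat_natCast, Finset.prod_range_succ', smul_eq_C_mul,
    armProd]
  simp [mul_comm]

lemma signedElementary_zero : signedElementary 0 = 1 := by simp [signedElementary]

lemma signedElementary_succ (n : ℕ) : signedElementary (n + 1) =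
    C ((-1) ^ (n + 1) * ((n + 1).factorial : ℚ)⁻¹) * legProd n := rfl

/-- Up to sign, the hook Schur function expanded in complete and elementary ones. -/
noncomputable def hookSum (a : ℤ) (j : ℕ) : ℚ[X] :=
  ∑ k ∈ Finset.range (j + 1), complete (a + k) * signedElementary (j - k)

lemma hookSum_zero (a : ℤ) : hookSum a 0 = complete a := by
  simp [hookSum, signedElementary_zero]

lemma hookSum_succ (a : ℤ) (j : ℕ) :
    hookSum a (j + 1) = complete a * signedElementary (j + 1) + hookSum (a + 1) j := by
  rw [hookSum, Finset.sum_range_succ', add_comm, hookSum]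
  congr 1
  · simp
  · refine Finset.sum_congr rfl fun k _ => ?_
    rw [Nat.add_sub_add_right]
    push_cast
    ring_nf

lemma hookSum_natCast_succ (n j : ℕ) : hookSum (n + 1 : ℕ) j =
    C ((n.factorial : ℚ)⁻¹ * ((-1) ^ j * (j.factorial : ℚ)⁻¹) / ((n + 1 : ℚ) + j)) *
      (armProd n * legProd j) := by
  induction j generalizing n with
  | zero =>
    rw [hookSum_zero, complete_succ, Nat.factorial_succ]
    simp [legProd, div_eq_mul_inv]
    left
    ring
  | succ j ih =>
    have key := ih (n + 1)
    push_cast at key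
    rw [hookSum_succ]
    push_cast
    rw [key]
    have hc := complete_succ n
    push_cast at hc
    rw [hc, signedElementary_succ]
    have hl : legProd (j + 1) = legProd j * (X - C ((j : ℚ) + 1)) := by
      rw [legProd, Finset.prod_range_succ, legProd]; simp
    have ha : armProd (n + 1) = armProd n * (X + C ((n : ℚ) + 1)) := by
      rw [armProd, Finset.prod_range_succ, armProd]
    rw [hl, ha, Nat.factorial_succ, Nat.factorial_succ]
    generalize armProd n = A
    generalize legProd j = L
    have hn : (n.factorial : ℚ) ≠ 0 := by positivity
    have hj : (j.factorial : ℚ) ≠ 0 := by positivity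
    have hn1 : (n : ℚ) + 1 ≠ 0 := by positivity
    have hj1 : (j : ℚ) + 1 ≠ 0 := by positivity
    have hs : (n : ℚ) + 1 + (j + 1) ≠ 0 := by positivity
    push_cast
    set K : ℚ := (-1) ^ (j + 1) / (((n + 1) * n.factorial) * ((j + 1) * j.factorial) *
      (n + 1 + (j + 1))) with hK
    have e1 : ((n + 1 : ℚ) * n.factorial)⁻¹ * ((-1) ^ (j + 1) * ((j + 1 : ℚ) * j.factorial)⁻¹)
        = K * (n + 1 + (j + 1)) := by rw [hK]; field_simp
    have e2 : ((n + 1 : ℚ) * n.factorial)⁻¹ * ((-1) ^ j * (j.factorial : ℚ)⁻¹) / (n + 1 + 1 + j)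
        = - K * (j + 1) := by
      rw [hK, pow_succ, show (n : ℚ) + 1 + 1 + j = n + 1 + (j + 1) by ring]; field_simp
    have e3 : (n.factorial : ℚ)⁻¹ * ((-1) ^ (j + 1) * ((j + 1 : ℚ) * j.factorial)⁻¹) /
        (n + 1 + (j + 1)) = K * (n + 1) := by rw [hK]; field_simp
    rw [e2, e3]
    calc _ = C (((n + 1 : ℚ) * n.factorial)⁻¹ * ((-1) ^ (j + 1) *
            ((j + 1 : ℚ) * j.factorial)⁻¹)) * (X * (A * L)) +
          C (-K * (j + 1)) * (A * (X + C ((n : ℚ) + 1)) * L) := by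
            simp only [C_mul]
            ring
      _ = _ := by
        rw [e1]
        simp only [C_mul, C_add, C_neg, C_1]
        ring

lemma hookSum_neg (b j : ℕ) : hookSum (-(b : ℤ)) j = if j = b then 1 else 0 := by
  induction j generalizing b with
  | zero =>
    rw [hookSum_zero]
    rcases b with _ | b
    · simp [complete_zero]
    · rw [complete_of_neg (by omega)]
      simp
  | succ j ih =>
    rw [hookSum_succ]
    rcases b with _ | b
    · have h := hookSum_natCast_succ 0 j
      simp only [Nat.cast_zero, neg_zero, zero_add, Nat.cast_one] at h ⊢
      rw [h, complete_zero, signedElementary_succ, Nat.factorial_succ, if_neg (by omega), one_mul,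
        armProd, Finset.prod_range_zero, one_mul, ← add_mul, ← C_add]
      convert zero_mul _
      rw [← C_0]
      congr 1
      have hj1 : (j : ℚ) + 1 ≠ 0 := by positivity
      have hj2 : 1 + (j : ℚ) ≠ 0 := by positivity
      have hj : (j.factorial : ℚ) ≠ 0 := by positivity
      push_cast [Nat.factorial_zero]
      field_simp
      ring
    · rw [complete_of_neg (by omega), zero_mul, zero_add,
        show -((b + 1 : ℕ) : ℤ) + 1 = -(b : ℤ) by push_cast; ring, ih]
      simp

/-- The unitriangular matrix of signed elementary symmetric polynomials. -/
noncomputable def elementaryMatrix (t : ℕ) : Matrix (Fin t) (Fin t) ℚ[X] :=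
  Matrix.of fun k j => if k ≤ j then signedElementary (j - k) else 0

lemma det_elementaryMatrix (t : ℕ) : (elementaryMatrix t).det = 1 := by
  rw [Matrix.det_of_isUpperTriangular]
  · simp [elementaryMatrix, signedElementary_zero]
  · intro i j hij
    exact if_neg (not_le.mpr hij)

lemma sum_complete_mul_elementaryMatrix {t : ℕ} (a : ℤ) (j : Fin t) :
    ∑ k : Fin t, complete (a + (k : ℕ)) * elementaryMatrix t k j = hookSum a j := by
  have h : ∀ k : Fin t, complete (a + (k : ℕ)) * elementaryMatrix t k j =
      (fun k : ℕ => if k ≤ (j : ℕ) then complete (a + k) * signedElementary (j - k) else 0) k := by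
    intro k
    simp only [elementaryMatrix, Matrix.of_apply, Fin.le_def]
    split_ifs <;> simp
  rw [Finset.sum_congr rfl fun k _ => h k, Fin.sum_univ_eq_sum_range (fun k : ℕ =>
    if k ≤ (j : ℕ) then complete (a + k) * signedElementary (j - k) else 0), ← Finset.sum_filter,
    hookSum]
  refine Finset.sum_congr ?_ fun _ _ => rfl
  ext k
  simp only [Finset.mem_filter, Finset.mem_range]
  omega

/-- Two square matrices related by multiplication with invertible matrices on both sides. -/
def UnimodEquiv {R : Type*} [CommRing R] {n : ℕ} (A B : Matrix (Fin n) (Fin n) R) : Prop :=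
  ∃ P Q : Matrix (Fin n) (Fin n) R, IsUnit P.det ∧ IsUnit Q.det ∧ P * A * Q = B

lemma UnimodEquiv.of_submatrix {R : Type*} [CommRing R] {n : ℕ}
    {A B : Matrix (Fin n) (Fin n) R} (e₁ e₂ : Equiv.Perm (Fin n))
    (h : UnimodEquiv (A.submatrix e₁ e₂) B) : UnimodEquiv A B := by
  obtain ⟨P, Q, hP, hQ, h⟩ := h
  rw [← Matrix.isUnit_iff_isUnit_det] at hP hQ
  refine ⟨P.submatrix (Equiv.refl _) e₁.symm, Q.submatrix e₂.symm (Equiv.refl _), ?_, ?_, ?_⟩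
  · rwa [← Matrix.isUnit_iff_isUnit_det, Matrix.isUnit_submatrix_equiv]
  · rwa [← Matrix.isUnit_iff_isUnit_det, Matrix.isUnit_submatrix_equiv]
  · rw [← h]
    ext i j
    simp only [Matrix.mul_apply, Matrix.submatrix_apply, Equiv.refl_apply]
    rw [← Equiv.sum_comp e₂]
    refine Finset.sum_congr rfl fun k _ => ?_
    rw [← Equiv.sum_comp e₁]
    simp

lemma UnimodEquiv.of_mul_right {R : Type*} [CommRing R] {n : ℕ}
    {A B U : Matrix (Fin n) (Fin n) R} (hU : IsUnit U.det) (h : UnimodEquiv (A * U) B) :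
    UnimodEquiv A B := by
  obtain ⟨P, Q, hP, hQ, h⟩ := h
  refine ⟨P, U * Q, hP, ?_, ?_⟩
  · rw [Matrix.det_mul]
    exact hU.mul hQ
  · rw [← h]
    simp only [Matrix.mul_assoc]

/-- Clearing the first row and column with a pivot dividing all their entries. -/
lemma UnimodEquiv.of_pivot {R : Type*} [CommRing R] {n : ℕ}
    {A : Matrix (Fin (n + 1)) (Fin (n + 1)) R} {β : Fin (n + 1) → R} (ε : R) (hε : IsUnit ε)
    (s q : Fin n → R) (h0 : ε * A 0 0 = β 0) (hs : ∀ i, A i.succ 0 = s i * A 0 0)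
    (hq : ∀ j, A 0 j.succ = A 0 0 * q j)
    (h : UnimodEquiv (Matrix.of fun i j : Fin n => A i.succ j.succ - s i * A 0 0 * q j)
      (Matrix.diagonal fun i => β i.succ)) :
    UnimodEquiv A (Matrix.diagonal β) := by
  obtain ⟨P, Q, hP, hQ, h⟩ := h
  let P' : Matrix (Fin (n + 1)) (Fin (n + 1)) R := Matrix.of fun i j =>
    Fin.cases (Fin.cases ε (fun _ => 0) j)
      (fun i' => Fin.cases (-∑ k, P i' k * s k) (fun j' => P i' j') j) i
  let Q' : Matrix (Fin (n + 1)) (Fin (n + 1)) R := Matrix.of fun i j =>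
    Fin.cases (Fin.cases 1 (fun j' => -∑ k, q k * Q k j') j)
      (fun i' => Fin.cases 0 (fun j' => Q i' j') j) i
  have hPA0 : ∀ j, (P' * A) 0 j = ε * A 0 j := fun j => by
    simp [Matrix.mul_apply, Fin.sum_univ_succ, P']
  have hPA1 : ∀ i, (P' * A) (Fin.succ i) 0 = 0 := fun i => by
    simp [Matrix.mul_apply, Fin.sum_univ_succ, P', hs, Finset.sum_mul, mul_assoc]
  have hPA2 : ∀ i j, (P' * A) (Fin.succ i) (Fin.succ j) =
      (P * Matrix.of fun i j : Fin n => A i.succ j.succ - s i * A 0 0 * q j) i j := fun i j => by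
    simp only [Matrix.mul_apply, Fin.sum_univ_succ, P', Matrix.of_apply, Fin.cases_zero,
      Fin.cases_succ, hq, mul_sub, Finset.sum_sub_distrib, neg_mul, Finset.sum_mul]
    rw [neg_add_eq_sub]
    congr 1
    exact Finset.sum_congr rfl fun k _ => by ring
  refine ⟨P', Q', ?_, ?_, ?_⟩
  · have : P'.det = ε * P.det := by
      rw [Matrix.det_succ_row_zero, Fin.sum_univ_succ]
      simp only [P', Matrix.of_apply, Fin.cases_zero, Fin.cases_succ, mul_zero, zero_mul,
        Finset.sum_const_zero, add_zero, Fin.val_zero, pow_zero, one_mul]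
      congr 2
    rw [this]
    exact hε.mul hP
  · have : Q'.det = Q.det := by
      rw [Matrix.det_succ_column_zero, Fin.sum_univ_succ]
      simp only [Q', Matrix.of_apply, Fin.cases_zero, Fin.cases_succ, mul_zero, zero_mul,
        Finset.sum_const_zero, add_zero, Fin.val_zero, pow_zero, one_mul]
      congr 1
    rwa [this]
  · ext i j
    rw [Matrix.mul_apply, Fin.sum_univ_succ]
    refine Fin.cases ?_ (fun i => ?_) i <;> refine Fin.cases ?_ (fun j => ?_) j
    · simp [hPA0, Q', h0]
    · simp [hPA0, Q', hq, Finset.mul_sum, mul_assoc, (Fin.succ_ne_zero _).symm]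
    · simp [hPA1, Q']
    · have := congrFun (congrFun h i) j
      rw [Matrix.mul_apply] at this
      simp only [hPA1, hPA2, zero_mul, zero_add, Q', Matrix.of_apply, Fin.cases_succ]
      rw [this]
      simp [Matrix.diagonal_apply]

/-- Unit rows followed by a Cauchy block, whose rows and columns are scaled by chains of
polynomials ordered by divisibility. -/
lemma unimodEquiv_diagonal_of_cauchy {n : ℕ} (s : ℕ) (A : Matrix (Fin n) (Fin n) ℚ[X])
    (f g : Fin n → ℚ[X]) (u v x y : Fin n → ℚ)
    (hone : ∀ i j : Fin n, (i : ℕ) < s → A i j = if i = j then 1 else 0)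
    (hA : ∀ i j : Fin n, s ≤ i → s ≤ j → A i j = C (u i * v j / (x i + y j)) * (f i * g j))
    (hf : ∀ i j : Fin n, s ≤ i → i ≤ j → f i ∣ f j)
    (hg : ∀ i j : Fin n, s ≤ i → i ≤ j → g i ∣ g j)
    (hu : ∀ i : Fin n, s ≤ i → u i ≠ 0) (hv : ∀ i : Fin n, s ≤ i → v i ≠ 0)
    (hxy : ∀ i j : Fin n, s ≤ i → s ≤ j → x i + y j ≠ 0)
    (hx : ∀ i j : Fin n, s ≤ i → i < j → x i ≠ x j)
    (hy : ∀ i j : Fin n, s ≤ i → i < j → y i ≠ y j) :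
    UnimodEquiv A (Matrix.diagonal fun i => if (i : ℕ) < s then 1 else f i * g i) := by
  induction n generalizing s with
  | zero => exact ⟨1, 1, by simp, by simp, by ext i; exact i.elim0⟩
  | succ n ih =>
    rcases s with _ | s
    · have h0 := hxy 0 0 (Nat.zero_le _) (Nat.zero_le _)
      have hu0 := hu 0 (Nat.zero_le _)
      have hv0 := hv 0 (Nat.zero_le _)
      choose F hF using fun i : Fin n => hf 0 i.succ (Nat.zero_le _) (Fin.zero_le _)
      choose G hG using fun i : Fin n => hg 0 i.succ (Nat.zero_le _) (Fin.zero_le _)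
      have hA' := fun i j => hA i j (Nat.zero_le _) (Nat.zero_le _)
      refine .of_pivot (C ((u 0 * v 0 / (x 0 + y 0))⁻¹)) (isUnit_C.mpr (by simp [*]))
        (fun i => C (u i.succ * (x 0 + y 0) / (u 0 * (x i.succ + y 0))) * F i)
        (fun j => C (v j.succ * (x 0 + y 0) / (v 0 * (x 0 + y j.succ))) * G j) ?_ ?_ ?_ ?_
      · rw [hA', ← mul_assoc, ← C_mul, inv_mul_cancel₀ (by positivity)]
        simp
      · intro i
        have := hxy i.succ 0 (Nat.zero_le _) (Nat.zero_le _)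
        rw [hA', hA', hF, show u i.succ * v 0 / (x i.succ + y 0) =
          u i.succ * (x 0 + y 0) / (u 0 * (x i.succ + y 0)) * (u 0 * v 0 / (x 0 + y 0)) by
            field_simp, C_mul]
        ring
      · intro j
        have := hxy 0 j.succ (Nat.zero_le _) (Nat.zero_le _)
        rw [hA', hA', hG, show u 0 * v j.succ / (x 0 + y j.succ) =
          v j.succ * (x 0 + y 0) / (v 0 * (x 0 + y j.succ)) * (u 0 * v 0 / (x 0 + y 0)) by
            field_simp, C_mul]
        ring
      · refine ih 0 _ (fun i => f i.succ) (fun i => g i.succ)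
          (fun i => u i.succ * (x i.succ - x 0) / (x i.succ + y 0))
          (fun j => v j.succ * (y j.succ - y 0) / (x 0 + y j.succ))
          (fun i => x i.succ) (fun i => y i.succ) ?_ ?_ ?_ ?_ ?_ ?_ ?_ ?_ ?_
        · intro i j h
          omega
        · intro i j _ _
          have h1 := hxy i.succ 0 (Nat.zero_le _) (Nat.zero_le _)
          have h2 := hxy 0 j.succ (Nat.zero_le _) (Nat.zero_le _)
          have h3 := hxy i.succ j.succ (Nat.zero_le _) (Nat.zero_le _)
          rw [Matrix.of_apply, hA', hA', show
            u i.succ * (x i.succ - x 0) / (x i.succ + y 0) *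
              (v j.succ * (y j.succ - y 0) / (x 0 + y j.succ)) / (x i.succ + y j.succ) =
            u i.succ * v j.succ / (x i.succ + y j.succ) -
              u i.succ * (x 0 + y 0) / (u 0 * (x i.succ + y 0)) * (u 0 * v 0 / (x 0 + y 0)) *
              (v j.succ * (x 0 + y 0) / (v 0 * (x 0 + y j.succ))) by field_simp; ring,
            hF, hG, C_sub, C_mul, C_mul]
          ring
        · exact fun i j _ h => hf _ _ (Nat.zero_le _) (Fin.succ_le_succ_iff.mpr h)
        · exact fun i j _ h => hg _ _ (Nat.zero_le _) (Fin.succ_le_succ_iff.mpr h)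
        · exact fun i _ => div_ne_zero (mul_ne_zero (hu _ (Nat.zero_le _))
            (sub_ne_zero.mpr (hx _ _ (Nat.zero_le _) i.succ_pos).symm))
            (hxy _ _ (Nat.zero_le _) (Nat.zero_le _))
        · exact fun i _ => div_ne_zero (mul_ne_zero (hv _ (Nat.zero_le _))
            (sub_ne_zero.mpr (hy _ _ (Nat.zero_le _) i.succ_pos).symm))
            (hxy _ _ (Nat.zero_le _) (Nat.zero_le _))
        · exact fun i j _ _ => hxy _ _ (Nat.zero_le _) (Nat.zero_le _)
        · exact fun i j _ h => hx _ _ (Nat.zero_le _) (Fin.succ_lt_succ_iff.mpr h)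
        · exact fun i j _ h => hy _ _ (Nat.zero_le _) (Fin.succ_lt_succ_iff.mpr h)
    · have hsucc : ∀ i : Fin n, s ≤ i → s + 1 ≤ (i.succ : ℕ) := fun i h => by simpa using h
      have h00 : A 0 0 = 1 := by simpa using hone 0 0 (Nat.succ_pos s)
      refine .of_pivot 1 isUnit_one (fun i => A i.succ 0) 0 (by simp [h00]) (by simp [h00]) ?_ ?_
      · intro j
        rw [hone 0 _ (Nat.succ_pos s), if_neg (Fin.succ_ne_zero _).symm]
        simp
      · simp only [Fin.val_succ, add_lt_add_iff_right]
        refine ih s _ (fun i => f i.succ) (fun i => g i.succ) (fun i => u i.succ)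
          (fun i => v i.succ) (fun i => x i.succ) (fun i => y i.succ) ?_ ?_ ?_ ?_ ?_ ?_ ?_ ?_ ?_
        · intro i j h
          simp [hone i.succ j.succ (by simpa using h)]
        · intro i j h h'
          simp [hA i.succ j.succ (hsucc i h) (hsucc j h')]
        · exact fun i j h h' => hf _ _ (hsucc i h) (Fin.succ_le_succ_iff.mpr h')
        · exact fun i j h h' => hg _ _ (hsucc i h) (Fin.succ_le_succ_iff.mpr h')
        · exact fun i h => hu _ (hsucc i h)
        · exact fun i h => hv _ (hsucc i h)
        · exact fun i j h h' => hxy _ _ (hsucc i h) (hsucc j h')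
        · exact fun i j h h' => hx _ _ (hsucc i h) (Fin.succ_lt_succ_iff.mpr h')
        · exact fun i j h h' => hy _ _ (hsucc i h) (Fin.succ_lt_succ_iff.mpr h')

lemma exists_conjugate {t : ℕ} {p : ℕ → ℕ} (hdec : Antitone p) (hlen : ∀ i, t ≤ i → p i = 0) :
    ∃ c : ℕ → ℕ, ∀ i k, i < c k ↔ k < p i := by
  classical
  have h : ∀ k, ∃ i, p i ≤ k := fun k => ⟨t, by simp [hlen t le_rfl]⟩
  refine ⟨fun k => Nat.find (h k), fun i k => ?_⟩
  rw [Nat.lt_find_iff]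
  exact ⟨fun H => not_le.mp (H i le_rfl), fun H m hm => not_le.mpr (H.trans_le (hdec hm))⟩

lemma exists_rank {t : ℕ} {p : ℕ → ℕ} (hdec : Antitone p) (hlen : ∀ i, t ≤ i → p i = 0) :
    ∃ r ≤ t, ∀ k, k < r ↔ k < p k := by
  classical
  have h : ∃ i, p i ≤ i := ⟨t, by simp [hlen t le_rfl]⟩
  refine ⟨Nat.find h, Nat.find_min' h (by simp [hlen t le_rfl]), fun k => ?_⟩
  rw [Nat.lt_find_iff]
  refine ⟨fun H => not_le.mp (H k le_rfl), fun H m hm => ?_⟩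
  have := hdec hm
  omega

lemma prod_diagonalHook {t : ℕ} {p c : ℕ → ℕ} (hdec : Antitone p)
    (hlen : ∀ i, t ≤ i → p i = 0) (hc : ∀ i k, i < c k ↔ k < p i) (k : ℕ) :
    ∏ u ∈ ((Finset.range t ×ˢ Finset.range (p 0)).filter (fun u => u.2 < p u.1)).filter
        (fun u => (u.1 = k ∧ k ≤ u.2) ∨ (u.2 = k ∧ k ≤ u.1)),
      (X + C ((u.2 : ℚ) - (u.1 : ℚ))) =
    if k < p k then armProd (p k - k - 1) * legProd (c k - 1 - k) else 1 := by
  have hmem : ∀ i j, j < p i → i < t ∧ j < p 0 := fun i j h => by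
    have := hdec (Nat.zero_le i)
    refine ⟨?_, by omega⟩
    by_contra! hi
    simp [hlen i hi] at h
  split_ifs with hk
  · have hck := (hc k k).mpr hk
    have hset : ((Finset.range t ×ˢ Finset.range (p 0)).filter (fun u => u.2 < p u.1)).filter
        (fun u => (u.1 = k ∧ k ≤ u.2) ∨ (u.2 = k ∧ k ≤ u.1)) =
        (Finset.range (p k - k - 1)).image (fun s => (k, k + 1 + s)) ∪
        (Finset.range (c k - 1 - k + 1)).image (fun s => (k + s, k)) := by
      ext ⟨i, j⟩
      simp only [Finset.mem_filter, Finset.mem_product, Finset.mem_range, Finset.mem_union,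
        Finset.mem_image, Prod.mk.injEq]
      constructor
      · rintro ⟨⟨-, hij⟩, ⟨rfl, h⟩ | ⟨rfl, h⟩⟩
        · rcases h.eq_or_lt with rfl | h
          · exact Or.inr ⟨0, by omega, by omega, rfl⟩
          · exact Or.inl ⟨j - i - 1, by omega, rfl, by omega⟩
        · have := (hc i j).mpr hij
          exact Or.inr ⟨i - j, by omega, by omega, rfl⟩
      · rintro (⟨s, hs, rfl, rfl⟩ | ⟨s, hs, rfl, rfl⟩)
        · have : k + 1 + s < p k := by omega
          exact ⟨⟨hmem _ _ this, this⟩, Or.inl ⟨rfl, by omega⟩⟩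
        · have := (hc (k + s) k).mp (by omega)
          exact ⟨⟨hmem _ _ this, this⟩, Or.inr ⟨rfl, by omega⟩⟩
    rw [hset, Finset.prod_union, Finset.prod_image, Finset.prod_image, armProd, legProd]
    · congr 1
      · refine Finset.prod_congr rfl fun s _ => ?_
        congr 2
        push_cast
        ring
      · refine Finset.prod_congr rfl fun s _ => ?_
        rw [sub_eq_add_neg X, ← C_neg]
        congr 2
        push_cast
        ring
    · intro a _ b _ h
      simpa using h
    · intro a _ b _ h
      simpa using h
    · rw [Finset.disjoint_left]
      simp only [Finset.mem_image, Finset.mem_range]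
      rintro _ ⟨s, -, rfl⟩ ⟨s', -, h⟩
      simp only [Prod.mk.injEq] at h
      omega
  · refine Finset.prod_eq_one fun u hu => ?_
    simp only [Finset.mem_filter] at hu
    obtain ⟨⟨-, h⟩, ⟨h1, h2⟩ | ⟨h1, h2⟩⟩ := hu
    · rw [h1] at h
      omega
    · have := hdec h2
      omega

/-- The column of a pivot in row `k`: the leg length of the `k`-th diagonal hook, or minus the
content of the end of the row if this is not positive. -/
def pivotColumn (p c : ℕ → ℕ) (k : ℕ) : ℕ := if k < p k then c k - 1 - k else k - p k

lemma pivotColumn_lt {t : ℕ} {p c : ℕ → ℕ} (hlen : ∀ i, t ≤ i → p i = 0)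
    (hc : ∀ i k, i < c k ↔ k < p i) {k : ℕ} (hk : k < t) : pivotColumn p c k < t := by
  have : c k ≤ t := not_lt.mp fun h => by simpa [hlen t le_rfl] using (hc t k).mp h
  unfold pivotColumn
  split_ifs <;> omega

lemma conjugate_antitone {p c : ℕ → ℕ} (hc : ∀ i k, i < c k ↔ k < p i) : Antitone c :=
  fun k _ h => not_lt.mp fun hlt => lt_irrefl (c k) ((hc _ _).mpr (h.trans_lt ((hc _ _).mp hlt)))

lemma pivotColumn_injective {p c : ℕ → ℕ} (hdec : Antitone p)
    (hc : ∀ i k, i < c k ↔ k < p i) : Function.Injective (pivotColumn p c) := by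
  have mixed : ∀ k i, k < p k → ¬ i < p i → c k - 1 - k ≠ i - p i := fun k i hk hi => by
    have h1 := hc k k
    have h2 := hc i k
    omega
  intro k l h
  have hk := hc k k
  have hl := hc l l
  unfold pivotColumn at h
  split_ifs at h with h1 h2 h2
  · rcases le_total k l with hkl | hkl <;> have := conjugate_antitone hc hkl <;> omega
  · exact absurd h (mixed k l h1 h2)
  · exact absurd h.symm (mixed l k h2 h1)
  · rcases le_total k l with hkl | hkl <;> have := hdec hkl <;> omega

end SpecializedJacobiTrudi

open SpecializedJacobiTrudi in
/-- Let `λ` be a partition (given, 0-indexed, by its weakly decreasing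
sequence of parts `p 0 ≥ p 1 ≥ ⋯`, with `p i = 0` for `i ≥ t`, so `t ≥ ℓ(λ)`).  Let `J`
be the t×t Jacobi–Trudi matrix of `λ` with `h_m` specialized to
`h_m(1^x) = C(x+m-1, m) = x(x+1)⋯(x+m-1)/m!`, i.e. with `(i,j)` entry
`C(x + λ_i + j - i - 1, λ_i + j - i)` (and `0` when `λ_i + j - i < 0`).  Then `J` has a
Smith normal form over `ℚ[x]` with diagonal entries `α_1, …, α_t`, where
`α_i = ∏_{u ∈ D_{t-i+1}} (x + c(u))`, the product being over the `(t-i+1)`-st diagonal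
hook of `λ` and `c(i,j) = j - i` the content. -/
theorem stmt16 (t : ℕ) (p : ℕ → ℕ) (hdec : Antitone p) (hlen : ∀ i, t ≤ i → p i = 0)
    (J : Matrix (Fin t) (Fin t) (Polynomial ℚ))
    (hJ : ∀ i j : Fin t, J i j =
      if 0 ≤ ((p i : ℤ) + (j : ℕ) - (i : ℕ)) then
        ((((((p i : ℤ) + (j : ℕ) - (i : ℕ)).toNat).factorial : ℚ)⁻¹ : ℚ) •
          ∏ r ∈ Finset.range (((p i : ℤ) + (j : ℕ) - (i : ℕ)).toNat),
            (Polynomial.X + Polynomial.C (r : ℚ)))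
      else 0)
    (cells : Finset (ℕ × ℕ))
    (hcells : cells =
      (Finset.range t ×ˢ Finset.range (p 0)).filter (fun u => u.2 < p u.1))
    (α : Fin t → Polynomial ℚ)
    (hα : ∀ i : Fin t, α i =
      ∏ u ∈ cells.filter (fun u =>
          (u.1 = t - 1 - (i : ℕ) ∧ t - 1 - (i : ℕ) ≤ u.2) ∨
          (u.2 = t - 1 - (i : ℕ) ∧ t - 1 - (i : ℕ) ≤ u.1)),
        (Polynomial.X + Polynomial.C ((u.2 : ℚ) - (u.1 : ℚ)))) :
    ∃ P Q : Matrix (Fin t) (Fin t) (Polynomial ℚ),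
      IsUnit P.det ∧ IsUnit Q.det ∧
      P * J * Q = Matrix.diagonal α ∧
      ∀ (i : ℕ) (h : i + 1 < t), α ⟨i, Nat.lt_of_succ_lt h⟩ ∣ α ⟨i + 1, h⟩ := by
  obtain ⟨c, hc⟩ := exists_conjugate hdec hlen
  obtain ⟨r, hrt, hr⟩ := exists_rank hdec hlen
  have hα' : ∀ i : Fin t, α i = if (i : ℕ) < t - r then 1 else
      armProd (p (t - 1 - i) - (t - 1 - i) - 1) * legProd (pivotColumn p c (t - 1 - i)) := by
    intro i
    rw [hα, hcells, prod_diagonalHook hdec hlen hc]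
    have := hr (t - 1 - i)
    by_cases h : t - 1 - (i : ℕ) < p (t - 1 - i)
    · rw [if_pos h, if_neg (by omega), pivotColumn, if_pos h]
    · rw [if_neg h, if_pos (by omega)]
  have hdiag : ∀ i : Fin t, t - r ≤ i → t - 1 - (i : ℕ) < p (t - 1 - i) := fun i h =>
    (hr _).mp (by omega)
  have hpc : ∀ i : Fin t, t - r ≤ i →
      pivotColumn p c (t - 1 - i) = c (t - 1 - i) - 1 - (t - 1 - i) := fun i h =>
    if_pos (hdiag i h)
  have hp : ∀ i j : Fin t, t - r ≤ i → i < j →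
      p (t - 1 - i) - (t - 1 - i) < p (t - 1 - j) - (t - 1 - j) := by
    intro i j h hij
    have h1 := hdec (show t - 1 - (j : ℕ) ≤ t - 1 - i by omega)
    have h2 := hdiag i h
    omega
  have hw : ∀ i j : Fin t, t - r ≤ i → i < j →
      pivotColumn p c (t - 1 - i) < pivotColumn p c (t - 1 - j) := by
    intro i j h hij
    rw [hpc i h, hpc j (by omega)]
    have h1 := conjugate_antitone hc (show t - 1 - (j : ℕ) ≤ t - 1 - i by omega)
    have h2 := (hc _ _).mpr (hdiag i h)
    omega
  have hf : ∀ i j : Fin t, t - r ≤ i → i ≤ j →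
      armProd (p (t - 1 - i) - (t - 1 - i) - 1) ∣ armProd (p (t - 1 - j) - (t - 1 - j) - 1) := by
    intro i j h hij
    rcases hij.eq_or_lt with rfl | hij
    · rfl
    · exact armProd_dvd (by have := hp i j h hij; omega)
  have hg : ∀ i j : Fin t, t - r ≤ i → i ≤ j →
      legProd (pivotColumn p c (t - 1 - i)) ∣ legProd (pivotColumn p c (t - 1 - j)) := by
    intro i j h hij
    rcases hij.eq_or_lt with rfl | hij
    · rfl
    · exact legProd_dvd (hw i j h hij).le
  have hchain : ∀ (i : ℕ) (h : i + 1 < t), α ⟨i, Nat.lt_of_succ_lt h⟩ ∣ α ⟨i + 1, h⟩ := by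
    intro i h
    rw [hα' ⟨i, Nat.lt_of_succ_lt h⟩, hα' ⟨i + 1, h⟩]
    by_cases hi : i < t - r
    · rw [if_pos hi]
      exact one_dvd _
    · rw [if_neg hi, if_neg (show ¬ i + 1 < t - r by omega)]
      have hle : (⟨i, Nat.lt_of_succ_lt h⟩ : Fin t) ≤ ⟨i + 1, h⟩ := by simp
      exact mul_dvd_mul (hf _ _ (not_lt.mp hi) hle) (hg _ _ (not_lt.mp hi) hle)
  let w : Fin t → Fin t := fun k => ⟨pivotColumn p c k, pivotColumn_lt hlen hc k.2⟩
  have hwinj : Function.Injective w := fun k l h =>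
    Fin.ext (pivotColumn_injective hdec hc (Fin.mk.inj_iff.mp h))
  let e : Equiv.Perm (Fin t) := Equiv.ofBijective w (Finite.injective_iff_bijective.mp hwinj)
  have hJU : ∀ i j : Fin t, (J * elementaryMatrix t) i j = hookSum ((p i : ℤ) - (i : ℕ)) j := by
    intro i j
    rw [Matrix.mul_apply, ← sum_complete_mul_elementaryMatrix]
    refine Finset.sum_congr rfl fun k _ => ?_
    rw [hJ, sub_add_eq_add_sub]
    rfl
  have hequiv : UnimodEquiv J (Matrix.diagonal α) := by
    refine .of_mul_right (U := elementaryMatrix t) (by simp [det_elementaryMatrix])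
      (.of_submatrix Fin.revPerm (Fin.revPerm.trans e) ?_)
    rw [funext hα']
    have hrev : ∀ i : Fin t, ((Fin.rev i : Fin t) : ℕ) = t - 1 - i := fun i => by
      rw [Fin.val_rev]
      omega
    have hent : ∀ i j : Fin t, (J * elementaryMatrix t).submatrix Fin.revPerm
        (Fin.revPerm.trans e) i j = hookSum ((p (t - 1 - i) : ℤ) - ((t - 1 - i : ℕ) : ℤ))
          (pivotColumn p c (t - 1 - j)) := by
      intro i j
      rw [Matrix.submatrix_apply, hJU, ← hrev, ← hrev]
      rfl
    refine unimodEquiv_diagonal_of_cauchy (t - r) _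
      (fun i => armProd (p (t - 1 - i) - (t - 1 - i) - 1))
      (fun i => legProd (pivotColumn p c (t - 1 - i)))
      (fun i => ((p (t - 1 - i) - (t - 1 - i) - 1).factorial : ℚ)⁻¹)
      (fun j => (-1) ^ pivotColumn p c (t - 1 - j) *
        ((pivotColumn p c (t - 1 - j)).factorial : ℚ)⁻¹)
      (fun i => ((p (t - 1 - i) - (t - 1 - i) : ℕ) : ℚ))
      (fun j => (pivotColumn p c (t - 1 - j) : ℚ)) ?_ ?_ hf hg ?_ ?_ ?_ ?_ ?_
    · intro i j hi
      have hi' : ¬ t - 1 - (i : ℕ) < p (t - 1 - i) := fun h => by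
        have := (hr _).mpr h
        omega
      have hpi : pivotColumn p c (t - 1 - i) = t - 1 - i - p (t - 1 - i) := if_neg hi'
      rw [hent, show ((p (t - 1 - i) : ℤ) - ((t - 1 - i : ℕ) : ℤ)) =
        -((pivotColumn p c (t - 1 - i) : ℕ) : ℤ) by omega, hookSum_neg]
      refine if_congr ?_ rfl rfl
      rw [(pivotColumn_injective hdec hc).eq_iff]
      omega
    · intro i j hi _
      have h := hdiag i hi
      obtain ⟨n, hn⟩ : ∃ n, p (t - 1 - i) - (t - 1 - i) = n + 1 :=
        ⟨p (t - 1 - i) - (t - 1 - i) - 1, by omega⟩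
      rw [hent, show ((p (t - 1 - i) : ℤ) - ((t - 1 - i : ℕ) : ℤ)) = ((n + 1 : ℕ) : ℤ) by omega,
        hookSum_natCast_succ, hn]
      simp
    · exact fun i _ => by positivity
    · exact fun i _ => mul_ne_zero (pow_ne_zero _ (by norm_num)) (by positivity)
    · intro i j hi _
      have : 0 < p (t - 1 - i) - (t - 1 - i) := by
        have := hdiag i hi
        omega
      positivity
    · exact fun i j hi hij => Nat.cast_injective.ne (hp i j hi hij).ne
    · exact fun i j hi hij => Nat.cast_injective.ne (hw i j hi hij).ne
  obtain ⟨P, Q, hP, hQ, h⟩ := hequiv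
  exact ⟨P, Q, hP, hQ, h, hchain⟩
end

section
/- Let λ be a partition with Young diagram {(i,j) : 1 ≤ i ≤ ℓ(λ), 1 ≤ j ≤ λ_i}, and let ρ be the rank of λ (the largest k with λ_k ≥ k). For (r,s) with r,s ≥ 1, let λ(r,s) be the partition whose diagram is {(u,v) ∈ λ : u ≥ r, v ≥ s} (the empty partition if no such squares exist). Associate an indeterminate x_{ij} to each (i,j) ∈ λ, and for each square (r,s) define the polynomial P_{rs} = ∑_{μ ⊆ λ(r,s)} ∏_{(i,j) ∈ λ(r,s)∖μ} x_{ij} ∈ ℤ[x_{ij} : (i,j) ∈ λ], where μ ranges over all partitions contained in λ(r,s); in particular P_{rs} = 1 when λ(r,s) = ∅. Let M be the (ρ+1)×(ρ+1) matrix M = [P_{rs}]_{1 ≤ r,s ≤ ρ+1}, and for 1 ≤ k ≤ ρ+1 let A_{kk} = ∏_{(i,j) ∈ λ(k,k)} x_{ij} (so A_{ρ+1,ρ+1} = 1). Then M has a Smith normal form over ℤ[x_{ij} : (i,j) ∈ λ] whose diagonal entries are A_{ρ+1,ρ+1}, A_{ρρ}, …, A_{22}, A_{11} (note A_{k+1,k+1}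 divides A_{kk}). In particular det M = ± A_{11}A_{22}⋯A_{ρρ}. -/
open scoped Classical

/-- The cells (0-indexed) of the Young diagram of the partition with parts
`p 0 ≥ p 1 ≥ ⋯` (where `p i = 0` for `i ≥ l`). -/
def cellsOf (p : ℕ → ℕ) (l : ℕ) : Finset (ℕ × ℕ) :=
  (Finset.range l ×ˢ Finset.range (p 0)).filter (fun u => u.2 < p u.1)

/-- The polynomial ring `ℤ[x_{ij} : (i,j) ∈ λ]`, one indeterminate per cell of `λ`. -/
abbrev MvR (p : ℕ → ℕ) (l : ℕ) := MvPolynomial ↥(cellsOf p l) ℤ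

/-- The cells of `λ(r,s) = {(u,v) ∈ λ : u ≥ r, v ≥ s}` (0-indexed). -/
noncomputable def cellsRS (p : ℕ → ℕ) (l : ℕ) (r s : ℕ) : Finset ↥(cellsOf p l) :=
  Finset.univ.filter (fun u => r ≤ (u : ℕ × ℕ).1 ∧ s ≤ (u : ℕ × ℕ).2)

/-- `μ` is (the cell set of) a partition contained in `λ(r,s)`: a subset of the cells
of `λ(r,s)` that is upper-left justified within `λ(r,s)`. -/
def IsSubPartition (p : ℕ → ℕ) (l : ℕ) (r s : ℕ) (μ : Finset ↥(cellsOf p l)) : Prop :=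
  μ ⊆ cellsRS p l r s ∧
    ∀ a ∈ μ, ∀ b ∈ cellsRS p l r s,
      (b : ℕ × ℕ).1 ≤ (a : ℕ × ℕ).1 → (b : ℕ × ℕ).2 ≤ (a : ℕ × ℕ).2 → b ∈ μ

/-- The polynomial `P_{rs} = ∑_{μ ⊆ λ(r,s)} ∏_{(i,j) ∈ λ(r,s)∖μ} x_{ij}`, the sum over
all partitions `μ` contained in `λ(r,s)`.  In particular `P_{rs} = 1` if `λ(r,s) = ∅`. -/
noncomputable def Ppoly (p : ℕ → ℕ) (l : ℕ) (r s : ℕ) : MvR p l :=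
  ∑ μ ∈ (cellsRS p l r s).powerset.filter (IsSubPartition p l r s),
    ∏ u ∈ cellsRS p l r s \ μ, MvPolynomial.X u

/-- `A_{kk} = ∏_{(i,j) ∈ λ(k,k)} x_{ij}` (0-indexed `k`). -/
noncomputable def Apoly (p : ℕ → ℕ) (l : ℕ) (k : ℕ) : MvR p l :=
  ∏ u ∈ cellsRS p l k k, MvPolynomial.X u

/-- The rank `ρ` of `λ`: the number of diagonal cells, i.e. the largest `k` with
`λ_k ≥ k` (1-indexed). -/
def rankOf (p : ℕ → ℕ) (l : ℕ) : ℕ := ((Finset.range l).filter (fun i => i < p i)).card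

/-- The generating function `∑_μ ∏_{u ∈ C ∖ μ} x_u` over the subsets `μ` of `C` that are
down-closed within `C`. -/
noncomputable def downsetPoly (p : ℕ → ℕ) (l : ℕ) (C : Finset ↥(cellsOf p l)) : MvR p l :=
  ∑ μ ∈ C.powerset.filter (fun μ : Finset ↥(cellsOf p l) => ∀ a ∈ μ, ∀ b ∈ C,
      (b : ℕ × ℕ).1 ≤ (a : ℕ × ℕ).1 → (b : ℕ × ℕ).2 ≤ (a : ℕ × ℕ).2 → b ∈ μ),
    ∏ u ∈ C \ μ, MvPolynomial.X u

/-- The cells of `λ` in rows `r, …, k - 1` and columns `≥ k`. -/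
noncomputable def armCells (p : ℕ → ℕ) (l : ℕ) (r k : ℕ) : Finset ↥(cellsOf p l) :=
  Finset.univ.filter
    (fun u => r ≤ (u : ℕ × ℕ).1 ∧ (u : ℕ × ℕ).1 < k ∧ k ≤ (u : ℕ × ℕ).2)

/-- The cells of `λ` in rows `≥ k` and columns `s, …, k - 1`. -/
noncomputable def legCells (p : ℕ → ℕ) (l : ℕ) (s k : ℕ) : Finset ↥(cellsOf p l) :=
  Finset.univ.filter
    (fun u => k ≤ (u : ℕ × ℕ).1 ∧ s ≤ (u : ℕ × ℕ).2 ∧ (u : ℕ × ℕ).2 < k)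

/-- The cells of `λ` in rows `r, …, k - 1` and columns `s, …, k - 1`. -/
noncomputable def boxCells (p : ℕ → ℕ) (l : ℕ) (r s k : ℕ) : Finset ↥(cellsOf p l) :=
  Finset.univ.filter (fun u => r ≤ (u : ℕ × ℕ).1 ∧ (u : ℕ × ℕ).1 < k ∧
    s ≤ (u : ℕ × ℕ).2 ∧ (u : ℕ × ℕ).2 < k)

/-- The partitions `μ ⊆ λ(r,s)` whose first missing diagonal cell on or after both `r` and `s`
is `(k,k)`. -/
def FirstMissing (p : ℕ → ℕ) (l : ℕ) (r s k : ℕ) (μ : Finset ↥(cellsOf p l)) : Prop :=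
  r ≤ k ∧ s ≤ k ∧ Disjoint (cellsRS p l k k) μ ∧ boxCells p l r s k ⊆ μ

theorem mem_cellsRS {p : ℕ → ℕ} {l r s : ℕ} {u : ↥(cellsOf p l)} :
    u ∈ cellsRS p l r s ↔ r ≤ (u : ℕ × ℕ).1 ∧ s ≤ (u : ℕ × ℕ).2 := by
  simp [cellsRS]

theorem mem_armCells {p : ℕ → ℕ} {l r k : ℕ} {u : ↥(cellsOf p l)} :
    u ∈ armCells p l r k ↔
      r ≤ (u : ℕ × ℕ).1 ∧ (u : ℕ × ℕ).1 < k ∧ k ≤ (u : ℕ × ℕ).2 := by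
  simp [armCells]

theorem mem_legCells {p : ℕ → ℕ} {l s k : ℕ} {u : ↥(cellsOf p l)} :
    u ∈ legCells p l s k ↔
      k ≤ (u : ℕ × ℕ).1 ∧ s ≤ (u : ℕ × ℕ).2 ∧ (u : ℕ × ℕ).2 < k := by
  simp [legCells]

theorem mem_boxCells {p : ℕ → ℕ} {l r s k : ℕ} {u : ↥(cellsOf p l)} :
    u ∈ boxCells p l r s k ↔ r ≤ (u : ℕ × ℕ).1 ∧ (u : ℕ × ℕ).1 < k ∧
      s ≤ (u : ℕ × ℕ).2 ∧ (u : ℕ × ℕ).2 < k := by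
  simp [boxCells]

theorem lt_rankOf_iff {p : ℕ → ℕ} {l : ℕ} (hdec : Antitone p) (hlen : ∀ i, l ≤ i → p i = 0)
    (i : ℕ) : i < rankOf p l ↔ i < p i := by
  have hex : ∃ n, ¬ n < p n := ⟨l, by simp [hlen l le_rfl]⟩
  obtain ⟨n, hn, hmin⟩ : ∃ n, ¬ n < p n ∧ ∀ m < n, m < p m :=
    ⟨Nat.find hex, Nat.find_spec hex, fun m hm => not_not.mp (Nat.find_min hex hm)⟩
  have key : ∀ j, j < n ↔ j < p j := by
    intro j
    refine ⟨hmin j, fun h => ?_⟩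
    by_contra! hj
    have h2 := hdec hj
    omega
  have hset : (Finset.range l).filter (fun i => i < p i) = Finset.range n := by
    ext j
    simp only [Finset.mem_filter, Finset.mem_range, key]
    refine ⟨fun h => h.2, fun h => ⟨?_, h⟩⟩
    by_contra! hj
    have := hlen j hj
    omega
  rw [rankOf, hset, Finset.card_range, key]

theorem diag_mem_cellsOf {p : ℕ → ℕ} {l : ℕ} (hdec : Antitone p)
    (hlen : ∀ i, l ≤ i → p i = 0) {k : ℕ} (hk : k < rankOf p l) : (k, k) ∈ cellsOf p l := by
  rw [lt_rankOf_iff hdec hlen] at hk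
  have h0 := hdec (Nat.zero_le k)
  have hl : k < l := by
    by_contra! h
    have := hlen k h
    omega
  simp only [cellsOf, Finset.mem_filter, Finset.mem_product, Finset.mem_range]
  omega

theorem cellsRS_rankOf {p : ℕ → ℕ} {l : ℕ} (hdec : Antitone p) (hlen : ∀ i, l ≤ i → p i = 0) :
    cellsRS p l (rankOf p l) (rankOf p l) = ∅ := by
  rw [Finset.eq_empty_iff_forall_notMem]
  rintro ⟨⟨a, b⟩, hab⟩ h
  simp only [cellsOf, Finset.mem_filter, Finset.mem_product, Finset.mem_range] at hab
  replace h : rankOf p l ≤ a ∧ rankOf p l ≤ b := mem_cellsRS.mp h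
  have h1 := (lt_rankOf_iff hdec hlen (rankOf p l)).not.mp (lt_irrefl _)
  have h2 := hdec h.1
  omega

theorem existsUnique_firstMissing {p : ℕ → ℕ} {l : ℕ} (hdec : Antitone p)
    (hlen : ∀ i, l ≤ i → p i = 0) {r s : ℕ} (hr : r ≤ rankOf p l) (hs : s ≤ rankOf p l)
    {μ : Finset ↥(cellsOf p l)} (hμ : IsSubPartition p l r s μ) :
    ∃! k : Fin (rankOf p l + 1), FirstMissing p l r s k μ := by
  have hex : ∃ k, r ≤ k ∧ s ≤ k ∧ Disjoint (cellsRS p l k k) μ :=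
    ⟨rankOf p l, hr, hs, by simp [cellsRS_rankOf hdec hlen]⟩
  obtain ⟨n, ⟨hrk, hsk, hd⟩, hmin⟩ :
      ∃ n, (r ≤ n ∧ s ≤ n ∧ Disjoint (cellsRS p l n n) μ) ∧
        ∀ m < n, ¬ (r ≤ m ∧ s ≤ m ∧ Disjoint (cellsRS p l m m) μ) :=
    ⟨Nat.find hex, Nat.find_spec hex, fun m hm => Nat.find_min hex hm⟩
  have hle : n ≤ rankOf p l := by
    by_contra! h
    exact hmin _ h ⟨hr, hs, by simp [cellsRS_rankOf hdec hlen]⟩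
  have hn : FirstMissing p l r s n μ := by
    refine ⟨hrk, hsk, hd, fun u hu => ?_⟩
    rw [mem_boxCells] at hu
    have hnd : ¬ Disjoint (cellsRS p l (n - 1) (n - 1)) μ :=
      fun h => hmin (n - 1) (by omega) ⟨by omega, by omega, h⟩
    obtain ⟨a, ha, haμ⟩ := Finset.not_disjoint_iff.mp hnd
    rw [mem_cellsRS] at ha
    exact hμ.2 a haμ u (mem_cellsRS.mpr (by omega)) (by omega) (by omega)
  refine ⟨⟨n, by omega⟩, hn, fun k (hk : FirstMissing p l r s k μ) => Fin.ext ?_⟩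
  rcases lt_trichotomy (k : ℕ) n with h | h | h
  · exact (hmin k h ⟨hk.1, hk.2.1, hk.2.2.1⟩).elim
  · exact h
  · have hmem := diag_mem_cellsOf hdec hlen (k := n) (by omega)
    have hin : (⟨(n, n), hmem⟩ : ↥(cellsOf p l)) ∈ cellsRS p l n n :=
      mem_cellsRS.mpr ⟨le_rfl, le_rfl⟩
    exact (Finset.disjoint_left.mp hd hin
      (hk.2.2.2 (mem_boxCells.mpr ⟨hrk, h, hsk, h⟩))).elim

theorem sum_firstMissing {p : ℕ → ℕ} {l : ℕ} {r s k : ℕ} (hr : r ≤ k) (hs : s ≤ k) :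
    ∑ μ ∈ ((cellsRS p l r s).powerset.filter (IsSubPartition p l r s)).filter
        (FirstMissing p l r s k), ∏ u ∈ cellsRS p l r s \ μ, MvPolynomial.X u =
      downsetPoly p l (armCells p l r k) * Apoly p l k * downsetPoly p l (legCells p l s k) := by
  rw [mul_right_comm, downsetPoly, downsetPoly, Finset.sum_mul_sum, ← Finset.sum_product',
    Finset.sum_mul]
  refine Finset.sum_nbij' (fun μ => (μ ∩ armCells p l r k, μ ∩ legCells p l s k))
    (fun ν => ν.1 ∪ ν.2 ∪ boxCells p l r s k) ?_ ?_ ?_ ?_ ?_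
  · intro μ hμ
    simp only [Finset.mem_filter, Finset.mem_powerset] at hμ
    obtain ⟨⟨-, -, hdown⟩, -⟩ := hμ
    simp only [Finset.mem_product, Finset.mem_filter, Finset.mem_powerset]
    refine ⟨⟨Finset.inter_subset_right, fun a ha b hb h1 h2 => ?_⟩,
      ⟨Finset.inter_subset_right, fun a ha b hb h1 h2 => ?_⟩⟩
    · refine Finset.mem_inter.mpr ⟨?_, hb⟩
      rw [mem_armCells] at hb
      exact hdown a (Finset.mem_inter.mp ha).1 b (mem_cellsRS.mpr (by omega)) h1 h2
    · refine Finset.mem_inter.mpr ⟨?_, hb⟩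
      rw [mem_legCells] at hb
      exact hdown a (Finset.mem_inter.mp ha).1 b (mem_cellsRS.mpr (by omega)) h1 h2
  · rintro ⟨α, β⟩ hν
    simp only [Finset.mem_product, Finset.mem_filter, Finset.mem_powerset] at hν
    obtain ⟨⟨hα, hαd⟩, ⟨hβ, hβd⟩⟩ := hν
    have hα' := fun u hu => mem_armCells.mp (@hα u hu)
    have hβ' := fun u hu => mem_legCells.mp (@hβ u hu)
    have hsub : α ∪ β ∪ boxCells p l r s k ⊆ cellsRS p l r s := by
      intro u hu
      rw [mem_cellsRS]
      simp only [Finset.mem_union, mem_boxCells] at hu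
      rcases hu with (hu | hu) | hu
      · have := hα' u hu
        omega
      · have := hβ' u hu
        omega
      · omega
    simp only [Finset.mem_filter, Finset.mem_powerset]
    refine ⟨⟨hsub, hsub, fun a ha b hb h1 h2 => ?_⟩, hr, hs, ?_, Finset.subset_union_right⟩
    · simp only [Finset.mem_union, mem_boxCells] at ha ⊢
      rw [mem_cellsRS] at hb
      rcases ha with (ha | ha) | ha
      · have := hα' a ha
        by_cases hbk : k ≤ (b : ℕ × ℕ).2
        · exact Or.inl (Or.inl (hαd a ha b (mem_armCells.mpr (by omega)) h1 h2))
        · right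
          omega
      · have := hβ' a ha
        by_cases hbk : k ≤ (b : ℕ × ℕ).1
        · exact Or.inl (Or.inr (hβd a ha b (mem_legCells.mpr (by omega)) h1 h2))
        · right
          omega
      · right
        omega
    · rw [Finset.disjoint_left]
      intro u hu hu'
      rw [mem_cellsRS] at hu
      simp only [Finset.mem_union, mem_boxCells] at hu'
      rcases hu' with (hu' | hu') | hu'
      · have := hα' u hu'
        omega
      · have := hβ' u hu'
        omega
      · omega
  · intro μ hμ
    simp only [Finset.mem_filter, Finset.mem_powerset] at hμ
    obtain ⟨⟨hsub, -⟩, -, -, hdisj, hbox⟩ := hμ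
    ext u
    have h1 := @hsub u
    have h2 := @hbox u
    have h3 := @Finset.disjoint_right.mp hdisj u
    simp only [Finset.mem_union, Finset.mem_inter, mem_cellsRS, mem_boxCells, mem_armCells,
      mem_legCells] at *
    by_cases hu : u ∈ μ
    · have h1 := h1 hu
      have h3 := h3 hu
      simp only [hu, true_and, iff_true]
      omega
    · simp only [hu, false_and, false_or, iff_false]
      exact fun h => hu (h2 h)
  · rintro ⟨α, β⟩ hν
    simp only [Finset.mem_product, Finset.mem_filter, Finset.mem_powerset] at hν
    obtain ⟨⟨hα, -⟩, ⟨hβ, -⟩⟩ := hν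
    ext u
    all_goals
      have h1 := @hα u
      have h2 := @hβ u
      simp only [Finset.mem_union, Finset.mem_inter, mem_boxCells, mem_armCells,
        mem_legCells] at *
    · refine ⟨?_, fun h => ⟨Or.inl (Or.inl h), h1 h⟩⟩
      rintro ⟨(h | h) | h, h'⟩
      · exact h
      · have := h2 h
        omega
      · omega
    · refine ⟨?_, fun h => ⟨Or.inl (Or.inr h), h2 h⟩⟩
      rintro ⟨(h | h) | h, h'⟩
      · have := h1 h
        omega
      · exact h
      · omega
  · intro μ hμ
    simp only [Finset.mem_filter, Finset.mem_powerset] at hμ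
    obtain ⟨-, -, -, hdisj, hbox⟩ := hμ
    rw [Apoly, ← Finset.prod_union, ← Finset.prod_union]
    · refine Finset.prod_congr ?_ fun _ _ => rfl
      ext u
      have h2 := @hbox u
      have h3 := @Finset.disjoint_right.mp hdisj u
      simp only [Finset.mem_union, Finset.mem_inter, Finset.mem_sdiff, mem_cellsRS, mem_boxCells,
        mem_armCells, mem_legCells] at *
      by_cases hu : u ∈ μ
      · have h3 := h3 hu
        simp only [hu, true_and, not_true, and_false, false_iff]
        omega
      · have h2 := mt h2 hu
        simp only [hu, false_and, not_false_iff, and_true]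
        omega
    all_goals
      rw [Finset.disjoint_left]
      intro u
      simp only [Finset.mem_union, Finset.mem_sdiff, mem_cellsRS, mem_armCells, mem_legCells]
      omega

theorem Ppoly_eq_sum {p : ℕ → ℕ} {l : ℕ} (hdec : Antitone p) (hlen : ∀ i, l ≤ i → p i = 0)
    {r s : ℕ} (hr : r ≤ rankOf p l) (hs : s ≤ rankOf p l) :
    Ppoly p l r s = ∑ k : Fin (rankOf p l + 1),
      (if r ≤ k then downsetPoly p l (armCells p l r k) else 0) * Apoly p l k *
        (if s ≤ k then downsetPoly p l (legCells p l s k) else 0) := by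
  have hterm : ∀ k : Fin (rankOf p l + 1),
      (if r ≤ k then downsetPoly p l (armCells p l r k) else 0) * Apoly p l k *
        (if s ≤ k then downsetPoly p l (legCells p l s k) else 0) =
      ∑ μ ∈ ((cellsRS p l r s).powerset.filter (IsSubPartition p l r s)).filter
        (FirstMissing p l r s k), ∏ u ∈ cellsRS p l r s \ μ, MvPolynomial.X u := by
    intro k
    by_cases h : r ≤ k ∧ s ≤ k
    · rw [sum_firstMissing h.1 h.2, if_pos h.1, if_pos h.2]
    · rw [Finset.filter_false_of_mem fun μ _ hf => h ⟨hf.1, hf.2.1⟩, Finset.sum_empty]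
      rcases not_and_or.mp h with h | h <;> simp [h]
  rw [Finset.sum_congr rfl fun k _ => (hterm k).trans (Finset.sum_filter _ _),
    Finset.sum_comm, Ppoly]
  refine Finset.sum_congr rfl fun μ hμ => ?_
  obtain ⟨k, hk, huniq⟩ :=
    existsUnique_firstMissing hdec hlen hr hs (Finset.mem_filter.mp hμ).2
  rw [Finset.sum_eq_single k (fun j _ hj => if_neg fun h => hj (huniq j h)) (by simp),
    if_pos hk]

theorem downsetPoly_empty (p : ℕ → ℕ) (l : ℕ) : downsetPoly p l ∅ = 1 := by
  simp [downsetPoly]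

theorem Apoly_dvd_Apoly (p : ℕ → ℕ) (l : ℕ) {j k : ℕ} (h : j ≤ k) :
    Apoly p l k ∣ Apoly p l j := by
  refine Finset.prod_dvd_prod_of_subset _ _ _ fun u hu => ?_
  rw [mem_cellsRS] at hu ⊢
  omega

/-- `M = U D L` with `U` and `L` of determinant `1` and `D` diagonal. -/
theorem exists_factorization {p : ℕ → ℕ} {l : ℕ} (hdec : Antitone p)
    (hlen : ∀ i, l ≤ i → p i = 0) :
    ∃ U L : Matrix (Fin (rankOf p l + 1)) (Fin (rankOf p l + 1)) (MvR p l),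
      U.det = 1 ∧ L.det = 1 ∧
      (Matrix.of fun r s : Fin (rankOf p l + 1) => Ppoly p l (r : ℕ) (s : ℕ)) =
        U * Matrix.diagonal (fun k : Fin (rankOf p l + 1) => Apoly p l k) * L := by
  refine ⟨Matrix.of fun r k => if (r : ℕ) ≤ k then downsetPoly p l (armCells p l r k) else 0,
    Matrix.of fun k s => if (s : ℕ) ≤ k then downsetPoly p l (legCells p l s k) else 0,
    ?_, ?_, ?_⟩
  · rw [Matrix.det_of_isUpperTriangular]
    · refine Finset.prod_eq_one fun k _ => ?_
      have : armCells p l k k = ∅ := by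
        rw [armCells, Finset.filter_false_of_mem]
        intro u _
        omega
      simp [this, downsetPoly_empty]
    · intro i j h
      exact if_neg (not_le.mpr h)
  · rw [Matrix.det_of_isLowerTriangular]
    · refine Finset.prod_eq_one fun k _ => ?_
      have : legCells p l k k = ∅ := by
        rw [legCells, Finset.filter_false_of_mem]
        intro u _
        omega
      simp [this, downsetPoly_empty]
    · intro i j h
      exact if_neg (not_le.mpr h)
  · ext1 r s
    rw [Matrix.mul_apply]
    simp only [Matrix.mul_diagonal, Matrix.of_apply]
    exact Ppoly_eq_sum hdec hlen (by omega) (by omega)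

/-- The `(ρ+1)×(ρ+1)` matrix `M = [P_{rs}]` has a Smith normal form over
`ℤ[x_{ij} : (i,j) ∈ λ]` with diagonal entries `A_{ρ+1,ρ+1}, A_{ρρ}, …, A_{22}, A_{11}`
(each dividing the next).  In particular `det M = ± A_{11} A_{22} ⋯ A_{ρρ}`. -/
theorem stmt17 (p : ℕ → ℕ) (l : ℕ) (hdec : Antitone p) (hlen : ∀ i, l ≤ i → p i = 0) :
    ∃ P Q : Matrix (Fin (rankOf p l + 1)) (Fin (rankOf p l + 1)) (MvR p l),
      IsUnit P.det ∧ IsUnit Q.det ∧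
      P * (Matrix.of fun r s : Fin (rankOf p l + 1) => Ppoly p l (r : ℕ) (s : ℕ)) * Q =
        Matrix.diagonal (fun i : Fin (rankOf p l + 1) => Apoly p l (rankOf p l - (i : ℕ))) ∧
      (∀ (i : ℕ), i + 1 < rankOf p l + 1 →
        Apoly p l (rankOf p l - i) ∣ Apoly p l (rankOf p l - (i + 1))) ∧
      ((Matrix.of fun r s : Fin (rankOf p l + 1) => Ppoly p l (r : ℕ) (s : ℕ)).det =
          ∏ k ∈ Finset.range (rankOf p l), Apoly p l k ∨
       (Matrix.of fun r s : Fin (rankOf p l + 1) => Ppoly p l (r : ℕ) (s : ℕ)).det =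
          -∏ k ∈ Finset.range (rankOf p l), Apoly p l k) := by
  obtain ⟨U, L, hU, hL, hM⟩ := exists_factorization hdec hlen
  have hU' : IsUnit U.det := by simp [hU]
  have hL' : IsUnit L.det := by simp [hL]
  rw [hM]
  refine ⟨U⁻¹.submatrix Fin.revPerm id, L⁻¹.submatrix id Fin.revPerm, ?_, ?_, ?_,
    fun i _ => Apoly_dvd_Apoly p l (by omega), Or.inl ?_⟩
  · rw [Matrix.det_permute, Matrix.det_nonsing_inv, hU, Ring.inverse_one, mul_one]
    exact (Equiv.Perm.sign _).isUnit.map (Int.castRingHom _)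
  · rw [Matrix.det_permute', Matrix.det_nonsing_inv, hL, Ring.inverse_one, mul_one]
    exact (Equiv.Perm.sign _).isUnit.map (Int.castRingHom _)
  · have hD : U⁻¹ * (U * Matrix.diagonal (fun k : Fin (rankOf p l + 1) => Apoly p l k) * L) *
        L⁻¹ = Matrix.diagonal (fun k : Fin (rankOf p l + 1) => Apoly p l k) := by
      rw [Matrix.mul_assoc U, Matrix.nonsing_inv_mul_cancel_left _ _ hU',
        Matrix.mul_nonsing_inv_cancel_right _ _ hL']
    rw [← Matrix.submatrix_id_id (U * _ * L), ← Matrix.submatrix_mul _ _ _ _ _ Function.bijective_id,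
      ← Matrix.submatrix_mul _ _ _ _ _ Function.bijective_id, hD,
      Matrix.submatrix_diagonal_equiv]
    congr 1
    ext1 i
    simp only [Function.comp_apply, Fin.revPerm_apply, Fin.val_rev]
    congr 1
    omega
  · rw [Matrix.det_mul, Matrix.det_mul, hU, hL, Matrix.det_diagonal, one_mul, mul_one,
      Fin.prod_univ_castSucc]
    have hlast : Apoly p l (rankOf p l) = 1 := by
      rw [Apoly, cellsRS_rankOf hdec hlen, Finset.prod_empty]
    simp [hlast, Finset.prod_range]
end

section
/- (Carlitz–Roselle–Scoville) Let λ be a partition with rank ρ (the largest k with λ_k ≥ k). For (r,s) with r,s ≥ 1, let λ(r,s) be the partition whose diagram is {(u,v) ∈ λ : u ≥ r, v ≥ s}, and let N_{rs} be the number of partitions μ contained in λ(r,s) (so N_{rs} = 1 when λ(r,s) = ∅). Then the (ρ+1)×(ρ+1) integer matrix [N_{rs}]_{1 ≤ r,s ≤ ρ+1} has determinant ±1. -/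
open scoped Classical

/-- `N_{rs}`: the number of partitions `μ` contained in `λ(r,s)` (`N_{rs} = 1` when
`λ(r,s) = ∅`, counting the empty partition). -/
noncomputable def Ncount (p : ℕ → ℕ) (l : ℕ) (r s : ℕ) : ℕ :=
  ((cellsRS p l r s).powerset.filter (IsSubPartition p l r s)).card

/-- The subsets of `S` that are closed, within `S`, under moving weakly up and left. -/
noncomputable def relLowerSets (S : Finset (ℕ × ℕ)) : Finset (Finset (ℕ × ℕ)) :=
  S.powerset.filter fun T => ∀ a ∈ T, ∀ b ∈ S, b.1 ≤ a.1 → b.2 ≤ a.2 → b ∈ T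

theorem mem_relLowerSets {S T : Finset (ℕ × ℕ)} :
    T ∈ relLowerSets S ↔ T ⊆ S ∧ ∀ a ∈ T, ∀ b ∈ S, b.1 ≤ a.1 → b.2 ≤ a.2 → b ∈ T := by
  simp [relLowerSets]

theorem relLowerSets_empty : relLowerSets ∅ = {∅} := by
  ext T
  simp only [mem_relLowerSets, Finset.subset_empty, Finset.mem_singleton]
  exact ⟨fun h => h.1, fun h => ⟨h, by simp [h]⟩⟩

theorem mem_cellsOf {p : ℕ → ℕ} {l : ℕ} (hdec : Antitone p) (hlen : ∀ i, l ≤ i → p i = 0)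
    (u : ℕ × ℕ) : u ∈ cellsOf p l ↔ u.2 < p u.1 := by
  simp only [cellsOf, Finset.mem_filter, Finset.mem_product, Finset.mem_range]
  refine ⟨fun h => h.2, fun h => ⟨⟨?_, h.trans_le (hdec (Nat.zero_le _))⟩, h⟩⟩
  by_contra hl
  have := hlen u.1 (not_lt.1 hl)
  omega

/-- The cells of `λ(r,s)` as a subset of `ℕ × ℕ`. -/
def quadrant (p : ℕ → ℕ) (l r s : ℕ) : Finset (ℕ × ℕ) :=
  (cellsOf p l).filter fun u => r ≤ u.1 ∧ s ≤ u.2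

/-- The cells of the diagram in rows `r, …, i - 1` and columns `≥ i`. -/
def rightArm (p : ℕ → ℕ) (l r i : ℕ) : Finset (ℕ × ℕ) :=
  (cellsOf p l).filter fun u => r ≤ u.1 ∧ u.1 < i ∧ i ≤ u.2

/-- The cells of the diagram in rows `≥ i` and columns `s, …, i - 1`. -/
def lowerLeg (p : ℕ → ℕ) (l s i : ℕ) : Finset (ℕ × ℕ) :=
  (cellsOf p l).filter fun u => i ≤ u.1 ∧ s ≤ u.2 ∧ u.2 < i

theorem rightArm_self (p : ℕ → ℕ) (l r : ℕ) : rightArm p l r r = ∅ :=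
  Finset.filter_eq_empty_iff.2 fun _ _ => by omega

theorem lowerLeg_self (p : ℕ → ℕ) (l s : ℕ) : lowerLeg p l s s = ∅ :=
  Finset.filter_eq_empty_iff.2 fun _ _ => by omega

theorem Ncount_eq_card_relLowerSets (p : ℕ → ℕ) (l r s : ℕ) :
    Ncount p l r s = (relLowerSets (quadrant p l r s)).card := by
  have hmem : ∀ u (hu : u ∈ cellsOf p l),
      ((⟨u, hu⟩ : ↥(cellsOf p l)) ∈ cellsRS p l r s ↔ u ∈ quadrant p l r s) := by
    intro u hu
    simp [cellsRS, quadrant, hu]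
  have hsub : ∀ u ∈ quadrant p l r s, u ∈ cellsOf p l := fun u hu => (Finset.mem_filter.1 hu).1
  unfold Ncount
  refine Finset.card_bij (fun T _ => T.map (Function.Embedding.subtype _)) ?_ ?_ ?_
  · intro T hT
    obtain ⟨-, hTs, hTl⟩ := Finset.mem_filter.1 hT
    rw [mem_relLowerSets]
    constructor
    · intro u hu
      obtain ⟨⟨v, hv⟩, hvT, rfl⟩ := Finset.mem_map.1 hu
      exact (hmem v hv).1 (hTs hvT)
    · intro a ha b hb h1 h2
      obtain ⟨v, hvT, rfl⟩ := Finset.mem_map.1 ha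
      exact Finset.mem_map.2
        ⟨⟨b, hsub b hb⟩, hTl v hvT _ ((hmem b (hsub b hb)).2 hb) h1 h2, rfl⟩
  · intro T _ T' _ h
    exact Finset.map_injective _ h
  · intro T hT
    obtain ⟨hTs, hTl⟩ := mem_relLowerSets.1 hT
    refine ⟨Finset.univ.filter fun u => (u : ℕ × ℕ) ∈ T, ?_, ?_⟩
    · have hs : (Finset.univ.filter fun u : ↥(cellsOf p l) => (u : ℕ × ℕ) ∈ T)
          ⊆ cellsRS p l r s := fun u hu =>
        (hmem u.1 u.2).2 (hTs (Finset.mem_filter.1 hu).2)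
      refine Finset.mem_filter.2 ⟨Finset.mem_powerset.2 hs, hs, fun a ha b hb h1 h2 => ?_⟩
      exact Finset.mem_filter.2 ⟨Finset.mem_univ _,
        hTl _ (Finset.mem_filter.1 ha).2 _ ((hmem b.1 b.2).1 hb) h1 h2⟩
    · ext u
      simp only [Finset.mem_map, Finset.mem_filter, Finset.mem_univ, true_and,
        Function.Embedding.subtype_apply]
      exact ⟨fun ⟨v, hv, hvu⟩ => hvu ▸ hv, fun hu => ⟨⟨u, hsub u (hTs hu)⟩, hu, rfl⟩⟩

/-- The boundary path of a partition inside `λ(r,s)` meets the main diagonal exactly once, at a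
vertex `(i,i)`; the partition is the box above and to the left of that vertex together with
independent choices in the arm and in the leg. -/
theorem card_relLowerSets_quadrant {p : ℕ → ℕ} {l : ℕ} (hdec : Antitone p)
    (hlen : ∀ i, l ≤ i → p i = 0) {r s : ℕ} (hr : r ≤ rankOf p l) (hs : s ≤ rankOf p l) :
    (relLowerSets (quadrant p l r s)).card =
      ∑ i ∈ (Finset.range (rankOf p l + 1)).filter (fun i => r ≤ i ∧ s ≤ i),
        (relLowerSets (rightArm p l r i)).card * (relLowerSets (lowerLeg p l s i)).card := by
  have hQ : ∀ u, u ∈ quadrant p l r s ↔ u.2 < p u.1 ∧ r ≤ u.1 ∧ s ≤ u.2 := fun u => by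
    rw [quadrant, Finset.mem_filter, mem_cellsOf hdec hlen]
  have hR : ∀ i u, u ∈ rightArm p l r i ↔ u.2 < p u.1 ∧ r ≤ u.1 ∧ u.1 < i ∧ i ≤ u.2 :=
    fun i u => by rw [rightArm, Finset.mem_filter, mem_cellsOf hdec hlen]
  have hL : ∀ i u, u ∈ lowerLeg p l s i ↔ u.2 < p u.1 ∧ i ≤ u.1 ∧ s ≤ u.2 ∧ u.2 < i :=
    fun i u => by rw [lowerLeg, Finset.mem_filter, mem_cellsOf hdec hlen]
  have hbox : ∀ i, i ≤ rankOf p l → ∀ u : ℕ × ℕ, u.1 < i → u.2 < i → u.2 < p u.1 := by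
    intro i hi u h1 h2
    have h3 := (lt_rankOf_iff hdec hlen (i - 1)).1 (by omega)
    have h4 : p (i - 1) ≤ p u.1 := hdec (by omega)
    omega
  let glue : (Σ _ : ℕ, Finset (ℕ × ℕ) × Finset (ℕ × ℕ)) → Finset (ℕ × ℕ) := fun x =>
    (quadrant p l r s).filter (fun u => u.1 < x.1 ∧ u.2 < x.1) ∪ (x.2.1 ∪ x.2.2)
  have hglue : ∀ i X Y u, u ∈ glue ⟨i, X, Y⟩ ↔
      (u ∈ quadrant p l r s ∧ u.1 < i ∧ u.2 < i) ∨ u ∈ X ∨ u ∈ Y := by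
    intro i X Y u
    simp [glue]
  simp_rw [← Finset.card_product]
  rw [← Finset.card_sigma]
  symm
  refine Finset.card_bij (fun x _ => glue x) ?_ ?_ ?_
  · rintro ⟨i, X, Y⟩ h
    simp only [Finset.mem_sigma, Finset.mem_filter, Finset.mem_range, Finset.mem_product,
      mem_relLowerSets] at h
    obtain ⟨⟨hi, hri, hsi⟩, ⟨hXs, hXl⟩, hYs, hYl⟩ := h
    rw [mem_relLowerSets]
    constructor
    · intro u hu
      rcases (hglue i X Y u).1 hu with h | h | h
      · exact h.1
      · have := (hR i u).1 (hXs h)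
        exact (hQ u).2 (by omega)
      · have := (hL i u).1 (hYs h)
        exact (hQ u).2 (by omega)
    · intro a ha b hb h1 h2
      have hb' := (hQ b).1 hb
      rw [hglue] at ha ⊢
      rcases ha with h | h | h
      · exact Or.inl ⟨hb, by omega, by omega⟩
      · have := (hR i a).1 (hXs h)
        by_cases hc : b.2 < i
        · exact Or.inl ⟨hb, by omega, hc⟩
        · exact Or.inr (Or.inl (hXl a h b ((hR i b).2 (by omega)) h1 h2))
      · have := (hL i a).1 (hYs h)
        by_cases hc : b.1 < i
        · exact Or.inl ⟨hb, hc, by omega⟩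
        · exact Or.inr (Or.inr (hYl a h b ((hL i b).2 (by omega)) h1 h2))
  · have hdiag : ∀ i X Y, X ⊆ rightArm p l r i → Y ⊆ lowerLeg p l s i →
        i ≤ rankOf p l → ∀ j, r ≤ j → s ≤ j → ((j, j) ∈ glue ⟨i, X, Y⟩ ↔ j < i) := by
      intro i X Y hX hY hi j hrj hsj
      rw [hglue]
      constructor
      · rintro (h | h | h)
        · exact h.2.1
        · exact ((hR i _).1 (hX h)).2.2.1
        · exact ((hL i _).1 (hY h)).2.2.2
      · intro h
        exact Or.inl ⟨(hQ _).2 ⟨hbox i hi (j, j) h h, hrj, hsj⟩, h, h⟩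
    rintro ⟨i, X, Y⟩ h ⟨j, X', Y'⟩ h' heq
    simp only [Finset.mem_sigma, Finset.mem_filter, Finset.mem_range, Finset.mem_product,
      mem_relLowerSets] at h h' heq
    obtain ⟨⟨hi, hri, hsi⟩, ⟨hXs, -⟩, hYs, -⟩ := h
    obtain ⟨⟨hj, hrj, hsj⟩, ⟨hXs', -⟩, hYs', -⟩ := h'
    have hij : i = j := by
      have h1 := hdiag i X Y hXs hYs (by omega)
      have h2 := hdiag j X' Y' hXs' hYs' (by omega)
      have h3 := (h1 i hri hsi).symm.trans (heq ▸ h2 i hri hsi)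
      have h4 := (h1 j hrj hsj).symm.trans (heq ▸ h2 j hrj hsj)
      omega
    subst hij
    have hmem : ∀ u, u ∈ glue ⟨i, X, Y⟩ ↔ u ∈ glue ⟨i, X', Y'⟩ := fun u => by rw [heq]
    simp only [hglue] at hmem
    have hX : X = X' := by
      ext u
      have h0 := hmem u
      have h1 : u ∈ X → _ := fun h => (hR i u).1 (hXs h)
      have h2 : u ∈ X' → _ := fun h => (hR i u).1 (hXs' h)
      have h3 : u ∈ Y → _ := fun h => (hL i u).1 (hYs h)
      have h4 : u ∈ Y' → _ := fun h => (hL i u).1 (hYs' h)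
      grind
    have hY : Y = Y' := by
      ext u
      have h0 := hmem u
      have h1 : u ∈ X → _ := fun h => (hR i u).1 (hXs h)
      have h2 : u ∈ X' → _ := fun h => (hR i u).1 (hXs' h)
      have h3 : u ∈ Y → _ := fun h => (hL i u).1 (hYs h)
      have h4 : u ∈ Y' → _ := fun h => (hL i u).1 (hYs' h)
      grind
    rw [hX, hY]
  · intro T hT
    obtain ⟨hTs, hTl⟩ := mem_relLowerSets.1 hT
    have hlast : max r s ≤ rankOf p l ∧ (rankOf p l, rankOf p l) ∉ T := by
      refine ⟨max_le hr hs, fun h => ?_⟩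
      exact lt_irrefl _ ((lt_rankOf_iff hdec hlen _).2 ((hQ _).1 (hTs h)).1)
    have hex : ∃ i, max r s ≤ i ∧ (i, i) ∉ T := ⟨_, hlast⟩
    obtain ⟨i, ⟨hmi, hiT⟩, hmin⟩ : ∃ i, (max r s ≤ i ∧ (i, i) ∉ T) ∧
        ∀ j < i, ¬ (max r s ≤ j ∧ (j, j) ∉ T) :=
      ⟨Nat.find hex, Nat.find_spec hex, fun j hj => Nat.find_min hex hj⟩
    have hi : i ≤ rankOf p l := by
      by_contra hc
      exact hmin _ (not_le.1 hc) hlast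
    have hri : r ≤ i := (le_max_left _ _).trans hmi
    have hsi : s ≤ i := (le_max_right _ _).trans hmi
    have hno : ∀ u ∈ T, ¬ (i ≤ u.1 ∧ i ≤ u.2) := by
      rintro u hu ⟨h1, h2⟩
      have h3 := (hQ u).1 (hTs hu)
      have h4 := hdec h1
      exact hiT (hTl u hu (i, i) ((hQ _).2 ⟨by simp only; omega, hri, hsi⟩) h1 h2)
    have hfull : ∀ u ∈ quadrant p l r s, u.1 < i → u.2 < i → u ∈ T := by
      intro u hu h1 h2
      have h3 := (hQ u).1 hu
      have h4 : (i - 1, i - 1) ∈ T := by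
        by_contra hc
        exact hmin (i - 1) (by omega) ⟨by omega, hc⟩
      exact hTl _ h4 u hu (by simp only; omega) (by simp only; omega)
    refine ⟨⟨i, T.filter (fun u => i ≤ u.2), T.filter (fun u => i ≤ u.1)⟩, ?_, ?_⟩
    · simp only [Finset.mem_sigma, Finset.mem_filter, Finset.mem_range, Finset.mem_product,
        mem_relLowerSets]
      refine ⟨⟨by omega, hri, hsi⟩, ⟨?_, ?_⟩, ?_, ?_⟩
      · intro u hu
        obtain ⟨hu, hu2⟩ := Finset.mem_filter.1 hu
        have h3 := (hQ u).1 (hTs hu)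
        have h4 := hno u hu
        exact (hR i u).2 (by omega)
      · intro a ha b hb h1 h2
        have h3 := (hR i b).1 hb
        exact ⟨hTl a ha.1 b ((hQ b).2 (by omega)) h1 h2, by omega⟩
      · intro u hu
        obtain ⟨hu, hu2⟩ := Finset.mem_filter.1 hu
        have h3 := (hQ u).1 (hTs hu)
        have h4 := hno u hu
        exact (hL i u).2 (by omega)
      · intro a ha b hb h1 h2
        have h3 := (hL i b).1 hb
        exact ⟨hTl a ha.1 b ((hQ b).2 (by omega)) h1 h2, by omega⟩
    · ext u
      rw [hglue]
      simp only [Finset.mem_filter]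
      constructor
      · rintro (h | h | h)
        · exact hfull u h.1 h.2.1 h.2.2
        · exact h.1
        · exact h.1
      · intro hu
        by_cases h1 : i ≤ u.1
        · exact Or.inr (Or.inr ⟨hu, h1⟩)
        by_cases h2 : i ≤ u.2
        · exact Or.inr (Or.inl ⟨hu, h2⟩)
        exact Or.inl ⟨hTs hu, not_le.1 h1, not_le.1 h2⟩

theorem det_eq_one_of_upper_unitriangular {n : ℕ} (f : ℕ → ℕ → ℤ) (hf : ∀ i, f i i = 1) :
    (Matrix.of fun r i : Fin n => if r ≤ i then f r i else 0).det = 1 := by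
  rw [Matrix.det_of_isUpperTriangular]
  · simp [hf]
  · intro i j hij
    exact if_neg (not_le.2 hij)

theorem det_Ncount_eq_one {p : ℕ → ℕ} {l : ℕ} (hdec : Antitone p)
    (hlen : ∀ i, l ≤ i → p i = 0) :
    (Matrix.of fun r s : Fin (rankOf p l + 1) => (Ncount p l (r : ℕ) (s : ℕ) : ℤ)).det = 1 := by
  let A : Matrix (Fin (rankOf p l + 1)) (Fin (rankOf p l + 1)) ℤ :=
    Matrix.of fun r i => if r ≤ i then ((relLowerSets (rightArm p l r i)).card : ℤ) else 0
  let B : Matrix (Fin (rankOf p l + 1)) (Fin (rankOf p l + 1)) ℤ :=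
    Matrix.of fun s i => if s ≤ i then ((relLowerSets (lowerLeg p l s i)).card : ℤ) else 0
  have hA : A.det = 1 :=
    det_eq_one_of_upper_unitriangular (fun r i => ((relLowerSets (rightArm p l r i)).card : ℤ))
      fun i => by simp [rightArm_self, relLowerSets_empty]
  have hB : B.det = 1 :=
    det_eq_one_of_upper_unitriangular (fun s i => ((relLowerSets (lowerLeg p l s i)).card : ℤ))
      fun i => by simp [lowerLeg_self, relLowerSets_empty]
  have hAB : (Matrix.of fun r s : Fin (rankOf p l + 1) => (Ncount p l (r : ℕ) (s : ℕ) : ℤ)) =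
      A * B.transpose := by
    ext r s
    rw [Matrix.of_apply, Ncount_eq_card_relLowerSets,
      card_relLowerSets_quadrant hdec hlen (Nat.lt_succ_iff.1 r.2) (Nat.lt_succ_iff.1 s.2),
      Finset.sum_filter, Finset.sum_range, Matrix.mul_apply]
    push_cast
    refine Finset.sum_congr rfl fun i _ => ?_
    simp only [A, B, Matrix.transpose_apply, Matrix.of_apply, ← Fin.val_fin_le, ite_and]
    split_ifs <;> simp
  rw [hAB, Matrix.det_mul, Matrix.det_transpose, hA, hB, one_mul]

/-- Carlitz–Roselle–Scoville: the `(ρ+1)×(ρ+1)` integer matrix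
`[N_{rs}]` has determinant `±1`. -/
theorem stmt18 (p : ℕ → ℕ) (l : ℕ) (hdec : Antitone p) (hlen : ∀ i, l ≤ i → p i = 0) :
    (Matrix.of fun r s : Fin (rankOf p l + 1) =>
        (Ncount p l (r : ℕ) (s : ℕ) : ℤ)).det = 1 ∨
    (Matrix.of fun r s : Fin (rankOf p l + 1) =>
        (Ncount p l (r : ℕ) (s : ℕ) : ℤ)).det = -1 := by
  exact Or.inl (det_Ncount_eq_one hdec hlen)
end

section
/- (Zagier) Fix n ≥ 1. For a permutation w in the symmetric group S_n, let inv(w) = #{(i,j) : 1 ≤ i < j ≤ n, w(i) > w(j)} be the number of inversions of w. Let V be the n!×n! matrix over the polynomial ring ℚ[q] with rows and columns indexed by S_n whose (u,v)-entry is q^{inv(v·u^{−1})} (the q-Varchenko matrix of the braid arrangement). Then det V = ∏_{j=2}^{n} (1 − q^{j(j−1)})^{C(n,j)·(j−2)!·(n−j+1)!}, where C(n,j) is the binomial coefficient. -/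
open Polynomial

/-- The number of inversions of a permutation `w` of `{0, …, n-1}`. -/
def invCount {n : ℕ} (w : Equiv.Perm (Fin n)) : ℕ :=
  ((Finset.univ : Finset (Fin n × Fin n)).filter
    (fun p => p.1 < p.2 ∧ w p.2 < w p.1)).card

theorem exists_equiv_pow_mul {G : Type*} [Group G] [Finite G] (g : G) (n : ℕ) (hg : orderOf g = n + 1) :
    ∃ e : Fin (n + 1) × (G ⧸ Subgroup.zpowers g) ≃ G,
      ∀ k c, e (k, c) = g ^ k.val * (Quotient.out c)⁻¹ := by
  refine ⟨Equiv.ofBijective (fun p => g ^ p.1.val * (Quotient.out p.2)⁻¹) ⟨?_, ?_⟩, fun _ _ => rfl⟩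
  · rintro ⟨k, c⟩ ⟨l, d⟩ h
    simp only at h
    have hcd : c = d := by
      rw [← Quotient.out_eq c, ← Quotient.out_eq d]
      refine QuotientGroup.eq.2 ⟨(l : ℤ) - k, ?_⟩
      simp only [zpow_sub, zpow_natCast]
      have : (Quotient.out c)⁻¹ = (g ^ k.val)⁻¹ * (g ^ l.val * (Quotient.out d)⁻¹) := by
        rw [← h]; group
      rw [this, ← zpow_natCast, ← zpow_natCast]
      group
    subst hcd
    have hkl : g ^ k.val = g ^ l.val := mul_right_cancel h
    have := pow_injOn_Iio_orderOf (x := g) (by simp only [hg, Set.mem_Iio]; omega)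
      (by simp only [hg, Set.mem_Iio]; omega) hkl
    simp [Fin.ext this]
  · intro u
    let c : G ⧸ Subgroup.zpowers g := QuotientGroup.mk u⁻¹
    have hc : (QuotientGroup.mk (Quotient.out c) : G ⧸ Subgroup.zpowers g) = QuotientGroup.mk u⁻¹ :=
      Quotient.out_eq c
    have hmem : u * Quotient.out c ∈ Subgroup.zpowers g := by
      simpa using QuotientGroup.eq.1 hc.symm
    have hmem' := (mem_powers_iff_mem_zpowers).2 hmem
    obtain ⟨k, hk⟩ := hmem'
    refine ⟨(⟨k % (n + 1), Nat.mod_lt _ n.succ_pos⟩, c), ?_⟩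
    simp only at hk ⊢
    rw [← hg, pow_mod_orderOf, hk]
    group

section Regular

variable {G R : Type*} [Group G] [Fintype G] [DecidableEq G] [CommRing R]

/-- The matrix of left multiplication by `g` on the group algebra. -/
def leftRegular (R : Type*) [CommRing R] : G →* Matrix G G R where
  toFun g := Matrix.of fun u v => if u = g * v then 1 else 0
  map_one' := by ext u v; simp [Matrix.one_apply]
  map_mul' g h := by ext u v; simp [Matrix.mul_apply, mul_assoc]

theorem leftRegular_apply (g u v : G) :
    leftRegular R g u v = if u = g * v then 1 else 0 := rfl

theorem det_one_sub_smul_cyclicShift (n : ℕ) (x : R) :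
    (Matrix.of fun i j : Fin (n + 1) =>
      (if i = j then 1 else 0) - x * (if i = j + 1 then 1 else 0)).det = 1 - x ^ (n + 1) := by
  let A : Matrix (Fin (n + 1)) (Fin (n + 1)) R := Matrix.of fun i j =>
    (if i = j then 1 else 0) - x ^ (i.val + 1) * (if j = Fin.last n then 1 else 0)
  rw [← Matrix.det_eq_of_forall_row_eq_smul_add_pred (A := A) (fun _ => x)]
  · rw [Matrix.det_of_isUpperTriangular]
    · rw [Fin.prod_univ_castSucc]
      simp [A, Fin.castSucc_ne_last]
    · intro i j hij
      have h1 : i ≠ j := ne_of_gt hij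
      have h2 : j ≠ Fin.last n := ne_of_lt (lt_of_lt_of_le hij (Fin.le_last i))
      simp [A, h1, h2]
  · intro j
    have : (0 : Fin (n + 1)) = j + 1 ↔ j = Fin.last n := by
      rw [eq_comm, ← Fin.last_add_one, add_left_inj]
    simp [A, this]
  · intro i j
    have : i.succ = j + 1 ↔ i.castSucc = j := by
      rw [← Fin.coeSucc_eq_succ, add_left_inj]
    simp only [A, Matrix.of_apply, this, Fin.val_succ, Fin.val_castSucc]
    ring

theorem det_one_sub_smul_leftRegular (g : G) (n t : ℕ) (hg : orderOf g = n + 1)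
    (ht : Fintype.card G = (n + 1) * t) (x : R) :
    (1 - x • leftRegular R g).det = (1 - x ^ (n + 1)) ^ t := by
  classical
  obtain ⟨e, he⟩ := exists_equiv_pow_mul g n hg
  have hcard : Fintype.card (G ⧸ Subgroup.zpowers g) = t := by
    have := Fintype.card_congr e
    rw [Fintype.card_prod, Fintype.card_fin, ht] at this
    exact Nat.eq_of_mul_eq_mul_left n.succ_pos this
  have hshift : ∀ k c, g * e (k, c) = e (k + 1, c) := by
    intro k c
    have hpow : g ^ ((k.val + 1) % (n + 1)) = g ^ (k.val + 1) := by
      rw [← pow_mod_orderOf g (k.val + 1), hg]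
    rw [he, he, Fin.val_add, Fin.val_one', Nat.add_mod_mod, hpow, pow_succ', mul_assoc]
  rw [← Matrix.det_submatrix_equiv_self e]
  have : (1 - x • leftRegular R g).submatrix e e =
      Matrix.blockDiagonal fun _ : G ⧸ Subgroup.zpowers g => Matrix.of fun i j : Fin (n + 1) =>
        (if i = j then 1 else 0) - x * (if i = j + 1 then 1 else 0) := by
    ext ⟨k, c⟩ ⟨l, d⟩
    simp only [Matrix.submatrix_apply, Matrix.sub_apply, Matrix.smul_apply, leftRegular_apply,
      hshift, e.injective.eq_iff, Matrix.one_apply, Prod.mk.injEq, Matrix.blockDiagonal_apply,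
      Matrix.of_apply, smul_eq_mul]
    by_cases hcd : c = d <;> simp [hcd]
  rw [this, Matrix.det_blockDiagonal]
  simp only [det_one_sub_smul_cyclicShift, Finset.prod_const, Finset.card_univ, hcard]

end Regular

section Cycles

variable {n : ℕ}

/-- The cycle `i ↦ i + 1 ↦ ⋯ ↦ j ↦ i` of `Fin n`, for natural numbers `i ≤ j < n`. -/
def intervalCycle (n i j : ℕ) : Equiv.Perm (Fin n) :=
  if h : i ≤ j ∧ j < n then Fin.cycleIcc ⟨i, h.1.trans_lt h.2⟩ ⟨j, h.2⟩ else 1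

theorem val_intervalCycle {i j : ℕ} (hij : i ≤ j) (hj : j < n) (x : Fin n) :
    (intervalCycle n i j x).val =
      if x.val < i then x.val else if x.val < j then x.val + 1
        else if x.val = j then i else x.val := by
  have : NeZero n := ⟨by omega⟩
  rw [intervalCycle, dif_pos ⟨hij, hj⟩]
  split_ifs with h1 h2 h3
  · rw [Fin.cycleIcc_of_lt (Fin.lt_def.2 h1)]
  · rw [Fin.cycleIcc_of_ge_of_lt (Fin.le_def.2 (not_lt.1 h1)) (Fin.lt_def.2 h2)]
    exact Fin.val_add_one_of_lt' (by omega)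
  · obtain rfl : x = ⟨j, hj⟩ := Fin.ext h3
    rw [Fin.cycleIcc_of_last (Fin.le_def.2 hij)]
  · rw [Fin.cycleIcc_of_gt (Fin.lt_def.2 (by simp only; omega))]

theorem intervalCycle_self (i : ℕ) (hi : i < n) : intervalCycle n i i = 1 := by
  ext x
  rw [val_intervalCycle le_rfl hi]
  simp only [Equiv.Perm.coe_one, id_eq]
  split_ifs <;> omega

theorem orderOf_intervalCycle {i j : ℕ} (hij : i ≤ j) (hj : j < n) :
    orderOf (intervalCycle n i j) = j - i + 1 := by
  rcases hij.eq_or_lt with rfl | h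
  · simp [intervalCycle_self i hj]
  · rw [intervalCycle, dif_pos ⟨hij, hj⟩, ← Equiv.Perm.lcm_cycleType,
      Fin.cycleType_cycleIcc_of_lt (Fin.lt_def.2 h)]
    simp

theorem intervalCycle_mul_intervalCycle {a b k : ℕ} (hak : a ≤ k) (hkb : k < b) (hb : b < n) :
    intervalCycle n a b * intervalCycle n k b =
      intervalCycle n (k + 1) b * intervalCycle n a (b - 1) := by
  ext x
  simp only [Equiv.Perm.mul_apply]
  rw [val_intervalCycle (by omega) hb, val_intervalCycle (by omega) hb,
    val_intervalCycle (by omega) hb, val_intervalCycle (by omega) (by omega)]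
  split_ifs <;> omega

end Cycles

section Factor

variable {n : ℕ}

/-- The weighted sum of the cycles `(k … b)` for `a ≤ k ≤ b`, in the regular representation. -/
noncomputable def cycleSum (n a b : ℕ) :
    Matrix (Equiv.Perm (Fin n)) (Equiv.Perm (Fin n)) ℚ[X] :=
  ∑ k ∈ Finset.Icc a b, (X : ℚ[X]) ^ (b - k) • leftRegular ℚ[X] (intervalCycle n k b)

theorem one_sub_mul_cycleSum {a b : ℕ} (hab : a < b) (hb : b < n) :
    (1 - (X : ℚ[X]) ^ (b - a) • leftRegular ℚ[X] (intervalCycle n a b)) * cycleSum n a b =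
      cycleSum n (a + 1) b *
        (1 - (X : ℚ[X]) ^ (b - a + 1) • leftRegular ℚ[X] (intervalCycle n a (b - 1))) := by
  have hsum : (X : ℚ[X]) ^ (b - a) • leftRegular ℚ[X] (intervalCycle n a b) *
        ∑ k ∈ Finset.Ico a b, (X : ℚ[X]) ^ (b - k) • leftRegular ℚ[X] (intervalCycle n k b) =
      cycleSum n (a + 1) b *
        (X : ℚ[X]) ^ (b - a + 1) • leftRegular ℚ[X] (intervalCycle n a (b - 1)) := by
    have hIcc : Finset.Icc (a + 1) b = (Finset.Ico a b).image (· + 1) := by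
      rw [Finset.image_add_right_Ico]; rfl
    rw [cycleSum, hIcc, Finset.sum_image (fun _ _ _ _ h => Nat.succ_injective h), Finset.mul_sum,
      Finset.sum_mul]
    refine Finset.sum_congr rfl fun k hk => ?_
    obtain ⟨h1, h2⟩ := Finset.mem_Ico.1 hk
    rw [smul_mul_smul_comm, smul_mul_smul_comm, ← map_mul, ← map_mul,
      intervalCycle_mul_intervalCycle h1 h2 hb, ← pow_add, ← pow_add]
    congr 2
    omega
  have hfirst : cycleSum n a b = (X : ℚ[X]) ^ (b - a) • leftRegular ℚ[X] (intervalCycle n a b) +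
      cycleSum n (a + 1) b := by
    rw [cycleSum, ← Finset.insert_Icc_add_one_left_eq_Icc hab.le, Finset.sum_insert (by simp)]
    rfl
  have hlast : cycleSum n a b =
      ∑ k ∈ Finset.Ico a b, (X : ℚ[X]) ^ (b - k) • leftRegular ℚ[X] (intervalCycle n k b) + 1 := by
    rw [cycleSum, ← Finset.Ico_insert_right hab.le, Finset.sum_insert (by simp), add_comm]
    simp [intervalCycle_self b hb]
  rw [sub_mul, mul_sub, ← hsum, one_mul, mul_one]
  nth_rewrite 2 [hlast]
  rw [hfirst, mul_add, mul_one]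
  abel

theorem exists_factorial_eq {m : ℕ} (hm : 2 ≤ m) (hmn : m ≤ n) :
    n.factorial = m * (m - 1) * (n.factorial / (m * (m - 1))) := by
  refine (Nat.mul_div_cancel' (dvd_trans ?_ (Nat.factorial_dvd_factorial hmn))).symm
  obtain ⟨k, rfl⟩ := Nat.exists_eq_add_of_le' hm
  exact ⟨k.factorial, by simp [Nat.factorial_succ]; ring⟩

theorem one_sub_X_pow_ne_zero {k : ℕ} (hk : k ≠ 0) : (1 - X ^ k : ℚ[X]) ≠ 0 := by
  intro h
  have := congrArg (Polynomial.eval 0) h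
  simp [hk] at this

theorem det_cycleSum_succ {a b : ℕ} (hab : a < b) (hb : b < n) :
    (cycleSum n a b).det = (cycleSum n (a + 1) b).det *
      (1 - X ^ ((b - a + 1) * (b - a))) ^ (n.factorial / ((b - a + 1) * (b - a))) := by
  obtain ⟨d, rfl⟩ := Nat.exists_eq_add_of_lt hab
  have hd : a + d + 1 - a = d + 1 := by omega
  have hN := exists_factorial_eq (n := n) (m := d + 2) (by omega) (by omega)
  rw [hd]
  simp only [show d + 2 - 1 = d + 1 from rfl] at hN
  set t := n.factorial / ((d + 2) * (d + 1)) with ht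
  have hcard : Fintype.card (Equiv.Perm (Fin n)) = n.factorial := by
    rw [Fintype.card_perm, Fintype.card_fin]
  have h := congrArg Matrix.det (one_sub_mul_cycleSum hab hb)
  rw [Matrix.det_mul, Matrix.det_mul, hd,
    det_one_sub_smul_leftRegular _ (d + 1) ((d + 1) * t)
      (by rw [orderOf_intervalCycle (by omega) hb, hd]) (by rw [hcard, hN]; ring),
    det_one_sub_smul_leftRegular _ d ((d + 2) * t)
      (by rw [orderOf_intervalCycle (by omega) (by omega)]; omega) (by rw [hcard, hN]; ring),
    ← pow_mul, ← pow_mul, mul_comm (d + 1) (d + 1 + 1)] at h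
  have hne := one_sub_X_pow_ne_zero (k := (d + 1 + 1) * (d + 1)) (by positivity)
  refine mul_left_cancel₀ (pow_ne_zero ((d + 1) * t) hne) (h.trans ?_)
  rw [show (d + 2) * t = (d + 1) * t + t by ring, pow_add]
  ring

theorem det_cycleSum (b d : ℕ) (hd : d ≤ b) (hb : b < n) :
    (cycleSum n (b - d) b).det = ∏ m ∈ Finset.Icc 2 (d + 1),
      (1 - X ^ (m * (m - 1))) ^ (n.factorial / (m * (m - 1))) := by
  induction d with
  | zero => simp [cycleSum, intervalCycle_self b hb]
  | succ d ih =>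
    rw [det_cycleSum_succ (by omega) hb, show b - (d + 1) + 1 = b - d by omega, ih (by omega),
      show b - (b - (d + 1)) = d + 1 by omega, Finset.prod_Icc_succ_top (show 2 ≤ d + 1 + 1 by omega)]
    rfl

end Factor

section Inversions

variable {n : ℕ}

/-- The permutations of `Fin n` that fix every element `≥ b`. -/
def permsFixingFrom (n b : ℕ) : Finset (Equiv.Perm (Fin n)) :=
  Finset.univ.filter fun w => ∀ i : Fin n, b ≤ i.val → w i = i

theorem mem_permsFixingFrom {b : ℕ} {w : Equiv.Perm (Fin n)} :
    w ∈ permsFixingFrom n b ↔ ∀ i : Fin n, b ≤ i.val → w i = i := by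
  simp [permsFixingFrom]

theorem val_apply_lt_of_mem_permsFixingFrom {b : ℕ} {w : Equiv.Perm (Fin n)}
    (hw : w ∈ permsFixingFrom n b) {i : Fin n} (hi : i.val < b) : (w i).val < b := by
  by_contra! h
  have := w.injective (mem_permsFixingFrom.1 hw (w i) h)
  omega

theorem invCount_intervalCycle_mul {k b : ℕ} (hkb : k ≤ b) (hb : b < n) {v : Equiv.Perm (Fin n)}
    (hv : v ∈ permsFixingFrom n b) :
    invCount (intervalCycle n k b * v) = (b - k) + invCount v := by
  let S : Finset (Fin n × Fin n) :=
    (Finset.Ico (⟨k, hkb.trans_lt hb⟩ : Fin n) ⟨b, hb⟩).image fun x => (v⁻¹ x, ⟨b, hb⟩)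
  have hS : S.card = b - k := by
    rw [Finset.card_image_of_injective, Fin.card_Ico]
    intro x y hxy
    exact v⁻¹.injective (Prod.mk.inj hxy).1
  have mem_S : ∀ i j, (i, j) ∈ S ↔ j.val = b ∧ k ≤ (v i).val ∧ (v i).val < b := by
    intro i j
    simp only [S, Finset.mem_image, Finset.mem_Ico, Prod.mk.injEq, Fin.le_def, Fin.lt_def]
    constructor
    · rintro ⟨x, hx, rfl, rfl⟩
      simpa using hx
    · rintro ⟨hj, hi⟩
      exact ⟨v i, hi, by simp, Fin.ext hj.symm⟩
  have hfix : ∀ i : Fin n, b ≤ i.val → (v i).val = i.val := fun i hi =>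
    congrArg Fin.val (mem_permsFixingFrom.1 hv i hi)
  have hlt : ∀ i : Fin n, i.val < b → (v i).val < b := fun i hi =>
    val_apply_lt_of_mem_permsFixingFrom hv hi
  rw [← hS, invCount, invCount, ← Finset.card_union_of_disjoint]
  · congr 1
    ext ⟨i, j⟩
    simp only [Finset.mem_union, Finset.mem_filter, Finset.mem_univ, true_and, mem_S,
      Equiv.Perm.mul_apply, Fin.lt_def, val_intervalCycle hkb hb]
    have hi := hfix i
    have hj := hfix j
    have hi' := hlt i
    have hj' := hlt j
    split_ifs <;> omega
  · rw [Finset.disjoint_left]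
    rintro ⟨i, j⟩ h1 h2
    rw [mem_S] at h1
    simp only [Finset.mem_filter, Finset.mem_univ, true_and, Fin.lt_def] at h2
    have hj := hfix j
    omega

/-- The sum of `q ^ inv w • w` over the permutations `w` fixing every element `≥ b`, in the
regular representation. -/
noncomputable def inversionSum (n b : ℕ) :
    Matrix (Equiv.Perm (Fin n)) (Equiv.Perm (Fin n)) ℚ[X] :=
  ∑ w ∈ permsFixingFrom n b, (X : ℚ[X]) ^ invCount w • leftRegular ℚ[X] w

theorem inversionSum_succ {b : ℕ} (hb : b < n) :
    inversionSum n (b + 1) = cycleSum n 0 b * inversionSum n b := by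
  have hmaps : ∀ w ∈ permsFixingFrom n (b + 1), (w ⟨b, hb⟩).val ≤ b := fun w hw =>
    Nat.lt_succ_iff.1 (val_apply_lt_of_mem_permsFixingFrom hw (Nat.lt_succ_self b))
  have hcyc : ∀ {k : ℕ}, k ≤ b → ∀ {i : Fin n}, b < i.val → intervalCycle n k b i = i := by
    intro k hk i hi
    ext
    rw [val_intervalCycle hk hb]
    split_ifs <;> omega
  have hlast : ∀ {k : ℕ}, k ≤ b → (intervalCycle n k b ⟨b, hb⟩).val = k := by
    intro k hk
    rw [val_intervalCycle hk hb]
    simp only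
    split_ifs <;> omega
  have hleft : ∀ {k : ℕ} {v : Equiv.Perm (Fin n)}, k ≤ b → v ∈ permsFixingFrom n b →
      ((intervalCycle n k b * v) ⟨b, hb⟩).val = k := by
    intro k v hk hv
    rw [Equiv.Perm.mul_apply, mem_permsFixingFrom.1 hv _ le_rfl, hlast hk]
  rw [inversionSum, cycleSum, inversionSum, Finset.sum_mul_sum, ← Finset.sum_product']
  symm
  refine Finset.sum_nbij' (fun p => intervalCycle n p.1 b * p.2)
    (fun w => ((w ⟨b, hb⟩).val, (intervalCycle n (w ⟨b, hb⟩).val b)⁻¹ * w)) ?_ ?_ ?_ ?_ ?_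
  · rintro ⟨k, v⟩ h
    obtain ⟨hk, hv⟩ := Finset.mem_product.1 h
    rw [mem_permsFixingFrom] at hv ⊢
    intro i hi
    rw [Equiv.Perm.mul_apply, hv i (by omega), hcyc (Finset.mem_Icc.1 hk).2 (by omega)]
  · intro w hw
    have hwb := hmaps w hw
    refine Finset.mem_product.2 ⟨Finset.mem_Icc.2 ⟨Nat.zero_le _, hwb⟩, ?_⟩
    rw [mem_permsFixingFrom]
    intro i hi
    rw [Equiv.Perm.mul_apply, Equiv.Perm.inv_eq_iff_eq]
    rcases hi.eq_or_lt with h | h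
    · obtain rfl : i = ⟨b, hb⟩ := Fin.ext h.symm
      exact Fin.ext (hlast hwb).symm
    · rw [hcyc hwb h, mem_permsFixingFrom.1 hw i h]
  · rintro ⟨k, v⟩ h
    obtain ⟨hk, hv⟩ := Finset.mem_product.1 h
    simp only [hleft (Finset.mem_Icc.1 hk).2 hv, inv_mul_cancel_left]
  · intro w _
    exact mul_inv_cancel_left _ _
  · rintro ⟨k, v⟩ h
    obtain ⟨hk, hv⟩ := Finset.mem_product.1 h
    rw [smul_mul_smul_comm, ← map_mul, ← pow_add,
      invCount_intervalCycle_mul (Finset.mem_Icc.1 hk).2 hb hv]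

theorem inversionSum_zero : inversionSum n 0 = 1 := by
  have : permsFixingFrom n 0 = {1} := by
    ext w
    simp [mem_permsFixingFrom, Equiv.ext_iff]
  have hinv : invCount (1 : Equiv.Perm (Fin n)) = 0 := by
    refine Finset.card_eq_zero.2 (Finset.filter_eq_empty_iff.2 ?_)
    intro p _ h
    exact lt_asymm h.1 h.2
  simp [inversionSum, this, hinv]

theorem transpose_inversionSum_self :
    (inversionSum n n).transpose = Matrix.of fun u v : Equiv.Perm (Fin n) =>
      (X : ℚ[X]) ^ invCount (v * u⁻¹) := by
  have : permsFixingFrom n n = Finset.univ := by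
    ext w
    simp only [mem_permsFixingFrom, Finset.mem_univ, iff_true]
    intro i hi
    omega
  ext1 u v
  simp [inversionSum, this, Matrix.sum_apply, leftRegular_apply, ← mul_inv_eq_iff_eq_mul]

theorem det_inversionSum (b : ℕ) (hb : b ≤ n) :
    (inversionSum n b).det = ∏ m ∈ Finset.Icc 2 b,
      ((1 - X ^ (m * (m - 1))) ^ (n.factorial / (m * (m - 1)))) ^ (b + 1 - m) := by
  induction b with
  | zero => simp [inversionSum_zero]
  | succ b ih =>
    have hcycle := det_cycleSum (n := n) b b le_rfl (by omega)
    rw [Nat.sub_self] at hcycle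
    rw [inversionSum_succ (by omega), Matrix.det_mul, hcycle, ih (by omega)]
    rcases Nat.eq_zero_or_pos b with rfl | hpos
    · simp
    rw [Finset.prod_Icc_succ_top (by omega), Finset.prod_Icc_succ_top (by omega), mul_right_comm,
      ← Finset.prod_mul_distrib]
    congr 1
    · refine Finset.prod_congr rfl fun m hm => ?_
      rw [← pow_succ', show b + 1 + 1 - m = b + 1 - m + 1 by have := Finset.mem_Icc.1 hm; omega]
    · rw [show b + 1 + 1 - (b + 1) = 1 by omega, pow_one]

theorem factorial_div_mul {m : ℕ} (hm : 2 ≤ m) (hmn : m ≤ n) :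
    n.factorial / (m * (m - 1)) * (n + 1 - m) =
      n.choose m * (m - 2).factorial * (n - m + 1).factorial := by
  have hN := exists_factorial_eq hm hmn
  have hchoose := Nat.choose_mul_factorial_mul_factorial hmn
  have hfac : m.factorial = m * (m - 1) * (m - 2).factorial := by
    obtain ⟨k, rfl⟩ := Nat.exists_eq_add_of_le' hm
    simp [Nat.factorial_succ, mul_assoc]
  have hpos : 0 < m * (m - 1) := Nat.mul_pos (by omega) (by omega)
  refine Nat.eq_of_mul_eq_mul_left hpos ?_
  rw [← mul_assoc, ← hN, ← hchoose, hfac, Nat.factorial_succ, show n + 1 - m = n - m + 1 by omega]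
  ring

end Inversions

/-- Zagier: the determinant of the q-Varchenko matrix of the braid
arrangement, the `n!×n!` matrix over `ℚ[q]` with rows and columns indexed by the
symmetric group `S_n` and `(u,v)` entry `q^{inv(v u⁻¹)}`, equals
`∏_{j=2}^{n} (1 - q^{j(j-1)})^{C(n,j)·(j-2)!·(n-j+1)!}`. -/
theorem stmt19 (n : ℕ) (hn : 1 ≤ n) :
    (Matrix.of fun u v : Equiv.Perm (Fin n) =>
        (Polynomial.X : Polynomial ℚ) ^ invCount (v * u⁻¹)).det =
      ∏ j ∈ Finset.Icc 2 n,
        (1 - (Polynomial.X : Polynomial ℚ) ^ (j * (j - 1))) ^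
          (Nat.choose n j * Nat.factorial (j - 2) * Nat.factorial (n - j + 1)) := by
  rw [← transpose_inversionSum_self, Matrix.det_transpose, det_inversionSum n le_rfl]
  refine Finset.prod_congr rfl fun m hm => ?_
  obtain ⟨h1, h2⟩ := Finset.mem_Icc.1 hm
  rw [← pow_mul, factorial_div_mul h1 h2]
end
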